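/- Assume that the exponent δ of ψ satisfies δ > 1, that there exists a nondecreasing function W : [0,∞) → [0,∞) with ∫_0^∞ e^{−λx} W(x) dx = 1/ψ(λ) for all λ > 0 (the scale function), and that W satisfies hypothesis (H): for every β ∈ (0,1), limsup_{x → 0+} W(βx)/W(x) < 1. Then almost surely limsup_{t → 0+} (Y − Ȳ)_{(T_0 − t)^−} · φ⁻¹(t) / log log φ⁻¹(t) = 1, where Ȳ_s := inf_{u ≤ s} Y_u is the running infimum of Y and (Y − Ȳ)_{s^−} denotes the left limit at s of the reflected process Y − Ȳ. -/

import Mathlib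

open MeasureTheory Filter Set Topology
open scoped ENNReal

namespace CSBP

/-- The compensated integrand of the Lévy–Khintchine representation. -/
noncomputable def levyIntegrand (l x : ℝ) : ℝ :=
  Real.exp (-l * x) - 1 + l * x * Set.indicator (Set.Iio 1) (fun _ => (1 : ℝ)) x

lemma exp_neg_le_quadratic {r : ℝ} (hr : 0 ≤ r) : Real.exp (-r) ≤ 1 - r + r ^ 2 / 2 := by
  have h1 := Real.quadratic_le_exp_of_nonneg hr
  have h2 : Real.exp (-r) * Real.exp r = 1 := by rw [← Real.exp_add]; simp
  have h3 := Real.exp_pos (-r)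
  have h4 : Real.exp (-r) * (1 + r + r ^ 2 / 2) ≤ 1 := by nlinarith
  have h5 : 0 < 1 + r + r ^ 2 / 2 := by positivity
  have h6 : 1 ≤ (1 - r + r ^ 2 / 2) * (1 + r + r ^ 2 / 2) := by nlinarith [sq_nonneg (r ^ 2)]
  exact le_of_mul_le_mul_right (h4.trans h6) h5

lemma exp_compensated_doubling {r : ℝ} (hr : 0 ≤ r) :
    Real.exp (-(2 * r)) - 1 + 2 * r ≤ 8 * (Real.exp (-r) - 1 + r) := by
  rcases le_total r 2 with h | h
  · have h1 := exp_neg_le_quadratic (r := 2 * r) (by positivity)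
    have h2 : Real.exp (-r) = Real.exp (-(r / 2)) ^ 2 := by
      rw [← Real.exp_nat_mul]; congr 1; push_cast; ring
    have h3 := Real.add_one_le_exp (-(r / 2))
    have h4 : (1 - r / 2) ^ 2 ≤ Real.exp (-(r / 2)) ^ 2 :=
      pow_le_pow_left₀ (by linarith) (by linarith) 2
    rw [h2]; nlinarith
  · have h1 : Real.exp (-(2 * r)) ≤ 1 := Real.exp_le_one_iff.2 (by linarith)
    have h2 := Real.exp_pos (-r)
    linarith

lemma levyIntegrand_eq_of_lt {l x : ℝ} (hx : x < 1) :
    levyIntegrand l x = Real.exp (-(l * x)) - 1 + l * x := by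
  simp [levyIntegrand, hx]

lemma levyIntegrand_eq_of_le {l x : ℝ} (hx : 1 ≤ x) :
    levyIntegrand l x = Real.exp (-(l * x)) - 1 := by
  simp [levyIntegrand, not_lt.2 hx]

lemma levyIntegrand_le {l x : ℝ} (hl : 0 ≤ l) (hx : 0 < x) :
    levyIntegrand l x ≤ l ^ 2 * min 1 (x ^ 2) := by
  rcases lt_or_ge x 1 with h | h
  · rw [levyIntegrand_eq_of_lt h, min_eq_right (by nlinarith)]
    have := exp_neg_le_quadratic (r := l * x) (by positivity)
    nlinarith [sq_nonneg (l * x)]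
  · rw [levyIntegrand_eq_of_le h]
    have : Real.exp (-(l * x)) ≤ 1 := Real.exp_le_one_iff.2 (by nlinarith)
    have : 0 ≤ l ^ 2 * min 1 (x ^ 2) := by positivity
    linarith

lemma neg_min_le_levyIntegrand {l x : ℝ} (hx : 0 < x) :
    -min 1 (x ^ 2) ≤ levyIntegrand l x := by
  rcases lt_or_ge x 1 with h | h
  · rw [levyIntegrand_eq_of_lt h]
    have := Real.add_one_le_exp (-(l * x))
    have : 0 ≤ min 1 (x ^ 2) := by positivity
    linarith
  · rw [levyIntegrand_eq_of_le h, min_eq_left (by nlinarith)]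
    have := Real.exp_pos (-(l * x))
    linarith

lemma levyIntegrand_doubling {l x : ℝ} (hl : 0 ≤ l) (hx : 0 < x) :
    levyIntegrand (2 * l) x ≤ 8 * levyIntegrand l x + 8 * min 1 (x ^ 2) := by
  rcases lt_or_ge x 1 with h | h
  · rw [levyIntegrand_eq_of_lt h, levyIntegrand_eq_of_lt h]
    have := exp_compensated_doubling (r := l * x) (by positivity)
    have : 0 ≤ min 1 (x ^ 2) := by positivity
    rw [mul_assoc 2 l x]
    linarith
  · rw [levyIntegrand_eq_of_le h, levyIntegrand_eq_of_le h, min_eq_left (by nlinarith)]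
    have := Real.exp_pos (-(l * x))
    have : Real.exp (-(2 * l * x)) ≤ 1 := Real.exp_le_one_iff.2 (by nlinarith [mul_nonneg hl hx.le])
    linarith

lemma integrable_min_one_sq {ν : Measure ℝ}
    (hνint : ∫⁻ x, ENNReal.ofReal (min 1 (x ^ 2)) ∂ν ≠ ⊤) :
    Integrable (fun x : ℝ => min 1 (x ^ 2)) ν := by
  refine ⟨by fun_prop, ?_⟩
  rw [hasFiniteIntegral_iff_ofReal (Eventually.of_forall fun x => by positivity)]
  exact lt_top_iff_ne_top.2 hνint

lemma ae_pos_of_Iic_null {ν : Measure ℝ} (hνsupp : ν (Set.Iic 0) = 0) : ∀ᵐ x ∂ν, 0 < x := by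
  rw [ae_iff]; simpa [not_lt, Set.Iic] using hνsupp

lemma integrable_levyIntegrand {ν : Measure ℝ} (hνsupp : ν (Set.Iic 0) = 0)
    (hνint : ∫⁻ x, ENNReal.ofReal (min 1 (x ^ 2)) ∂ν ≠ ⊤) {l : ℝ} (hl : 0 ≤ l) :
    Integrable (levyIntegrand l) ν := by
  refine ((integrable_min_one_sq hνint).const_mul (1 + l ^ 2)).mono' ?_ ?_
  · have : Measurable (levyIntegrand l) := by
      unfold levyIntegrand
      have : Measurable (Set.indicator (Set.Iio (1 : ℝ)) (fun _ => (1 : ℝ))) :=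
        measurable_const.indicator measurableSet_Iio
      fun_prop
    exact this.aestronglyMeasurable
  · filter_upwards [ae_pos_of_Iic_null hνsupp] with x hx
    have h1 := levyIntegrand_le hl hx
    have h2 := neg_min_le_levyIntegrand (l := l) hx
    have h3 : 0 ≤ min 1 (x ^ 2) := by positivity
    rw [Real.norm_eq_abs, abs_le]
    constructor <;> nlinarith [mul_nonneg (sq_nonneg l) h3]

lemma exists_quadratic_bound {ψ : ℝ → ℝ} {a b : ℝ} (hb : 0 ≤ b) {ν : Measure ℝ}
    (hνsupp : ν (Set.Iic 0) = 0)
    (hνint : ∫⁻ x, ENNReal.ofReal (min 1 (x ^ 2)) ∂ν ≠ ⊤)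
    (hψform : ∀ l : ℝ, 0 ≤ l → ψ l = a * l + b * l ^ 2 + ∫ x, levyIntegrand l x ∂ν) :
    ∃ C : ℝ, 0 < C ∧ ∀ u : ℝ, 1 ≤ u → ψ u ≤ C * u ^ 2 := by
  set K := ∫ x, min 1 (x ^ 2) ∂ν with hK
  have hK0 : 0 ≤ K := integral_nonneg fun x => by positivity
  refine ⟨|a| + b + K + 1, by positivity, fun u hu => ?_⟩
  have hu0 : 0 ≤ u := by linarith
  have h1 : ∫ x, levyIntegrand u x ∂ν ≤ u ^ 2 * K := by
    rw [hK, ← integral_const_mul]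
    refine integral_mono_ae (integrable_levyIntegrand hνsupp hνint hu0)
      ((integrable_min_one_sq hνint).const_mul _) ?_
    filter_upwards [ae_pos_of_Iic_null hνsupp] with x hx using levyIntegrand_le hu0 hx
  rw [hψform u hu0]
  have h2 : a * u ≤ |a| * u ^ 2 := by
    have h3 := mul_le_mul_of_nonneg_right (le_abs_self a) hu0
    have h4 := mul_le_mul_of_nonneg_left (show u ≤ u ^ 2 by nlinarith) (abs_nonneg a)
    linarith
  nlinarith [sq_nonneg u]

lemma exists_doubling_bound {ψ : ℝ → ℝ} {a b : ℝ} (hb : 0 ≤ b) {ν : Measure ℝ}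
    (hνsupp : ν (Set.Iic 0) = 0)
    (hνint : ∫⁻ x, ENNReal.ofReal (min 1 (x ^ 2)) ∂ν ≠ ⊤)
    (hψform : ∀ l : ℝ, 0 ≤ l → ψ l = a * l + b * l ^ 2 + ∫ x, levyIntegrand l x ∂ν)
    {c : ℝ} (hc : 0 < c) (hlin : ∀ u : ℝ, 1 ≤ u → c * u ≤ ψ u) :
    ∃ C : ℝ, 1 ≤ C ∧ ∀ u : ℝ, 1 ≤ u → ψ (2 * u) ≤ C * ψ u := by
  set K := ∫ x, min 1 (x ^ 2) ∂ν with hK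
  have hK0 : 0 ≤ K := integral_nonneg fun x => by positivity
  refine ⟨8 + (6 * |a| + 8 * K) / c, by
    have : 0 ≤ (6 * |a| + 8 * K) / c := by positivity
    linarith, fun u hu => ?_⟩
  have hu0 : 0 ≤ u := by linarith
  have h1 : ∫ x, levyIntegrand (2 * u) x ∂ν ≤ 8 * (∫ x, levyIntegrand u x ∂ν) + 8 * K := by
    have i1 := (integrable_levyIntegrand hνsupp hνint hu0).const_mul 8
    have i2 := (integrable_min_one_sq hνint).const_mul 8
    rw [hK, ← integral_const_mul, ← integral_const_mul, ← integral_add i1 i2]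
    refine integral_mono_ae (integrable_levyIntegrand hνsupp hνint (by positivity)) (i1.add i2) ?_
    filter_upwards [ae_pos_of_Iic_null hνsupp] with x hx using levyIntegrand_doubling hu0 hx
  have h2 : -6 * (a * u) ≤ 6 * |a| * u := by
    have := neg_le_abs a
    nlinarith
  have h3 : (6 * |a| + 8 * K) * u ≤ (6 * |a| + 8 * K) / c * ψ u := by
    have := hlin u hu
    have h4 : 0 ≤ (6 * |a| + 8 * K) / c := by positivity
    calc (6 * |a| + 8 * K) * u = (6 * |a| + 8 * K) / c * (c * u) := by field_simp
      _ ≤ _ := mul_le_mul_of_nonneg_left this h4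
  have e1 := hψform u hu0
  have e2 := hψform (2 * u) (by positivity)
  nlinarith [mul_nonneg hb (sq_nonneg u), mul_nonneg hK0 (sub_nonneg.2 hu)]

lemma integrable_exp_mul_scale {ψ W : ℝ → ℝ} (hψpos : ∀ u : ℝ, 0 < u → 0 < ψ u)
    (hWlaplace : ∀ lam : ℝ, 0 < lam →
      ∫ y in Set.Ioi (0 : ℝ), Real.exp (-lam * y) * W y = (ψ lam)⁻¹) {l : ℝ} (hl : 0 < l) :
    IntegrableOn (fun y => Real.exp (-l * y) * W y) (Ioi 0) := by
  by_contra h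
  have := hWlaplace l hl
  rw [integral_undef h] at this
  exact (inv_pos.2 (hψpos l hl)).ne this

lemma monotoneOn_of_laplace {ψ W : ℝ → ℝ} (hψpos : ∀ u : ℝ, 0 < u → 0 < ψ u)
    (hWnonneg : ∀ y : ℝ, 0 ≤ y → 0 ≤ W y)
    (hWlaplace : ∀ lam : ℝ, 0 < lam →
      ∫ y in Set.Ioi (0 : ℝ), Real.exp (-lam * y) * W y = (ψ lam)⁻¹) :
    MonotoneOn ψ (Ioi 0) := by
  intro l hl m hm hlm
  rw [← inv_le_inv₀ (hψpos m hm) (hψpos l hl), ← hWlaplace l hl, ← hWlaplace m hm]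
  refine setIntegral_mono_on (integrable_exp_mul_scale hψpos hWlaplace hm)
    (integrable_exp_mul_scale hψpos hWlaplace hl) measurableSet_Ioi fun y hy => ?_
  have hy' : 0 < y := hy
  refine mul_le_mul_of_nonneg_right (Real.exp_le_exp.2 ?_) (hWnonneg y hy'.le)
  nlinarith

lemma continuousOn_of_laplace {ψ W : ℝ → ℝ} (hψpos : ∀ u : ℝ, 0 < u → 0 < ψ u)
    (hWnonneg : ∀ y : ℝ, 0 ≤ y → 0 ≤ W y)
    (hWlaplace : ∀ lam : ℝ, 0 < lam →
      ∫ y in Set.Ioi (0 : ℝ), Real.exp (-lam * y) * W y = (ψ lam)⁻¹) :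
    ContinuousOn (fun u => (ψ u)⁻¹) (Ioi 0) := by
  intro l hl
  have hl' : 0 < l := hl
  refine ContinuousAt.continuousWithinAt ?_
  have hev : (fun u => (ψ u)⁻¹) =ᶠ[𝓝 l]
      fun u => ∫ y in Set.Ioi (0 : ℝ), Real.exp (-u * y) * W y := by
    filter_upwards [lt_mem_nhds hl'] with u hu using (hWlaplace u hu).symm
  refine ContinuousAt.congr ?_ hev.symm
  have hi := integrable_exp_mul_scale hψpos hWlaplace (half_pos hl')
  refine continuousAt_of_dominated (bound := fun y => Real.exp (-(l / 2) * y) * W y) ?_ ?_ hi ?_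
  · filter_upwards [lt_mem_nhds hl'] with u hu
    exact (integrable_exp_mul_scale hψpos hWlaplace hu).1
  · filter_upwards [lt_mem_nhds (half_lt_self hl')] with u hu
    filter_upwards [ae_restrict_mem measurableSet_Ioi] with y hy
    have hy' : 0 < y := hy
    rw [Real.norm_eq_abs, abs_of_nonneg (mul_nonneg (Real.exp_pos _).le (hWnonneg y hy'.le))]
    refine mul_le_mul_of_nonneg_right (Real.exp_le_exp.2 ?_) (hWnonneg y hy'.le)
    nlinarith
  · refine Eventually.of_forall fun y => ?_
    fun_prop

/-- The pair `(φ, φinv)` attached to a branching mechanism `ψ` satisfying Grey's condition. -/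
structure GreyExponent (ψ φ φinv : ℝ → ℝ) : Prop where
  pos : ∀ u : ℝ, 0 < u → 0 < ψ u
  mono : MonotoneOn ψ (Ioi 0)
  cont : ContinuousOn (fun u => (ψ u)⁻¹) (Ioi 0)
  integ : ∀ t : ℝ, 0 < t → IntegrableOn (fun u => (ψ u)⁻¹) (Ioi t)
  phi_eq : ∀ t : ℝ, 0 < t → φ t = ∫ u in Ioi t, (ψ u)⁻¹
  phi_anti : StrictAntiOn φ (Ioi 0)
  phi_pos : ∀ t : ℝ, 0 < t → 0 < φ t
  inv_pos : ∀ s : ℝ, 0 < s → 0 < φinv s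
  invl : ∀ t : ℝ, 0 < t → φinv (φ t) = t
  invr : ∀ s : ℝ, 0 < s → φ (φinv s) = s

namespace GreyExponent

variable {ψ φ φinv : ℝ → ℝ} (h : GreyExponent ψ φ φinv)
include h

lemma inv_anti : StrictAntiOn φinv (Ioi 0) := by
  intro s hs t ht hst
  by_contra! hle
  have h1 := h.phi_anti.antitoneOn (h.inv_pos s hs) (h.inv_pos t ht) hle
  rw [h.invr s hs, h.invr t ht] at h1
  exact absurd hst (not_lt.2 h1)

lemma inv_le_iff {s u : ℝ} (hs : 0 < s) (hu : 0 < u) : φinv s ≤ u ↔ φ u ≤ s := by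
  rw [← h.phi_anti.le_iff_ge hu (h.inv_pos s hs), h.invr s hs]

lemma le_inv_iff {s u : ℝ} (hs : 0 < s) (hu : 0 < u) : u ≤ φinv s ↔ s ≤ φ u := by
  rw [← h.phi_anti.le_iff_ge (h.inv_pos s hs) hu, h.invr s hs]

lemma lt_inv_iff {s u : ℝ} (hs : 0 < s) (hu : 0 < u) : u < φinv s ↔ s < φ u := by
  rw [← not_le, h.inv_le_iff hs hu, not_le]

lemma inv_continuousAt {s : ℝ} (hs : 0 < s) : ContinuousAt φinv s := by
  have hmono : StrictMonoOn (fun t => -φinv t) (Ioi 0) := fun a ha b hb hab =>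
    neg_lt_neg (h.inv_anti ha hb hab)
  have himg : (fun t => -φinv t) '' Ioi 0 = Iio 0 := by
    ext r
    constructor
    · rintro ⟨t, ht, rfl⟩
      exact neg_lt_zero.2 (h.inv_pos t ht)
    · intro hr
      have hr' : 0 < -r := by simpa using hr
      exact ⟨φ (-r), h.phi_pos _ hr', by simp [h.invl _ hr']⟩
  have h1 : ContinuousAt (fun t => -φinv t) s :=
    hmono.continuousAt_of_image_mem_nhds (Ioi_mem_nhds hs)
      (himg ▸ Iio_mem_nhds (neg_lt_zero.2 (h.inv_pos s hs)))
  have h2 : φinv = fun t => -(-φinv t) := by simp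
  rw [h2]
  exact h1.neg

lemma tendsto_inv_zero : Tendsto φinv (𝓝[>] 0) atTop := by
  refine tendsto_atTop.2 fun b => ?_
  have hm : 0 < max b 1 := by positivity
  filter_upwards [Ioo_mem_nhdsGT (h.phi_pos _ hm)] with s hs
  exact (le_max_left b 1).trans ((h.le_inv_iff hs.1 hm).2 hs.2.le)

lemma tendsto_inv_atTop : Tendsto φinv atTop (𝓝 0) := by
  rw [tendsto_order]
  constructor
  · intro a ha
    filter_upwards [eventually_gt_atTop 0] with s hs using ha.trans (h.inv_pos s hs)
  · intro a ha
    filter_upwards [eventually_ge_atTop (φ (a / 2)), eventually_gt_atTop 0] with s hs hs0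
    have := (h.inv_le_iff hs0 (half_pos ha)).2 hs
    linarith

lemma tendsto_phi_atTop : Tendsto φ atTop (𝓝 0) := by
  rw [tendsto_order]
  constructor
  · intro a ha
    filter_upwards [eventually_gt_atTop 0] with s hs using ha.trans (h.phi_pos s hs)
  · intro a ha
    filter_upwards [eventually_gt_atTop (φinv a)] with s hs
    have h1 := h.inv_pos a ha
    have := h.phi_anti h1 (h1.trans hs) hs
    rwa [h.invr a ha] at this

lemma phi_sub {u v : ℝ} (hu : 0 < u) (huv : u ≤ v) :
    φ u - φ v = ∫ w in Ioc u v, (ψ w)⁻¹ := by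
  have hv : 0 < v := hu.trans_le huv
  rw [h.phi_eq u hu, h.phi_eq v hv, ← Ioc_union_Ioi_eq_Ioi huv,
    setIntegral_union (Set.Ioc_disjoint_Ioi le_rfl) measurableSet_Ioi
      ((h.integ u hu).mono_set Ioc_subset_Ioi_self) (h.integ v hv)]
  ring

lemma sub_div_le_phi_sub {u v : ℝ} (hu : 0 < u) (huv : u ≤ v) :
    (v - u) / ψ v ≤ φ u - φ v := by
  have hv : 0 < v := hu.trans_le huv
  rw [h.phi_sub hu huv]
  have h1 : ∫ _ in Ioc u v, (ψ v)⁻¹ = (v - u) / ψ v := by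
    simp [huv, div_eq_mul_inv]
  rw [← h1]
  refine setIntegral_mono_on (by simp) ((h.integ u hu).mono_set Ioc_subset_Ioi_self)
    measurableSet_Ioc fun w hw => ?_
  have hw0 : 0 < w := hu.trans hw.1
  exact inv_anti₀ (h.pos w hw0) (h.mono hw0 hv hw.2)

lemma add_pos {s l : ℝ} (hs : 0 ≤ s) (hl : 0 < l) : 0 < φinv (s + φ l) :=
  h.inv_pos _ (by have := h.phi_pos l hl; linarith)

/-- The cumulant semigroup decreases at rate at most `ψ`. -/
lemma sub_le_cumulant {s l : ℝ} (hs : 0 ≤ s) (hl : 0 < l) :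
    l - s * ψ l ≤ φinv (s + φ l) := by
  have hp := h.phi_pos l hl
  have hsp : 0 < s + φ l := by linarith
  have hv := h.inv_pos _ hsp
  have hvl : φinv (s + φ l) ≤ l := (h.inv_le_iff hsp hl).2 (by linarith)
  have h1 := h.sub_div_le_phi_sub hv hvl
  rw [h.invr _ hsp, div_le_iff₀ (h.pos l hl)] at h1
  nlinarith

end GreyExponent

/-- Quantitative regularity of a branching mechanism at infinity. -/
structure RegularExponent (ψ φ φinv : ℝ → ℝ) : Prop extends GreyExponent ψ φ φinv where
  quadratic : ∃ C : ℝ, 0 < C ∧ ∀ u : ℝ, 1 ≤ u → ψ u ≤ C * u ^ 2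
  doubling : ∃ C : ℝ, 1 ≤ C ∧ ∀ u : ℝ, 1 ≤ u → ψ (2 * u) ≤ C * ψ u
  power : ∃ c Q : ℝ, 1 < c ∧ 0 < Q ∧
    ∀ u v : ℝ, 1 ≤ u → u ≤ v → Q * ψ u * u ^ (-c) ≤ ψ v * v ^ (-c)

lemma exists_linear_lower_bound {ψ : ℝ → ℝ} (hψpos : ∀ u : ℝ, 0 < u → 0 < ψ u) {c Q : ℝ}
    (hc : 1 < c) (hQ : 0 < Q)
    (hpow : ∀ u v : ℝ, 1 ≤ u → u ≤ v → Q * ψ u * u ^ (-c) ≤ ψ v * v ^ (-c)) :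
    ∃ k : ℝ, 0 < k ∧ ∀ u : ℝ, 1 ≤ u → k * u ≤ ψ u := by
  refine ⟨Q * ψ 1, mul_pos hQ (hψpos 1 one_pos), fun u hu => ?_⟩
  have h1 := hpow 1 u le_rfl hu
  have hu0 : 0 < u := by linarith
  rw [Real.one_rpow, mul_one, Real.rpow_neg hu0.le, ← div_eq_mul_inv,
    le_div_iff₀ (Real.rpow_pos_of_pos hu0 c)] at h1
  have h2 : u ≤ u ^ c := by
    simpa using Real.rpow_le_rpow_of_exponent_le hu hc.le
  exact (mul_le_mul_of_nonneg_left h2 (mul_pos hQ (hψpos 1 one_pos)).le).trans h1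

namespace RegularExponent

variable {ψ φ φinv : ℝ → ℝ} (h : RegularExponent ψ φ φinv)
include h

lemma exists_phi_mul_psi_le : ∃ C : ℝ, 0 < C ∧ ∀ u : ℝ, 1 ≤ u → φ u * ψ u ≤ C * u := by
  obtain ⟨c, Q, hc, hQ, hpow⟩ := h.power
  refine ⟨1 / (Q * (c - 1)), by have : 0 < c - 1 := by linarith
                                positivity, fun u hu => ?_⟩
  have hu0 : 0 < u := by linarith
  have hψ := h.pos u hu0
  have hc1 : 0 < c - 1 := by linarith
  have hle : φ u ≤ ∫ v in Ioi u, u ^ c / (Q * ψ u) * v ^ (-c) := by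
    rw [h.phi_eq u hu0]
    refine setIntegral_mono_on (h.integ u hu0)
      ((integrableOn_Ioi_rpow_of_lt (by linarith) hu0).const_mul _) measurableSet_Ioi
      fun v hv => ?_
    have hv' : u < v := hv
    have hv0 : 0 < v := hu0.trans hv'
    have h1 := hpow u v hu hv'.le
    have hψv := h.pos v hv0
    have huc : 0 < u ^ c := Real.rpow_pos_of_pos hu0 c
    have hvc : 0 < v ^ (-c) := Real.rpow_pos_of_pos hv0 _
    rw [Real.rpow_neg hu0.le] at h1
    rw [inv_le_iff_one_le_mul₀ hψv]
    have h2 : 1 ≤ (ψ v * v ^ (-c)) / (Q * ψ u * (u ^ c)⁻¹) := by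
      rw [le_div_iff₀ (by positivity)]; linarith
    calc (1 : ℝ) ≤ _ := h2
      _ = _ := by field_simp
  rw [integral_const_mul, integral_Ioi_rpow_of_lt (by linarith) hu0] at hle
  have huc : u ^ c * u ^ (-c + 1) = u := by
    rw [← Real.rpow_add hu0]; simp
  calc φ u * ψ u ≤ (u ^ c / (Q * ψ u) * (-u ^ (-c + 1) / (-c + 1))) * ψ u :=
        mul_le_mul_of_nonneg_right hle hψ.le
    _ = (u ^ c * u ^ (-c + 1)) / (Q * (c - 1)) := by
        have : -c + 1 ≠ 0 := by linarith
        have : c - 1 ≠ 0 := hc1.ne'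
        rw [show -c + 1 = -(c - 1) by ring]
        field_simp
    _ = _ := by rw [huc]; ring

lemma exists_le_phi_mul_psi : ∃ c : ℝ, 0 < c ∧ ∀ u : ℝ, 1 ≤ u → c * u ≤ φ u * ψ u := by
  obtain ⟨C, hC, hd⟩ := h.doubling
  refine ⟨C⁻¹, by positivity, fun u hu => ?_⟩
  have hu0 : 0 < u := by linarith
  have h1 := h.sub_div_le_phi_sub hu0 (show u ≤ 2 * u by linarith)
  have h2 := h.phi_pos (2 * u) (by linarith)
  have hψ := h.pos u hu0
  have hψ2 := h.pos (2 * u) (by linarith)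
  have h3 : u / (C * ψ u) ≤ φ u := by
    calc u / (C * ψ u) ≤ u / ψ (2 * u) := by gcongr; exact hd u hu
      _ = (2 * u - u) / ψ (2 * u) := by ring
      _ ≤ _ := by linarith
  calc C⁻¹ * u = u / (C * ψ u) * ψ u := by field_simp
    _ ≤ _ := mul_le_mul_of_nonneg_right h3 hψ.le

lemma exists_phi_mul_le {η : ℝ} (hη : 0 < η) :
    ∃ M : ℝ, 1 ≤ M ∧ ∀ u : ℝ, 1 ≤ u → φ (M * u) ≤ η * φ u := by
  obtain ⟨c, Q, hc, hQ, hpow⟩ := h.power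
  obtain ⟨C, hC, hup⟩ := h.exists_phi_mul_psi_le
  obtain ⟨k, hk, hlow⟩ := h.exists_le_phi_mul_psi
  have hlim : Tendsto (fun M : ℝ => C / (Q * k) * M ^ (-(c - 1))) atTop (𝓝 (C / (Q * k) * 0)) :=
    (tendsto_rpow_neg_atTop (by linarith)).const_mul _
  rw [mul_zero] at hlim
  obtain ⟨M, hM, hM1⟩ := ((hlim.eventually (ge_mem_nhds hη)).and (eventually_ge_atTop 1)).exists
  refine ⟨M, hM1, fun u hu => ?_⟩
  have hu0 : 0 < u := by linarith
  have hM0 : 0 < M := by linarith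
  have hMu : u ≤ M * u := by nlinarith
  have h1 := hpow u (M * u) hu hMu
  have h2 := hup (M * u) (hu.trans hMu)
  have h3 := hlow u hu
  have hψ := h.pos u hu0
  have hψM := h.pos (M * u) (by positivity)
  have huc : 0 < u ^ (-c) := Real.rpow_pos_of_pos hu0 _
  rw [Real.mul_rpow hM0.le hu0.le] at h1
  have h4 : Q * ψ u ≤ ψ (M * u) * M ^ (-c) := by
    refine le_of_mul_le_mul_right ?_ huc
    linarith
  have hφM := h.phi_pos (M * u) (by positivity)
  have hMc : M ^ (-(c - 1)) = M ^ (-c) * M := by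
    rw [show -(c - 1) = -c + 1 by ring, Real.rpow_add hM0, Real.rpow_one]
  have hMc0 : 0 < M ^ (-c) := Real.rpow_pos_of_pos hM0 _
  have h5 : φ (M * u) * (Q * ψ u) ≤ C / k * M ^ (-(c - 1)) * φ u * ψ u := by
    calc φ (M * u) * (Q * ψ u) ≤ φ (M * u) * (ψ (M * u) * M ^ (-c)) :=
          mul_le_mul_of_nonneg_left h4 hφM.le
      _ = (φ (M * u) * ψ (M * u)) * M ^ (-c) := by ring
      _ ≤ (C * (M * u)) * M ^ (-c) := mul_le_mul_of_nonneg_right h2 hMc0.le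
      _ = C / k * M ^ (-(c - 1)) * (k * u) := by rw [hMc]; field_simp
      _ ≤ C / k * M ^ (-(c - 1)) * (φ u * ψ u) := by
          refine mul_le_mul_of_nonneg_left h3 ?_
          rw [hMc]; positivity
      _ = _ := by ring
  have h6 : φ (M * u) ≤ C / (Q * k) * M ^ (-(c - 1)) * φ u := by
    refine le_of_mul_le_mul_right (h5.trans_eq ?_) (mul_pos hQ hψ)
    field_simp
  exact h6.trans (mul_le_mul_of_nonneg_right hM (h.phi_pos u hu0).le)

lemma exists_le_of_phi_le : ∃ C : ℝ, 0 < C ∧ ∀ u v η : ℝ, 0 < u → 1 ≤ v → 0 ≤ η →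
    φ u ≤ (1 + η) * φ v → (1 - η * C) * v ≤ u := by
  obtain ⟨C, hC, hup⟩ := h.exists_phi_mul_psi_le
  refine ⟨C, hC, fun u v η hu hv hη hle => ?_⟩
  rcases le_total v u with hvu | huv
  · have : 0 ≤ η * C * v := by positivity
    linarith
  · have h1 := h.sub_div_le_phi_sub hu huv
    have hψ := h.pos v (by linarith)
    rw [div_le_iff₀ hψ] at h1
    have h2 := mul_le_mul_of_nonneg_left (hup v hv) hη
    nlinarith

/-- Comparison of the inverse at two nearby times. -/
lemma exists_inv_comparison : ∃ C : ℝ, 0 < C ∧ ∀ s t η : ℝ, 0 < s → 0 < t → 0 ≤ η →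
    1 ≤ φinv s → t ≤ (1 + η) * s → (1 - η * C) * φinv s ≤ φinv t := by
  obtain ⟨C, hC, hcmp⟩ := h.exists_le_of_phi_le
  refine ⟨C, hC, fun s t η hs ht hη hv hle => ?_⟩
  refine hcmp _ _ η (h.inv_pos t ht) hv hη ?_
  rwa [h.invr t ht, h.invr s hs]

end RegularExponent

/-- Telescoping of the integral of an increment of an antitone function vanishing at infinity. -/
lemma lintegral_sub_shift {k : ℝ → ℝ} {a b : ℝ} (ha : 0 < a) (hab : a ≤ b)
    (hk : AntitoneOn k (Ioi 0)) (hk0 : Tendsto k atTop (𝓝 0)) :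
    ∫⁻ s in Ioi 0, ENNReal.ofReal (k (s + a) - k (s + b)) =
      ENNReal.ofReal (∫ t in a..b, k t) := by
  have hii : ∀ u v : ℝ, 0 < u → 0 < v → IntervalIntegrable k volume u v := fun u v hu hv =>
    (hk.mono fun x hx => lt_of_lt_of_le (lt_min hu hv) hx.1).intervalIntegrable
  have hint_on : ∀ N : ℝ, 0 ≤ N → ∀ c : ℝ, 0 < c →
      IntervalIntegrable (fun s => k (s + c)) volume 0 N := fun N hN c hc => by
    have := (hii c (N + c) hc (by linarith)).comp_add_right c
    simpa using this
  have hnn : ∀ s : ℝ, 0 < s → 0 ≤ k (s + a) - k (s + b) := fun s hs =>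
    sub_nonneg.2 (hk (show 0 < s + a by linarith) (show 0 < s + b by linarith) (by linarith))
  have hF : ∀ N : ℝ, 0 ≤ N → ∫ s in (0 : ℝ)..N, (k (s + a) - k (s + b)) =
      (∫ t in a..b, k t) - ∫ t in (N + a)..(N + b), k t := fun N hN => by
    rw [intervalIntegral.integral_sub (hint_on N hN a ha) (hint_on N hN b (by linarith)),
      intervalIntegral.integral_comp_add_right, intervalIntegral.integral_comp_add_right,
      zero_add, zero_add]
    have h1 := intervalIntegral.integral_add_adjacent_intervals
      (hii a b ha (by linarith)) (hii b (N + b) (by linarith) (by linarith))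
    have h2 := intervalIntegral.integral_add_adjacent_intervals
      (hii a (N + a) ha (by linarith)) (hii (N + a) (N + b) (by linarith) (by linarith))
    linarith
  have hrem : Tendsto (fun N : ℝ => ∫ t in (N + a)..(N + b), k t) atTop (𝓝 0) := by
    have hlim : Tendsto (fun N : ℝ => ∫ t in a..b, k (t + N)) atTop
        (𝓝 (∫ t in a..b, (0 : ℝ))) := by
      refine intervalIntegral.tendsto_integral_filter_of_dominated_convergence
        (fun t => |k t|) ?_ ?_ ((hii a b ha (by linarith)).abs) ?_
      · filter_upwards [eventually_ge_atTop 0] with N hN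
        have := (hii (a + N) (b + N) (by linarith) (by linarith)).comp_add_right N
        simp only [add_sub_cancel_right] at this
        rw [uIoc_of_le hab]
        exact this.1.aestronglyMeasurable
      · filter_upwards [eventually_ge_atTop 0] with N hN
        refine Eventually.of_forall fun t ht => ?_
        rw [uIoc_of_le hab] at ht
        have ht0 : 0 < t := ha.trans ht.1
        have hnn' : ∀ r : ℝ, 0 < r → 0 ≤ k r := fun r hr => by
          refine le_of_tendsto hk0 ?_
          filter_upwards [eventually_ge_atTop r] with r' hr'
          exact hk hr (hr.trans_le hr') hr'
        rw [Real.norm_eq_abs, abs_of_nonneg (hnn' _ (by linarith)), abs_of_nonneg (hnn' _ ht0)]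
        exact hk ht0 (show 0 < t + N by linarith) (by linarith)
      · refine Eventually.of_forall fun t _ => ?_
        exact hk0.comp (tendsto_atTop_add_const_left _ t tendsto_id)
    simp only [intervalIntegral.integral_zero] at hlim
    refine hlim.congr fun N => ?_
    rw [intervalIntegral.integral_comp_add_right, add_comm a, add_comm b]
  have hlim : Tendsto (fun N : ℝ => ∫ s in (0 : ℝ)..N, (k (s + a) - k (s + b))) atTop
      (𝓝 (∫ t in a..b, k t)) := by
    have := (tendsto_const_nhds (x := ∫ t in a..b, k t)).sub hrem
    rw [sub_zero] at this
    refine this.congr' ?_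
    filter_upwards [eventually_ge_atTop 0] with N hN using (hF N hN).symm
  have hI : IntegrableOn (fun s => k (s + a) - k (s + b)) (Ioi 0) := by
    refine integrableOn_Ioi_of_intervalIntegral_norm_tendsto (l := atTop) (b := id)
      (∫ t in a..b, k t) 0 ?_ tendsto_id ?_
    · intro N
      rcases le_total 0 N with hN | hN
      · exact ((hint_on N hN a ha).sub (hint_on N hN b (by linarith))).1
      · simp [Ioc_eq_empty (not_lt.2 hN)]
    · refine hlim.congr' ?_
      filter_upwards [eventually_ge_atTop 0] with N hN
      refine intervalIntegral.integral_congr_ae (Eventually.of_forall fun s hs => ?_)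
      rw [uIoc_of_le hN] at hs
      exact (Real.norm_of_nonneg (hnn s hs.1)).symm
  rw [← ofReal_integral_eq_lintegral_ofReal hI
    ((ae_restrict_iff' measurableSet_Ioi).2 (Eventually.of_forall hnn))]
  congr 1
  exact tendsto_nhds_unique (intervalIntegral_tendsto_integral_Ioi 0 hI tendsto_id) hlim

namespace GreyExponent

variable {ψ φ φinv : ℝ → ℝ} (h : GreyExponent ψ φ φinv)
include h

lemma hasDerivAt_phi {v : ℝ} (hv : 0 < v) : HasDerivAt φ (-(ψ v)⁻¹) v := by
  have hc : 0 < v / 2 := half_pos hv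
  have h1 : HasDerivAt (fun u => ∫ w in (v / 2)..u, (ψ w)⁻¹) ((ψ v)⁻¹) v := by
    refine intervalIntegral.integral_hasDerivAt_right ?_ ?_ (h.cont.continuousAt (Ioi_mem_nhds hv))
    · rw [intervalIntegrable_iff_integrableOn_Ioc_of_le (by linarith)]
      exact (h.integ _ hc).mono_set Ioc_subset_Ioi_self
    · exact h.cont.stronglyMeasurableAtFilter isOpen_Ioi v hv
  have h2 : HasDerivAt (fun u => φ (v / 2) - ∫ w in (v / 2)..u, (ψ w)⁻¹) (-(ψ v)⁻¹) v := by
    simpa using h1.const_sub (φ (v / 2))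
  refine h2.congr_of_eventuallyEq ?_
  filter_upwards [lt_mem_nhds (half_lt_self hv)] with u hu
  rw [intervalIntegral.integral_of_le hu.le, ← h.phi_sub hc hu.le]
  ring

lemma image_phi_Ioo {l m : ℝ} (hl : 0 < l) (hm : 0 < m) :
    φ '' Ioo l m = Ioo (φ m) (φ l) := by
  ext t
  constructor
  · rintro ⟨v, hv, rfl⟩
    have hv0 : 0 < v := hl.trans hv.1
    exact ⟨h.phi_anti hv0 hm hv.2, h.phi_anti hl hv0 hv.1⟩
  · rintro ⟨h1, h2⟩
    have ht : 0 < t := (h.phi_pos m hm).trans h1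
    refine ⟨φinv t, ⟨(h.lt_inv_iff ht hl).2 h2, ?_⟩, h.invr t ht⟩
    rw [← not_le, h.le_inv_iff ht hm, not_le]
    exact h1

/-- Integral over time of an increment of the Laplace functional of the process. -/
lemma lintegral_cumulant_sub {z l m : ℝ} (hz : 0 ≤ z) (hl : 0 < l) (hlm : l ≤ m) :
    ∫⁻ s in Ioi 0, ENNReal.ofReal
        (Real.exp (-z * φinv (s + φ l)) - Real.exp (-z * φinv (s + φ m))) =
      ∫⁻ v in Ioo l m, ENNReal.ofReal ((ψ v)⁻¹ * (1 - Real.exp (-z * v))) := by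
  have hm : 0 < m := hl.trans_le hlm
  have hφ : φ m ≤ φ l := h.phi_anti.antitoneOn hl hm hlm
  set k : ℝ → ℝ := fun t => 1 - Real.exp (-z * φinv t) with hk
  have hka : AntitoneOn k (Ioi 0) := fun s hs t ht hst => by
    have := h.inv_anti.antitoneOn hs ht hst
    simp only [hk]
    gcongr 1 - Real.exp ?_
    nlinarith
  have hk0 : Tendsto k atTop (𝓝 0) := by
    have h1 := (Real.continuous_exp.tendsto 0).comp
      (by simpa using (h.tendsto_inv_atTop.const_mul (-z)) :
        Tendsto (fun t => -z * φinv t) atTop (𝓝 0))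
    have h2 := h1.const_sub 1
    simpa [hk, Function.comp_def] using h2
  have hknn : ∀ t, 0 < t → 0 ≤ k t := fun t ht => by
    simp only [hk, sub_nonneg, Real.exp_le_one_iff]
    nlinarith [h.inv_pos t ht]
  have h1 := lintegral_sub_shift (h.phi_pos m hm) hφ hka hk0
  have h2 : (fun s => ENNReal.ofReal (k (s + φ m) - k (s + φ l))) = fun s => ENNReal.ofReal
      (Real.exp (-z * φinv (s + φ l)) - Real.exp (-z * φinv (s + φ m))) := by
    ext s; congr 1; simp only [hk]; ring
  rw [← h2, h1, intervalIntegral.integral_of_le hφ,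
    integral_Ioc_eq_integral_Ioo, ofReal_integral_eq_lintegral_ofReal, ← h.image_phi_Ioo hl hm,
    lintegral_image_eq_lintegral_deriv_mul_of_antitoneOn measurableSet_Ioo
      (fun v hv => (h.hasDerivAt_phi (hl.trans hv.1)).hasDerivWithinAt)
      (h.phi_anti.antitoneOn.mono fun v hv => hl.trans hv.1)]
  · refine setLIntegral_congr_fun measurableSet_Ioo fun v hv => ?_
    have hv0 : 0 < v := hl.trans hv.1
    simp only [hk, neg_neg, h.invl v hv0]
    rw [← ENNReal.ofReal_mul (inv_nonneg.2 (h.pos v hv0).le)]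
  · refine IntegrableOn.mono_set ?_ Ioo_subset_Icc_self
    exact (hka.mono fun x hx => (h.phi_pos m hm).trans_le hx.1).integrableOn_isCompact isCompact_Icc
  · exact (ae_restrict_iff' measurableSet_Ioo).2
      (Eventually.of_forall fun t ht => hknn t ((h.phi_pos m hm).trans ht.1))

end GreyExponent

/-- The scale function extended by zero to the negative half-line. -/
noncomputable def scaleExt (W : ℝ → ℝ) (r : ℝ) : ℝ := (Ioi 0).indicator W r

section Scale

variable {W : ℝ → ℝ}

lemma scaleExt_of_pos {r : ℝ} (hr : 0 < r) : scaleExt W r = W r := indicator_of_mem hr W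

lemma scaleExt_of_nonpos {r : ℝ} (hr : r ≤ 0) : scaleExt W r = 0 :=
  indicator_of_notMem (not_lt.2 hr) W

lemma scaleExt_monotone (hWnonneg : ∀ y : ℝ, 0 ≤ y → 0 ≤ W y) (hWmono : MonotoneOn W (Ici 0)) :
    Monotone (scaleExt W) := by
  intro r s hrs
  rcases le_or_gt r 0 with hr | hr
  · rw [scaleExt_of_nonpos hr]
    exact indicator_nonneg (fun y (hy : 0 < y) => hWnonneg y hy.le) s
  · rw [scaleExt_of_pos hr, scaleExt_of_pos (hr.trans_le hrs)]
    exact hWmono hr.le (hr.trans_le hrs).le hrs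

lemma integral_exp_mul_scaleExt_sub {ψ : ℝ → ℝ} (hψpos : ∀ u : ℝ, 0 < u → 0 < ψ u)
    (hWlaplace : ∀ lam : ℝ, 0 < lam →
      ∫ y in Set.Ioi (0 : ℝ), Real.exp (-lam * y) * W y = (ψ lam)⁻¹) {v z : ℝ} (hv : 0 < v) :
    Integrable (fun w => Real.exp (-v * w) * scaleExt W (w - z)) ∧
      ∫ w, Real.exp (-v * w) * scaleExt W (w - z) = Real.exp (-z * v) * (ψ v)⁻¹ := by
  have h0 : (fun w => Real.exp (-v * w) * scaleExt W w) =
      (Ioi 0).indicator fun w => Real.exp (-v * w) * W w := by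
    ext w; by_cases hw : w ∈ Ioi (0 : ℝ) <;> simp [scaleExt, hw]
  have hi : Integrable (fun w => Real.exp (-v * w) * scaleExt W w) := by
    rw [h0, integrable_indicator_iff measurableSet_Ioi]
    exact integrable_exp_mul_scale hψpos hWlaplace hv
  have he : ∫ w, Real.exp (-v * w) * scaleExt W w = (ψ v)⁻¹ := by
    rw [h0, integral_indicator measurableSet_Ioi, hWlaplace v hv]
  have hs : (fun w => Real.exp (-v * w) * scaleExt W (w - z)) =
      fun w => Real.exp (-z * v) * (Real.exp (-v * (w - z)) * scaleExt W (w - z)) := by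
    ext w
    rw [← mul_assoc, ← Real.exp_add]
    congr 2; ring
  rw [hs]
  refine ⟨(hi.comp_sub_right z).const_mul _, ?_⟩
  rw [integral_const_mul, integral_sub_right_eq_self
    (fun w => Real.exp (-v * w) * scaleExt W w) z, he]

/-- Laplace transform of the potential density of the process started from `z`. -/
lemma lintegral_potential_density {ψ : ℝ → ℝ} (hψpos : ∀ u : ℝ, 0 < u → 0 < ψ u)
    (hWnonneg : ∀ y : ℝ, 0 ≤ y → 0 ≤ W y) (hWmono : MonotoneOn W (Ici 0))
    (hWlaplace : ∀ lam : ℝ, 0 < lam →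
      ∫ y in Set.Ioi (0 : ℝ), Real.exp (-lam * y) * W y = (ψ lam)⁻¹) {z l m : ℝ}
    (hz : 0 ≤ z) (hl : 0 < l) (hlm : l ≤ m) :
    ∫⁻ w in Ioi 0, ENNReal.ofReal (Real.exp (-l * w) - Real.exp (-m * w)) *
        ENNReal.ofReal ((scaleExt W w - scaleExt W (w - z)) / w) =
      ∫⁻ v in Ioo l m, ENNReal.ofReal ((ψ v)⁻¹ * (1 - Real.exp (-z * v))) := by
  have hmono := scaleExt_monotone hWnonneg hWmono
  have hmeas := hmono.measurable
  have hnn : ∀ w, 0 ≤ scaleExt W w - scaleExt W (w - z) := fun w =>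
    sub_nonneg.2 (hmono (by linarith))
  have hexp : ∀ w : ℝ, 0 < w → ENNReal.ofReal (Real.exp (-l * w) - Real.exp (-m * w)) =
      ∫⁻ v in Ioo l m, ENNReal.ofReal (w * Real.exp (-v * w)) := by
    intro w hw
    have hd : ∀ v ∈ uIcc l m, HasDerivAt (fun v => -Real.exp (-v * w))
        (w * Real.exp (-v * w)) v := by
      intro v _
      have h1 : HasDerivAt (fun v : ℝ => -v * w) (-w) v := by
        simpa using (hasDerivAt_id v).neg.mul_const w
      have h2 := h1.exp.fun_neg
      rwa [show -(Real.exp (-v * w) * -w) = w * Real.exp (-v * w) by ring] at h2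
    have hc : Continuous fun v : ℝ => w * Real.exp (-v * w) := by fun_prop
    have h2 := intervalIntegral.integral_eq_sub_of_hasDerivAt hd (hc.intervalIntegrable l m)
    rw [← ofReal_integral_eq_lintegral_ofReal
      (hc.integrableOn_Icc.mono_set Ioo_subset_Icc_self)
      (Eventually.of_forall fun v => by positivity), ← integral_Ioc_eq_integral_Ioo,
      ← intervalIntegral.integral_of_le hlm, h2]
    congr 1; ring
  calc ∫⁻ w in Ioi 0, ENNReal.ofReal (Real.exp (-l * w) - Real.exp (-m * w)) *
        ENNReal.ofReal ((scaleExt W w - scaleExt W (w - z)) / w)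
      = ∫⁻ w in Ioi 0, ∫⁻ v in Ioo l m,
          ENNReal.ofReal (Real.exp (-v * w) * (scaleExt W w - scaleExt W (w - z))) := by
        refine setLIntegral_congr_fun measurableSet_Ioi fun w hw => ?_
        have hw0 : 0 < w := hw
        rw [hexp w hw, ← lintegral_mul_const' _ _ ENNReal.ofReal_ne_top]
        refine lintegral_congr fun v => ?_
        rw [← ENNReal.ofReal_mul (by positivity)]
        congr 1
        field_simp
    _ = ∫⁻ v in Ioo l m, ∫⁻ w in Ioi 0,
          ENNReal.ofReal (Real.exp (-v * w) * (scaleExt W w - scaleExt W (w - z))) := by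
        rw [lintegral_lintegral_swap]
        refine Measurable.aemeasurable ?_
        fun_prop
    _ = _ := by
        refine setLIntegral_congr_fun measurableSet_Ioo fun v hv => ?_
        have hv0 : 0 < v := hl.trans hv.1
        have hi0 := integral_exp_mul_scaleExt_sub hψpos hWlaplace (z := 0) hv0
        have hiz := integral_exp_mul_scaleExt_sub hψpos hWlaplace (z := z) hv0
        simp only [sub_zero, neg_zero, zero_mul, Real.exp_zero, one_mul] at hi0
        have heq : ∀ w, Real.exp (-v * w) * (scaleExt W w - scaleExt W (w - z)) =
            Real.exp (-v * w) * scaleExt W w - Real.exp (-v * w) * scaleExt W (w - z) :=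
          fun w => by ring
        have hsupp : ∫⁻ w in Ioi 0,
            ENNReal.ofReal (Real.exp (-v * w) * (scaleExt W w - scaleExt W (w - z))) =
            ∫⁻ w, ENNReal.ofReal
              (Real.exp (-v * w) * (scaleExt W w - scaleExt W (w - z))) := by
          rw [← lintegral_indicator measurableSet_Ioi]
          refine lintegral_congr fun w => ?_
          by_cases hw : w ∈ Ioi (0 : ℝ)
          · simp [hw]
          · have hw' : w ≤ 0 := not_lt.1 hw
            simp [hw, scaleExt_of_nonpos hw', scaleExt_of_nonpos (show w - z ≤ 0 by linarith)]
        rw [hsupp, ← ofReal_integral_eq_lintegral_ofReal]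
        · simp_rw [heq]
          rw [integral_sub hi0.1 hiz.1, hi0.2, hiz.2]
          congr 1; ring
        · simp_rw [heq]
          exact hi0.1.sub hiz.1
        · exact Eventually.of_forall fun w => mul_nonneg (Real.exp_pos _).le (hnn w)

end Scale

section Uniqueness

open BoundedContinuousFunction Polynomial

/-- A finite measure on `[0, ∞)` is determined by its Laplace transform at the integers. -/
lemma nnreal_measure_ext {ρ₁ ρ₂ : Measure NNReal} [IsFiniteMeasure ρ₁] [IsFiniteMeasure ρ₂]
    (heq : ∀ k : ℕ, ∫ w, Real.exp (-(k : ℝ) * w) ∂ρ₁ = ∫ w, Real.exp (-(k : ℝ) * w) ∂ρ₂) :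
    ρ₁ = ρ₂ := by
  let g : NNReal →ᵇ ℝ := BoundedContinuousFunction.ofNormedAddCommGroup
    (fun w : NNReal => Real.exp (-(w : ℝ))) (by fun_prop) 1
    (fun w => by simp)
  let A : StarSubalgebra ℝ (NNReal →ᵇ ℝ) :=
    { (Polynomial.aeval g : ℝ[X] →ₐ[ℝ] (NNReal →ᵇ ℝ)).range with
      star_mem' := fun {f} hf => by
        have : star f = f := by ext; simp
        rw [this]; exact hf }
  have hpow : ∀ (n : ℕ) (w : NNReal), (g ^ n : NNReal →ᵇ ℝ) w = Real.exp (-(n : ℝ) * w) := by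
    intro n w
    rw [BoundedContinuousFunction.pow_apply]
    change Real.exp (-(w : ℝ)) ^ n = _
    rw [← Real.exp_nat_mul]; congr 1; ring
  refine ext_of_forall_mem_subalgebra_integral_eq_of_polish (𝕜 := ℝ) (A := A) ?_ ?_
  · intro a b hab
    refine ⟨g, ⟨g.toContinuousMap, ⟨g, ⟨Polynomial.X, by simp⟩, rfl⟩, rfl⟩, ?_⟩
    change Real.exp (-(a : ℝ)) ≠ Real.exp (-(b : ℝ))
    intro he
    have := Real.exp_injective he
    exact hab (NNReal.coe_injective (neg_injective this))
  · rintro f ⟨p, rfl⟩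
    change ∫ w, (aeval g p : NNReal →ᵇ ℝ) w ∂ρ₁ = ∫ w, (aeval g p : NNReal →ᵇ ℝ) w ∂ρ₂
    induction p using Polynomial.induction_on' with
    | add p q hp hq =>
      simp only [map_add, BoundedContinuousFunction.coe_add, Pi.add_apply]
      rw [integral_add (BoundedContinuousFunction.integrable _ _)
          (BoundedContinuousFunction.integrable _ _),
        integral_add (BoundedContinuousFunction.integrable _ _)
          (BoundedContinuousFunction.integrable _ _), hp, hq]
    | monomial n c =>
      have : ∀ w, (aeval g (Polynomial.monomial n c) : NNReal →ᵇ ℝ) w =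
          c * Real.exp (-(n : ℝ) * w) := by
        intro w
        rw [Polynomial.aeval_monomial, BoundedContinuousFunction.mul_apply, hpow]
        congr 1
      simp_rw [this, integral_const_mul, heq n]

/-- Laplace increments determine a measure on `(0, ∞)`. -/
lemma restrict_Ioi_ext {μ₁ μ₂ : Measure ℝ}
    (hfin : ∀ l m : ℝ, 0 < l → l ≤ m → ∫⁻ w in Ioi 0,
      ENNReal.ofReal (Real.exp (-l * w) - Real.exp (-m * w)) ∂μ₁ ≠ ⊤)
    (heq : ∀ l m : ℝ, 0 < l → l ≤ m → ∫⁻ w in Ioi 0,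
      ENNReal.ofReal (Real.exp (-l * w) - Real.exp (-m * w)) ∂μ₁ = ∫⁻ w in Ioi 0,
      ENNReal.ofReal (Real.exp (-l * w) - Real.exp (-m * w)) ∂μ₂) :
    μ₁.restrict (Ioi 0) = μ₂.restrict (Ioi 0) := by
  set d : ℝ → ℝ≥0∞ := fun w => ENNReal.ofReal (Real.exp (-1 * w) - Real.exp (-2 * w)) with hd
  have hdm : Measurable d := by fun_prop
  have hdpos : ∀ w ∈ Ioi (0 : ℝ), d w ≠ 0 := fun w hw => by
    have hw' : 0 < w := hw
    simp only [hd, ne_eq, ENNReal.ofReal_eq_zero, not_le, sub_pos, Real.exp_lt_exp]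
    linarith
  have key : ∀ (μ : Measure ℝ) (k : ℕ),
      ∫⁻ w, ENNReal.ofReal (Real.exp (-(k : ℝ) * (w : NNReal)))
        ∂(((μ.restrict (Ioi 0)).withDensity d).map Real.toNNReal) =
      ∫⁻ w in Ioi 0, ENNReal.ofReal
        (Real.exp (-((k : ℝ) + 1) * w) - Real.exp (-((k : ℝ) + 2) * w)) ∂μ := by
    intro μ k
    rw [lintegral_map (by fun_prop) measurable_real_toNNReal,
      lintegral_withDensity_eq_lintegral_mul _ hdm (by fun_prop)]
    refine setLIntegral_congr_fun measurableSet_Ioi fun w hw => ?_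
    have hw' : 0 < w := hw
    simp only [Pi.mul_apply, hd]
    rw [Real.coe_toNNReal _ hw'.le, ← ENNReal.ofReal_mul' (Real.exp_pos _).le, sub_mul,
      ← Real.exp_add, ← Real.exp_add]
    congr 3 <;> ring
  have hmass : ∀ μ : Measure ℝ, ∫⁻ w in Ioi 0,
      ENNReal.ofReal (Real.exp (-1 * w) - Real.exp (-2 * w)) ∂μ ≠ ⊤ →
      IsFiniteMeasure ((μ.restrict (Ioi 0)).withDensity d) := fun μ hμ =>
    isFiniteMeasure_withDensity hμ
  have hf1 := hmass μ₁ (hfin 1 2 one_pos (by norm_num))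
  have hf2 := hmass μ₂ (heq 1 2 one_pos (by norm_num) ▸ hfin 1 2 one_pos (by norm_num))
  have hmap : ((μ₁.restrict (Ioi 0)).withDensity d).map Real.toNNReal =
      ((μ₂.restrict (Ioi 0)).withDensity d).map Real.toNNReal := by
    refine nnreal_measure_ext fun k => ?_
    rw [integral_eq_lintegral_of_nonneg_ae (Eventually.of_forall fun w => (Real.exp_pos _).le)
        (by fun_prop),
      integral_eq_lintegral_of_nonneg_ae (Eventually.of_forall fun w => (Real.exp_pos _).le)
        (by fun_prop), key, key, heq _ _ (by positivity) (by linarith)]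
  ext s hs
  have hback : ∀ (μ : Measure ℝ) (f : ℝ → ℝ≥0∞), Measurable f →
      ∫⁻ w, f w * (d w)⁻¹ ∂(((μ.restrict (Ioi 0)).withDensity d).map Real.toNNReal).map
        ((↑) : NNReal → ℝ) = ∫⁻ w in Ioi 0, f w ∂μ := by
    intro μ f hf
    rw [lintegral_map (by fun_prop) (by fun_prop), lintegral_map (by fun_prop) (by fun_prop),
      lintegral_withDensity_eq_lintegral_mul _ hdm (by fun_prop)]
    refine setLIntegral_congr_fun measurableSet_Ioi fun w hw => ?_
    have hw' : 0 < w := hw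
    simp only [Pi.mul_apply]
    rw [Real.coe_toNNReal _ hw'.le, mul_comm, mul_assoc,
      ENNReal.inv_mul_cancel (hdpos w hw) ENNReal.ofReal_ne_top, mul_one]
  have h1 := hback μ₁ (s.indicator 1) (measurable_one.indicator hs)
  have h2 := hback μ₂ (s.indicator 1) (measurable_one.indicator hs)
  rw [← lintegral_indicator_one hs, ← lintegral_indicator_one hs, ← h1, ← h2, hmap]

end Uniqueness

/-- The information generated by the process up to time `t`. -/
abbrev past {Ω : Type*} (Y : ℝ → Ω → ℝ) (t : ℝ) : MeasurableSpace Ω :=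
  ⨆ u ∈ Set.Icc (0 : ℝ) t, MeasurableSpace.comap (Y u) inferInstance

/-- A right-continuous process with the Markov branching property. -/
structure BranchingProcess {Ω : Type*} [MeasurableSpace Ω] (φ φinv : ℝ → ℝ) (P : Measure Ω)
    (Y : ℝ → Ω → ℝ) : Prop where
  meas : ∀ t : ℝ, Measurable (Y t)
  nonneg : ∀ t : ℝ, 0 ≤ t → ∀ ω, 0 ≤ Y t ω
  right : ∀ ω, ∀ t : ℝ, 0 ≤ t → ContinuousWithinAt (fun s => Y s ω) (Set.Ici t) t
  markov : ∀ s t : ℝ, 0 ≤ s → 0 ≤ t → ∀ lam : ℝ, 0 < lam →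
      P[(fun ω => Real.exp (-lam * Y (t + s) ω)) | past Y t]
        =ᵐ[P] fun ω => Real.exp (-(Y t ω) * φinv (s + φ lam))

/-- A domination inequality that holds before each time transfers to the union of a countable
adapted family of events. -/
lemma measure_biUnion_le_of_past {Ω : Type*} [MeasurableSpace Ω] {F : ℝ → MeasurableSpace Ω}
    (hF : Monotone F) (hle : ∀ t, F t ≤ ‹MeasurableSpace Ω›) {D : Set ℝ} (hD : D.Countable)
    {E : ℝ → Set Ω} (hE : ∀ p ∈ D, MeasurableSet[F p] (E p)) {μ m : Measure Ω}
    (hμ : ∀ p ∈ D, ∀ G : Set Ω, MeasurableSet[F p] G → G ⊆ E p → μ G ≤ m G) :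
    μ (⋃ p ∈ D, E p) ≤ m (⋃ p ∈ D, E p) := by
  have hfin : ∀ A : Finset ℝ, (∀ p ∈ A, p ∈ D) → μ (⋃ p ∈ A, E p) ≤ m (⋃ p ∈ A, E p) := by
    intro A
    induction A using Finset.induction_on_max with
    | empty => simp
    | insert a A hA ih =>
      intro hAD
      have hA' : ∀ p ∈ A, p ∈ D := fun p hp => hAD p (Finset.mem_insert_of_mem hp)
      have haD := hAD a (Finset.mem_insert_self a A)
      have hUm : MeasurableSet[F a] (⋃ p ∈ A, E p) :=
        MeasurableSet.biUnion A.countable_toSet fun p hp => hF (hA p hp).le _ (hE p (hA' p hp))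
      have hGm : MeasurableSet[F a] (E a \ ⋃ p ∈ A, E p) := (hE a haD).diff hUm
      have heq : (⋃ p ∈ insert a A, E p) = (⋃ p ∈ A, E p) ∪ (E a \ ⋃ p ∈ A, E p) := by
        rw [Finset.set_biUnion_insert, union_sdiff_self, union_comm]
      rw [heq, measure_union disjoint_sdiff_self_right (hle a _ hGm),
        measure_union disjoint_sdiff_self_right (hle a _ hGm)]
      exact add_le_add (ih hA') (hμ a haD _ hGm sdiff_subset)
  rcases D.eq_empty_or_nonempty with rfl | hne
  · simp
  · obtain ⟨e, rfl⟩ := hD.exists_eq_range hne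
    rw [biUnion_range, measure_iUnion_eq_iSup_accumulate]
    refine iSup_le fun n => ?_
    have : accumulate (fun n => E (e n)) n = ⋃ p ∈ (Finset.range (n + 1)).image e, E p := by
      ext ω; simp [accumulate_def]
    rw [this]
    refine (hfin _ fun p hp => ?_).trans (measure_mono ?_)
    · obtain ⟨i, -, rfl⟩ := Finset.mem_image.1 hp
      exact mem_range_self i
    · refine iUnion₂_subset fun p hp => ?_
      obtain ⟨i, -, rfl⟩ := Finset.mem_image.1 hp
      exact subset_iUnion (fun n => E (e n)) i

lemma lintegral_mul_eq_of_forall_setLIntegral_eq {Ω : Type*} {m m0 : MeasurableSpace Ω}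
    (hm : m ≤ m0) {P : Measure Ω} {A B : Ω → ℝ≥0∞} (hA : Measurable A)
    (hB : Measurable B) (h : ∀ G, MeasurableSet[m] G → ∫⁻ ω in G, A ω ∂P = ∫⁻ ω in G, B ω ∂P)
    {f : Ω → ℝ≥0∞} (hf : Measurable[m] f) : ∫⁻ ω, f ω * A ω ∂P = ∫⁻ ω, f ω * B ω ∂P := by
  have htrim : (P.withDensity A).trim hm = (P.withDensity B).trim hm := by
    refine @Measure.ext _ m _ _ fun G hG => ?_
    rw [trim_measurableSet_eq hm hG, trim_measurableSet_eq hm hG, withDensity_apply _ (hm _ hG),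
      withDensity_apply _ (hm _ hG), h G hG]
  have h1 : ∫⁻ ω, f ω ∂(P.withDensity A) = ∫⁻ ω, f ω ∂(P.withDensity B) := by
    rw [← lintegral_trim hm hf, htrim, lintegral_trim hm hf]
  rw [lintegral_withDensity_eq_lintegral_mul _ hA (hf.mono hm le_rfl),
    lintegral_withDensity_eq_lintegral_mul _ hB (hf.mono hm le_rfl)] at h1
  simpa [mul_comm] using h1

lemma measurable_indicator_one_of {Ω : Type*} {m : MeasurableSpace Ω} {G : Set Ω}
    (hG : MeasurableSet[m] G) : Measurable[m] (G.indicator (1 : Ω → ℝ≥0∞)) :=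
  measurable_one.indicator hG

lemma setLIntegral_eq_lintegral_indicator_mul {Ω : Type*} [MeasurableSpace Ω] {P : Measure Ω}
    {G : Set Ω} (hG : MeasurableSet G) (f : Ω → ℝ≥0∞) :
    ∫⁻ ω in G, f ω ∂P = ∫⁻ ω, G.indicator 1 ω * f ω ∂P := by
  rw [← lintegral_indicator hG]
  refine lintegral_congr fun ω => ?_
  by_cases hω : ω ∈ G <;> simp [hω]

lemma past_mono {Ω : Type*} (Y : ℝ → Ω → ℝ) : Monotone (past Y) := fun _ _ hst =>
  biSup_mono fun _ hu => ⟨hu.1, hu.2.trans hst⟩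

lemma measurable_past {Ω : Type*} (Y : ℝ → Ω → ℝ) {s t : ℝ} (hs : 0 ≤ s) (hst : s ≤ t) :
    Measurable[past Y t] (Y s) :=
  (comap_measurable (Y s)).mono
    (le_iSup₂_of_le (f := fun u (_ : u ∈ Icc (0 : ℝ) t) =>
      MeasurableSpace.comap (Y u) inferInstance) s ⟨hs, hst⟩ le_rfl) le_rfl

namespace BranchingProcess

variable {Ω : Type*} [mΩ : MeasurableSpace Ω] {ψ φ φinv : ℝ → ℝ} {P : Measure Ω}
  {Y : ℝ → Ω → ℝ}

lemma past_le (hY : BranchingProcess φ φinv P Y) (t : ℝ) : past Y t ≤ mΩ :=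
  iSup₂_le fun u _ => (hY.meas u).comap_le

variable [IsProbabilityMeasure P]

lemma lintegral_mul_exp (hY : BranchingProcess φ φinv P Y) (h : GreyExponent ψ φ φinv) {s t l : ℝ}
    (hs : 0 ≤ s) (ht : 0 ≤ t) (hl : 0 < l) {f : Ω → ℝ≥0∞} (hf : Measurable[past Y t] f) :
    ∫⁻ ω, f ω * ENNReal.ofReal (Real.exp (-l * Y (t + s) ω)) ∂P =
      ∫⁻ ω, f ω * ENNReal.ofReal (Real.exp (-(Y t ω) * φinv (s + φ l))) ∂P := by
  have m1 := hY.meas (t + s)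
  have m2 := hY.meas t
  refine lintegral_mul_eq_of_forall_setLIntegral_eq (m := past Y t) (m0 := mΩ) (hY.past_le t)
    (A := fun ω => ENNReal.ofReal (Real.exp (-l * Y (t + s) ω)))
    (B := fun ω => ENNReal.ofReal (Real.exp (-(Y t ω) * φinv (s + φ l)))) (by fun_prop)
    (by fun_prop) (fun G hG => ?_) hf
  have hint_on : Integrable (fun ω => Real.exp (-l * Y (t + s) ω)) P := by
    refine Integrable.of_bound (C := 1) (by fun_prop) (Eventually.of_forall fun ω => ?_)
    rw [Real.norm_of_nonneg (Real.exp_pos _).le, Real.exp_le_one_iff]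
    have := hY.nonneg (t + s) (by linarith) ω
    nlinarith
  have hint2 : Integrable (fun ω => Real.exp (-(Y t ω) * φinv (s + φ l))) P := by
    refine Integrable.of_bound (C := 1) (by fun_prop) (Eventually.of_forall fun ω => ?_)
    rw [Real.norm_of_nonneg (Real.exp_pos _).le, Real.exp_le_one_iff]
    have := hY.nonneg t ht ω
    have := h.add_pos hs hl
    nlinarith
  have h1 := setIntegral_condExp (hY.past_le t) hint_on hG
  rw [setIntegral_congr_ae (hY.past_le t _ hG)
    ((hY.markov s t hs ht l hl).mono fun ω hω _ => hω)] at h1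
  rw [← ofReal_integral_eq_lintegral_ofReal hint_on.integrableOn
      (Eventually.of_forall fun ω => (Real.exp_pos _).le),
    ← ofReal_integral_eq_lintegral_ofReal hint2.integrableOn
      (Eventually.of_forall fun ω => (Real.exp_pos _).le), h1]

lemma lintegral_mul_extinct (hY : BranchingProcess φ φinv P Y) (h : GreyExponent ψ φ φinv)
    {s t : ℝ} (hs : 0 < s) (ht : 0 ≤ t) {f : Ω → ℝ≥0∞} (hf : Measurable[past Y t] f) :
    ∫⁻ ω, f ω * {ω | Y (t + s) ω = 0}.indicator 1 ω ∂P =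
      ∫⁻ ω, f ω * ENNReal.ofReal (Real.exp (-(Y t ω) * φinv s)) ∂P := by
  have m1 := hY.meas (t + s)
  have m2 := hY.meas t
  have hVm : MeasurableSet {ω | Y (t + s) ω = 0} := m1 (measurableSet_singleton 0)
  refine lintegral_mul_eq_of_forall_setLIntegral_eq (m := past Y t) (m0 := mΩ) (hY.past_le t)
    (A := {ω | Y (t + s) ω = 0}.indicator 1)
    (B := fun ω => ENNReal.ofReal (Real.exp (-(Y t ω) * φinv s)))
    (measurable_indicator_one_of hVm) (by fun_prop) (fun G hG => ?_) hf
  have hle1 : ∀ (a b : ℝ), 0 ≤ a → 0 ≤ b → ENNReal.ofReal (Real.exp (-a * b)) ≤ 1 := by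
    intro a b ha hb
    rw [ENNReal.ofReal_le_one, Real.exp_le_one_iff]
    nlinarith
  have hlim1 : Tendsto (fun n : ℕ => ∫⁻ ω in G,
      ENNReal.ofReal (Real.exp (-((n : ℝ) + 1) * Y (t + s) ω)) ∂P) atTop
      (𝓝 (∫⁻ ω in G, {ω | Y (t + s) ω = 0}.indicator 1 ω ∂P)) := by
    refine tendsto_lintegral_of_dominated_convergence (fun _ => 1) (fun n => by fun_prop)
      (fun n => Eventually.of_forall fun ω =>
        hle1 _ _ (by positivity) (hY.nonneg _ (by linarith) ω)) (by simp)
      (Eventually.of_forall fun ω => ?_)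
    rcases (hY.nonneg (t + s) (by linarith) ω).eq_or_lt with h0 | h0
    · rw [indicator_of_mem (show ω ∈ {ω | Y (t + s) ω = 0} from h0.symm)]
      simp [← h0]
    · rw [indicator_of_notMem (show ω ∉ {ω | Y (t + s) ω = 0} from h0.ne')]
      have h2 : Tendsto (fun n : ℕ => Real.exp (-((n : ℝ) + 1) * Y (t + s) ω)) atTop (𝓝 0) := by
        refine Real.tendsto_exp_atBot.comp ?_
        simp only [neg_mul]
        refine tendsto_neg_atTop_atBot.comp (Tendsto.atTop_mul_const h0 ?_)
        exact tendsto_atTop_add_const_right _ _ tendsto_natCast_atTop_atTop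
      simpa using ENNReal.tendsto_ofReal h2
  have hlim2 : Tendsto (fun n : ℕ => ∫⁻ ω in G,
      ENNReal.ofReal (Real.exp (-(Y t ω) * φinv (s + φ ((n : ℝ) + 1)))) ∂P) atTop
      (𝓝 (∫⁻ ω in G, ENNReal.ofReal (Real.exp (-(Y t ω) * φinv s)) ∂P)) := by
    refine tendsto_lintegral_of_dominated_convergence (fun _ => 1) (fun n => by fun_prop)
      (fun n => Eventually.of_forall fun ω =>
        hle1 _ _ (hY.nonneg _ ht ω) (h.add_pos hs.le (by positivity)).le) (by simp)
      (Eventually.of_forall fun ω => ?_)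
    have h3 : Tendsto (fun n : ℕ => s + φ ((n : ℝ) + 1)) atTop (𝓝 s) := by
      have := (h.tendsto_phi_atTop.comp (tendsto_atTop_add_const_right atTop (1 : ℝ)
        (tendsto_natCast_atTop_atTop (R := ℝ)))).const_add s
      simpa using this
    have h4 := (h.inv_continuousAt hs).tendsto.comp h3
    exact ENNReal.tendsto_ofReal ((Real.continuous_exp.tendsto _).comp (h4.const_mul _))
  have heq : ∀ n : ℕ, ∫⁻ ω in G, ENNReal.ofReal (Real.exp (-((n : ℝ) + 1) * Y (t + s) ω)) ∂P =
      ∫⁻ ω in G, ENNReal.ofReal (Real.exp (-(Y t ω) * φinv (s + φ ((n : ℝ) + 1)))) ∂P := by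
    intro n
    rw [setLIntegral_eq_lintegral_indicator_mul (hY.past_le t _ hG),
      setLIntegral_eq_lintegral_indicator_mul (hY.past_le t _ hG)]
    exact hY.lintegral_mul_exp h hs.le ht (by positivity) (measurable_indicator_one_of hG)
  simp_rw [heq] at hlim1
  exact tendsto_nhds_unique hlim1 hlim2

lemma measure_inter_extinct (hY : BranchingProcess φ φinv P Y) (h : GreyExponent ψ φ φinv)
    {s t : ℝ} (hs : 0 < s) (ht : 0 ≤ t) {G : Set Ω} (hG : MeasurableSet[past Y t] G) :
    P (G ∩ {ω | Y (t + s) ω = 0}) =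
      ∫⁻ ω in G, ENNReal.ofReal (Real.exp (-(Y t ω) * φinv s)) ∂P := by
  have hVm : MeasurableSet {ω | Y (t + s) ω = 0} := hY.meas (t + s) (measurableSet_singleton 0)
  have hGm := hY.past_le t _ hG
  have := hY.lintegral_mul_extinct h hs ht (f := G.indicator 1) (measurable_indicator_one_of hG)
  rw [setLIntegral_eq_lintegral_indicator_mul hGm, ← this,
    ← lintegral_indicator_one (hGm.inter hVm), inter_indicator_one]
  rfl

lemma measure_survive_le (hY : BranchingProcess φ φinv P Y) (h : GreyExponent ψ φ φinv)
    {s t e : ℝ} (hs : 0 < s) (ht : 0 ≤ t) {G : Set Ω} (hG : MeasurableSet[past Y t] G)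
    (hGe : ∀ ω ∈ G, Y t ω ≤ e) :
    P (G ∩ {ω | Y (t + s) ω ≠ 0}) ≤ ENNReal.ofReal (e * φinv s) * P G := by
  have hVm : MeasurableSet {ω | Y (t + s) ω = 0} := hY.meas (t + s) (measurableSet_singleton 0)
  have hGm := hY.past_le t _ hG
  have h1 : P (G ∩ {ω | Y (t + s) ω = 0}) + P (G ∩ {ω | Y (t + s) ω ≠ 0}) = P G :=
    measure_inter_add_sdiff G hVm
  have h2 : P G ≤ P (G ∩ {ω | Y (t + s) ω = 0}) + ENNReal.ofReal (e * φinv s) * P G := by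
    rw [hY.measure_inter_extinct h hs ht hG, ← setLIntegral_const, ← setLIntegral_one,
      ← lintegral_add_right _ measurable_const]
    refine setLIntegral_mono' hGm fun ω hω => ?_
    have hp := h.inv_pos s hs
    have h0 := hY.nonneg t ht ω
    have h3 : 1 ≤ Real.exp (-(Y t ω) * φinv s) + e * φinv s := by
      have := Real.add_one_le_exp (-(Y t ω) * φinv s)
      have := mul_le_mul_of_nonneg_right (hGe ω hω) hp.le
      linarith
    have he : 0 ≤ e * φinv s := mul_nonneg (h0.trans (hGe ω hω)) hp.le
    rw [← ENNReal.ofReal_add (Real.exp_pos _).le he]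
    simpa using ENNReal.ofReal_le_ofReal h3
  rw [← h1] at h2
  rw [h1] at h2
  have h4 : P (G ∩ {ω | Y (t + s) ω = 0}) + P (G ∩ {ω | Y (t + s) ω ≠ 0}) ≤
      P (G ∩ {ω | Y (t + s) ω = 0}) + ENNReal.ofReal (e * φinv s) * P G := h1.trans_le h2
  exact (ENNReal.add_le_add_iff_left (measure_ne_top P _)).1 h4

end BranchingProcess

lemma exists_rat_of_eventually_nhdsGT {s b : ℝ} (hsb : s < b) {p : ℝ → Prop}
    (hp : ∀ᶠ u in 𝓝[>] s, p u) : ∃ q : ℚ, s < q ∧ (q : ℝ) < b ∧ p q := by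
  obtain ⟨c, hc, hcp⟩ := (mem_nhdsGT_iff_exists_Ioo_subset' hsb).1
    (inter_mem hp (Ioo_mem_nhdsGT hsb))
  obtain ⟨q, h1, h2⟩ := exists_rat_btwn (show s < c from hc)
  have := hcp ⟨h1, h2⟩
  exact ⟨q, h1, this.2.2, this.1⟩

namespace BranchingProcess

variable {Ω : Type*} [mΩ : MeasurableSpace Ω] {ψ φ φinv : ℝ → ℝ} {P : Measure Ω}
  {Y : ℝ → Ω → ℝ}

lemma eventually_nhdsGT (hY : BranchingProcess φ φinv P Y) (ω : Ω) {t : ℝ} (ht : 0 ≤ t)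
    {U : Set ℝ} (hU : IsOpen U) (h : Y t ω ∈ U) : ∀ᶠ u in 𝓝[>] t, Y u ω ∈ U :=
  ((hY.right ω t ht).mono Ioi_subset_Ici_self).eventually_mem (hU.mem_nhds h)

omit mΩ in
lemma measurableSet_past (Y : ℝ → Ω → ℝ) {s t : ℝ} (hs : 0 ≤ s) (hst : s ≤ t) {U : Set ℝ}
    (hU : MeasurableSet U) : MeasurableSet[past Y t] {ω | Y s ω ∈ U} :=
  measurable_past Y hs hst hU

variable [IsProbabilityMeasure P]

lemma measure_small_then_survive_le (hY : BranchingProcess φ φinv P Y)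
    (h : GreyExponent ψ φ φinv) {r k e : ℝ} (hk : 0 < k) (he : 0 ≤ e) :
    P ((⋃ p ∈ range ((↑) : ℚ → ℝ) ∩ Icc 0 (r - k), {ω | Y p ω ∈ Iio e}) ∩ {ω | Y r ω ≠ 0}) ≤
      ENNReal.ofReal (e * φinv k) := by
  have hVm : MeasurableSet {ω | Y r ω ≠ 0} := (hY.meas r (measurableSet_singleton 0)).compl
  rw [← Measure.restrict_apply' hVm]
  refine (measure_biUnion_le_of_past (past_mono Y) hY.past_le
    ((countable_range _).mono inter_subset_left)
    (fun p hp => measurableSet_past Y hp.2.1 le_rfl measurableSet_Iio)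
    (m := ENNReal.ofReal (e * φinv k) • P) ?_).trans ?_
  · intro p hp G hG hGE
    rw [Measure.restrict_apply' hVm, Measure.smul_apply, smul_eq_mul]
    have hpr : 0 < r - p := by linarith [hp.2.2]
    have h1 := hY.measure_survive_le h hpr hp.2.1 hG (e := e) fun ω hω => le_of_lt (hGE hω)
    rw [add_sub_cancel] at h1
    refine h1.trans ?_
    gcongr
    exact h.inv_anti.antitoneOn hk hpr (by linarith [hp.2.2])
  · rw [Measure.smul_apply, smul_eq_mul]
    exact mul_le_of_le_one_right' prob_le_one

/-- Almost surely the process stays at `0` after reaching it. -/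
lemma ae_absorbed (hY : BranchingProcess φ φinv P Y) (h : GreyExponent ψ φ φinv) :
    ∀ᵐ ω ∂P, ∀ s r : ℝ, 0 ≤ s → s ≤ r → Y s ω = 0 → Y r ω = 0 := by
  have hnull : ∀ r k : ℚ, 0 < k → ∀ᵐ ω ∂P,
      ¬ (Y r ω ≠ 0 ∧ ∀ n : ℕ, ∃ p : ℚ, 0 ≤ (p : ℝ) ∧ (p : ℝ) ≤ r - k ∧ Y p ω < 1 / ((n : ℝ) + 1)) := by
    intro r k hk
    have hk' : (0 : ℝ) < k := by exact_mod_cast hk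
    rw [ae_iff]
    refine le_antisymm (ge_of_tendsto' (x := atTop)
      (f := fun n : ℕ => ENNReal.ofReal (1 / ((n : ℝ) + 1) * φinv k)) ?_ fun n => ?_) zero_le
    · have := (tendsto_one_div_add_atTop_nhds_zero_nat (𝕜 := ℝ)).mul_const (φinv k)
      rw [zero_mul] at this
      simpa using ENNReal.tendsto_ofReal this
    · refine (measure_mono ?_).trans (hY.measure_small_then_survive_le h (r := r) hk'
        (e := 1 / ((n : ℝ) + 1)) (by positivity))
      intro ω hω
      simp only [not_not, mem_ofPred_eq] at hω
      obtain ⟨p, hp0, hp1, hp2⟩ := hω.2 n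
      exact ⟨mem_biUnion (x := (p : ℝ)) ⟨mem_range_self p, hp0, hp1⟩ hp2, hω.1⟩
  have hall : ∀ᵐ ω ∂P, ∀ r k : ℚ, 0 < k → ¬ (Y r ω ≠ 0 ∧ ∀ n : ℕ, ∃ p : ℚ, 0 ≤ (p : ℝ) ∧
      (p : ℝ) ≤ r - k ∧ Y p ω < 1 / ((n : ℝ) + 1)) := by
    simp only [ae_all_iff]
    exact hnull
  filter_upwards [hall] with ω hω s r hs hsr hs0
  by_contra hr
  obtain ⟨r', hr1, -, hr'⟩ := exists_rat_of_eventually_nhdsGT (lt_add_one r)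
    (hY.eventually_nhdsGT ω (hs.trans hsr) isOpen_compl_singleton hr)
  obtain ⟨k, hk0, hk1⟩ := exists_rat_btwn (show (0 : ℝ) < r' - s by linarith)
  refine hω r' k (by exact_mod_cast hk0) ⟨hr', fun n => ?_⟩
  obtain ⟨p, hp1, hp2, hp3⟩ := exists_rat_of_eventually_nhdsGT (show s < r' - k by linarith)
    (hY.eventually_nhdsGT ω hs (isOpen_Iio (a := 1 / ((n : ℝ) + 1)))
      (by rw [hs0]; exact mem_Iio.2 (by positivity)))
  exact ⟨p, by linarith, hp2.le, hp3⟩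

lemma tendsto_measure_survive (hY : BranchingProcess φ φinv P Y) (h : GreyExponent ψ φ φinv)
    {x : ℝ} (hY0 : ∀ᵐ ω ∂P, Y 0 ω = x) :
    Tendsto (fun n : ℕ => P {ω | Y ((n : ℝ) + 1) ω ≠ 0}) atTop (𝓝 0) := by
  have hlim : Tendsto (fun n : ℕ => ENNReal.ofReal (x * φinv ((n : ℝ) + 1))) atTop (𝓝 0) := by
    have := (h.tendsto_inv_atTop.comp (tendsto_atTop_add_const_right atTop (1 : ℝ)
        (tendsto_natCast_atTop_atTop (R := ℝ)))).const_mul x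
    rw [mul_zero] at this
    simpa using ENNReal.tendsto_ofReal this
  refine tendsto_of_tendsto_of_tendsto_of_le_of_le tendsto_const_nhds hlim (fun _ => zero_le)
    fun n => ?_
  have h1 := hY.measure_survive_le h (s := (n : ℝ) + 1) (by positivity) le_rfl
    (measurableSet_past Y le_rfl le_rfl (measurableSet_singleton x)) (e := x)
    fun ω hω => le_of_eq hω
  rw [zero_add] at h1
  refine le_trans (measure_mono_ae ?_) (h1.trans (mul_le_of_le_one_right' prob_le_one))
  filter_upwards [hY0] with ω hω hω2 using ⟨hω, hω2⟩

lemma ae_exists_extinct (hY : BranchingProcess φ φinv P Y) (h : GreyExponent ψ φ φinv)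
    {x : ℝ} (hY0 : ∀ᵐ ω ∂P, Y 0 ω = x) : ∀ᵐ ω ∂P, ∃ t : ℝ, 0 ≤ t ∧ Y t ω = 0 := by
  rw [ae_iff]
  refine le_antisymm (ge_of_tendsto' (hY.tendsto_measure_survive h hY0) fun n =>
    measure_mono fun ω hω => ?_) zero_le
  intro h0
  exact hω ⟨_, by positivity, h0⟩

omit [IsProbabilityMeasure P] in
/-- The process viewed as a function of time and of the sample point is measurable. -/
lemma measurable_uncurry (hY : BranchingProcess φ φinv P Y) :
    Measurable fun q : ℝ × Ω => Y (max q.1 0) q.2 := by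
  refine measurable_of_tendsto_metrizable
    (f := fun (n : ℕ) (q : ℝ × Ω) => Y (((⌊((n : ℝ) + 1) * max q.1 0⌋₊ : ℝ) + 1) / (n + 1)) q.2)
    (fun n => ?_) (tendsto_pi_nhds.2 fun q => ?_)
  · have h1 : Measurable fun q : ℕ × Ω => Y (((q.1 : ℝ) + 1) / (n + 1)) q.2 :=
      measurable_from_prod_countable_right fun k => hY.meas (((k : ℝ) + 1) / (n + 1))
    have h2 : Measurable fun q : ℝ × Ω => ((⌊((n : ℝ) + 1) * max q.1 0⌋₊, q.2) : ℕ × Ω) := by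
      refine Measurable.prodMk (Nat.measurable_floor.comp ?_) measurable_snd
      fun_prop
    exact h1.comp h2
  · set u := max q.1 0 with hu
    have hu0 : 0 ≤ u := le_max_right _ _
    have hgt : ∀ n : ℕ, u < ((⌊((n : ℝ) + 1) * u⌋₊ : ℝ) + 1) / (n + 1) := fun n => by
      rw [lt_div_iff₀ (by positivity), mul_comm]
      exact Nat.lt_floor_add_one _
    have hle : ∀ n : ℕ, ((⌊((n : ℝ) + 1) * u⌋₊ : ℝ) + 1) / (n + 1) ≤ u + 1 / ((n : ℝ) + 1) :=
      fun n => by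
        rw [add_div]
        gcongr
        rw [div_le_iff₀ (by positivity), mul_comm]
        exact Nat.floor_le (by positivity)
    have hlim : Tendsto (fun n : ℕ => ((⌊((n : ℝ) + 1) * u⌋₊ : ℝ) + 1) / (n + 1)) atTop (𝓝 u) := by
      refine tendsto_of_tendsto_of_tendsto_of_le_of_le tendsto_const_nhds ?_
        (fun n => (hgt n).le) hle
      simpa using (tendsto_one_div_add_atTop_nhds_zero_nat (𝕜 := ℝ)).const_add u
    exact (hY.right q.2 u hu0).tendsto.comp
      (tendsto_nhdsWithin_iff.2 ⟨hlim, Eventually.of_forall fun n => (hgt n).le⟩)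

lemma lintegral_occupation_exp (hY : BranchingProcess φ φinv P Y) (h : GreyExponent ψ φ φinv)
    {p l m : ℝ} (hp : 0 ≤ p) (hl : 0 < l) (hlm : l ≤ m) {G : Set Ω}
    (hG : MeasurableSet[past Y p] G) :
    ∫⁻ u in Ioi 0, ∫⁻ ω in G, ENNReal.ofReal
        (Real.exp (-l * Y (p + u) ω) - Real.exp (-m * Y (p + u) ω)) ∂P =
      ∫⁻ ω in G, (∫⁻ v in Ioo l m,
        ENNReal.ofReal ((ψ v)⁻¹ * (1 - Real.exp (-(Y p ω) * v)))) ∂P := by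
  have hm : 0 < m := hl.trans_le hlm
  have hGm := hY.past_le p _ hG
  have hYp := hY.meas p
  have hstep : ∀ u ∈ Ioi (0 : ℝ), ∫⁻ ω in G, ENNReal.ofReal
        (Real.exp (-l * Y (p + u) ω) - Real.exp (-m * Y (p + u) ω)) ∂P =
      ∫⁻ ω in G, ENNReal.ofReal (Real.exp (-(Y p ω) * φinv (u + φ l)) -
        Real.exp (-(Y p ω) * φinv (u + φ m))) ∂P := by
    intro u hu
    have hu0 : 0 ≤ u := le_of_lt hu
    have hYu := hY.meas (p + u)
    have hM : ∀ k : ℝ, 0 < k → ∫⁻ ω in G, ENNReal.ofReal (Real.exp (-k * Y (p + u) ω)) ∂P =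
        ∫⁻ ω in G, ENNReal.ofReal (Real.exp (-(Y p ω) * φinv (u + φ k))) ∂P := fun k hk => by
      rw [setLIntegral_eq_lintegral_indicator_mul hGm, setLIntegral_eq_lintegral_indicator_mul hGm]
      exact hY.lintegral_mul_exp h hu0 hp hk (measurable_indicator_one_of hG)
    have hfin : ∀ a : Ω → ℝ, (∀ ω, a ω ≤ 0) →
        ∫⁻ ω in G, ENNReal.ofReal (Real.exp (a ω)) ∂P ≠ ⊤ := fun a ha => by
      refine ((lintegral_mono (g := 1) fun ω => ?_).trans_lt ?_).ne
      · exact ENNReal.ofReal_le_one.2 (Real.exp_le_one_iff.2 (ha ω))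
      · simp
    have hφ : φinv (u + φ l) ≤ φinv (u + φ m) := h.inv_anti.antitoneOn
      (add_pos_of_nonneg_of_pos hu0 (h.phi_pos m hm))
      (add_pos_of_nonneg_of_pos hu0 (h.phi_pos l hl))
      (by have := h.phi_anti.antitoneOn hl hm hlm; linarith)
    have hnn := hY.nonneg p hp
    have hnn' := hY.nonneg (p + u) (by linarith)
    have hpos := (h.add_pos hu0 hm).le
    simp_rw [ENNReal.ofReal_sub _ (Real.exp_pos _).le]
    rw [lintegral_sub (by fun_prop), lintegral_sub (by fun_prop), hM l hl, hM m hm]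
    · exact hfin _ fun ω => by nlinarith [hnn ω]
    · refine Eventually.of_forall fun ω => ENNReal.ofReal_le_ofReal (Real.exp_le_exp.2 ?_)
      nlinarith [hnn ω]
    · exact hfin _ fun ω => by nlinarith [hnn' ω]
    · refine Eventually.of_forall fun ω => ENNReal.ofReal_le_ofReal (Real.exp_le_exp.2 ?_)
      nlinarith [hnn' ω]
  rw [setLIntegral_congr_fun measurableSet_Ioi hstep, lintegral_lintegral_swap]
  · refine lintegral_congr fun ω => ?_
    exact h.lintegral_cumulant_sub (hY.nonneg p hp ω) hl hlm
  · have hcont : ∀ k : ℝ, 0 < k → AEMeasurable (fun u => φinv (u + φ k))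
        (volume.restrict (Ioi 0)) := fun k hk => by
      refine ContinuousOn.aemeasurable (fun u hu => ?_) measurableSet_Ioi
      have hu' : 0 < u + φ k := add_pos hu (h.phi_pos k hk)
      exact ((h.inv_continuousAt hu').comp (f := fun u => u + φ k)
        (by fun_prop)).continuousWithinAt
    have hf : ∀ k : ℝ, 0 < k → AEMeasurable (fun q : ℝ × Ω => φinv (q.1 + φ k))
        ((volume.restrict (Ioi 0)).prod (P.restrict G)) := fun k hk => (hcont k hk).comp_fst
    have h1 := hf l hl
    have h2 := hf m hm
    have h3 : AEMeasurable (fun q : ℝ × Ω => Y p q.2)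
        ((volume.restrict (Ioi 0)).prod (P.restrict G)) :=
      (hYp.comp measurable_snd).aemeasurable
    simp only [Function.uncurry_def]
    exact ((h3.neg.mul h1).exp.sub (h3.neg.mul h2).exp).ennreal_ofReal

end BranchingProcess

namespace BranchingProcess

variable {Ω : Type*} [mΩ : MeasurableSpace Ω] {ψ φ φinv : ℝ → ℝ} {P : Measure Ω}
  {Y : ℝ → Ω → ℝ} [IsProbabilityMeasure P] {W : ℝ → ℝ}

omit [IsProbabilityMeasure P] in
lemma setLIntegral_max_eq {p : ℝ} (hp : 0 ≤ p) {G : Set Ω} (f : ℝ → Ω → ℝ → ℝ≥0∞) :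
    ∫⁻ u in Ioi 0, ∫⁻ ω in G, f u ω (Y (max (p + u) 0) ω) ∂P =
      ∫⁻ u in Ioi 0, ∫⁻ ω in G, f u ω (Y (p + u) ω) ∂P := by
  refine setLIntegral_congr_fun measurableSet_Ioi fun u hu => ?_
  have hu' : 0 < u := hu
  simp only [max_eq_left (show 0 ≤ p + u by linarith)]

lemma lintegral_occupation (hY : BranchingProcess φ φinv P Y) (h : GreyExponent ψ φ φinv)
    (hWnonneg : ∀ y : ℝ, 0 ≤ y → 0 ≤ W y) (hWmono : MonotoneOn W (Ici 0))
    (hWlaplace : ∀ lam : ℝ, 0 < lam →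
      ∫ y in Set.Ioi (0 : ℝ), Real.exp (-lam * y) * W y = (ψ lam)⁻¹)
    {p : ℝ} (hp : 0 ≤ p) {G : Set Ω} (hG : MeasurableSet[past Y p] G) {f : ℝ → ℝ≥0∞}
    (hf : Measurable f) :
    ∫⁻ u in Ioi 0, ∫⁻ ω in G, (Ioi 0).indicator f (Y (p + u) ω) ∂P =
      ∫⁻ w in Ioi 0, f w * ∫⁻ ω in G,
        ENNReal.ofReal ((scaleExt W w - scaleExt W (w - Y p ω)) / w) ∂P := by
  have hGm := hY.past_le p _ hG
  have hYp := hY.meas p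
  have hWm := (scaleExt_monotone hWnonneg hWmono).measurable
  have hYm : Measurable fun q : ℝ × Ω => Y (max (p + q.1) 0) q.2 :=
    hY.measurable_uncurry.comp (f := fun q : ℝ × Ω => (p + q.1, q.2)) (by fun_prop)
  set μ₁ : Measure ℝ := ((volume.restrict (Ioi 0)).prod (P.restrict G)).map
    (fun q : ℝ × Ω => Y (max (p + q.1) 0) q.2) with hμ₁
  set k : ℝ → Ω → ℝ≥0∞ := fun w ω =>
    ENNReal.ofReal ((scaleExt W w - scaleExt W (w - Y p ω)) / w) with hk
  have hkm : Measurable (Function.uncurry k) := by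
    simp only [hk, Function.uncurry_def]
    fun_prop
  have hkm' : Measurable fun w => ∫⁻ ω in G, k w ω ∂P := hkm.lintegral_prod_right'
  set μ₂ : Measure ℝ := volume.withDensity fun w => ∫⁻ ω in G, k w ω ∂P with hμ₂
  have e1 : ∀ g : ℝ → ℝ≥0∞, Measurable g → ∫⁻ w in Ioi 0, g w ∂μ₁ =
      ∫⁻ u in Ioi 0, ∫⁻ ω in G, (Ioi 0).indicator g (Y (p + u) ω) ∂P := by
    intro g hg
    have hgi := hg.indicator (measurableSet_Ioi (a := (0 : ℝ)))
    rw [← setLIntegral_max_eq hp (fun _ _ y => (Ioi 0).indicator g y),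
      ← lintegral_indicator measurableSet_Ioi, hμ₁, lintegral_map hgi hYm,
      lintegral_prod (fun q : ℝ × Ω => (Ioi 0).indicator g (Y (max (p + q.1) 0) q.2))
        (hgi.comp hYm).aemeasurable]
  have e2 : ∀ g : ℝ → ℝ≥0∞, Measurable g → ∫⁻ w in Ioi 0, g w ∂μ₂ =
      ∫⁻ w in Ioi 0, g w * ∫⁻ ω in G, k w ω ∂P := by
    intro g hg
    rw [hμ₂, restrict_withDensity measurableSet_Ioi,
      lintegral_withDensity_eq_lintegral_mul _ hkm' hg]
    refine lintegral_congr fun w => ?_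
    simp [mul_comm]
  have hval : ∀ l m : ℝ, 0 < l → l ≤ m → ∫⁻ w in Ioi 0,
      ENNReal.ofReal (Real.exp (-l * w) - Real.exp (-m * w)) ∂μ₁ = ∫⁻ ω in G, (∫⁻ v in Ioo l m,
        ENNReal.ofReal ((ψ v)⁻¹ * (1 - Real.exp (-(Y p ω) * v)))) ∂P := by
    intro l m hl hlm
    rw [e1 _ (by fun_prop), ← hY.lintegral_occupation_exp h hp hl hlm hG]
    refine setLIntegral_congr_fun measurableSet_Ioi fun u hu => lintegral_congr fun ω => ?_
    have hu' : 0 < u := hu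
    rcases (hY.nonneg (p + u) (by linarith) ω).eq_or_lt with h0 | h0
    · simp [← h0]
    · rw [indicator_of_mem (mem_Ioi.2 h0)]
  have hmain : μ₁.restrict (Ioi 0) = μ₂.restrict (Ioi 0) := by
    refine restrict_Ioi_ext (fun l m hl hlm => ?_) fun l m hl hlm => ?_
    · rw [hval l m hl hlm]
      have hb : ∀ ω, ∫⁻ v in Ioo l m, ENNReal.ofReal ((ψ v)⁻¹ * (1 - Real.exp (-(Y p ω) * v))) ≤
          ∫⁻ v in Ioi l, ENNReal.ofReal ((ψ v)⁻¹) := fun ω => by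
        refine (setLIntegral_mono' measurableSet_Ioo fun v hv => ?_).trans
          (lintegral_mono_set Ioo_subset_Ioi_self)
        have hv0 : 0 < v := hl.trans hv.1
        refine ENNReal.ofReal_le_ofReal (mul_le_of_le_one_right (inv_nonneg.2 (h.pos v hv0).le) ?_)
        have := Real.exp_pos (-(Y p ω) * v)
        linarith
      refine ((lintegral_mono hb).trans_lt ?_).ne
      rw [lintegral_const]
      exact ENNReal.mul_lt_top (h.integ l hl).lintegral_lt_top (measure_lt_top _ _)
    · rw [hval l m hl hlm, e2 _ (by fun_prop)]
      simp_rw [← lintegral_const_mul' _ _ ENNReal.ofReal_ne_top]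
      have hswap : ∫⁻ w in Ioi 0, ∫⁻ ω in G,
          ENNReal.ofReal (Real.exp (-l * w) - Real.exp (-m * w)) * k w ω ∂P =
          ∫⁻ ω in G, (∫⁻ w in Ioi 0,
            ENNReal.ofReal (Real.exp (-l * w) - Real.exp (-m * w)) * k w ω) ∂P := by
        refine lintegral_lintegral_swap (Measurable.aemeasurable ?_)
        exact Measurable.mul (f := fun q : ℝ × Ω =>
          ENNReal.ofReal (Real.exp (-l * q.1) - Real.exp (-m * q.1))) (by fun_prop) hkm
      rw [hswap]
      exact lintegral_congr fun ω => (lintegral_potential_density h.pos hWnonneg hWmono hWlaplace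
        (hY.nonneg p hp ω) hl hlm).symm
  rw [← e1 f hf, ← e2 f hf, hmain]

end BranchingProcess

lemma indicator_exp_le {q y k w : ℝ} (hq : 0 ≤ q) (hk : 0 ≤ k) (hk1 : k ≤ 1)
    (hlog : Real.log 2 ≤ k * q * y / 2) (hw : y ≤ w) :
    Real.exp (-w * q) ≤ Real.exp (-((1 - k) * q * y)) *
      (Real.exp (-(k * q / 2) * w) - Real.exp (-(k * q) * w)) := by
  have h1 : Real.exp (-w * q) ≤ Real.exp (-((1 - k) * q * y)) * Real.exp (-(k * q) * w) := by
    rw [← Real.exp_add, Real.exp_le_exp]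
    nlinarith [mul_nonneg (mul_nonneg (sub_nonneg.2 hk1) hq) (sub_nonneg.2 hw)]
  refine h1.trans (mul_le_mul_of_nonneg_left ?_ (Real.exp_pos _).le)
  have h2 : 2 ≤ Real.exp (k * q * w / 2) := by
    rw [← Real.log_le_iff_le_exp two_pos]
    nlinarith [mul_nonneg (mul_nonneg hk hq) (sub_nonneg.2 hw)]
  have h3 : Real.exp (-(k * q / 2) * w) = Real.exp (-(k * q) * w) * Real.exp (k * q * w / 2) := by
    rw [← Real.exp_add]; congr 1; ring
  rw [h3]
  nlinarith [Real.exp_pos (-(k * q) * w)]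

namespace BranchingProcess

variable {Ω : Type*} [mΩ : MeasurableSpace Ω] {ψ φ φinv : ℝ → ℝ} {P : Measure Ω}
  {Y : ℝ → Ω → ℝ} [IsProbabilityMeasure P]

lemma lintegral_level_le (hY : BranchingProcess φ φinv P Y) (h : GreyExponent ψ φ φinv)
    {p q y k B : ℝ} (hp : 0 ≤ p) (hq : 0 < q) (hk : 0 < k) (hk1 : k ≤ 1)
    (hlog : Real.log 2 ≤ k * q * y / 2) {G : Set Ω} (hG : MeasurableSet[past Y p] G)
    (hB : ∀ ω ∈ G, ∀ v, 0 < v → v ≤ k * q → 1 - Real.exp (-(Y p ω) * v) ≤ B) :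
    ∫⁻ u in Ioi 0, ∫⁻ ω in G, (Ici y).indicator
        (fun w => ENNReal.ofReal (Real.exp (-w * q))) (Y (p + u) ω) ∂P ≤
      ENNReal.ofReal (Real.exp (-((1 - k) * q * y)) * (B * ((k * q / 2) / ψ (k * q / 2)))) *
        P G := by
  have hGm := hY.past_le p _ hG
  have hkq : 0 < k * q := by positivity
  have hstep : ∀ w : ℝ, (Ici y).indicator (fun w => ENNReal.ofReal (Real.exp (-w * q))) w ≤
      ENNReal.ofReal (Real.exp (-((1 - k) * q * y))) *
      ENNReal.ofReal (Real.exp (-(k * q / 2) * w) - Real.exp (-(k * q) * w)) := by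
    intro w
    by_cases hw : w ∈ Ici y
    · rw [indicator_of_mem hw, ← ENNReal.ofReal_mul (Real.exp_pos _).le]
      exact ENNReal.ofReal_le_ofReal (indicator_exp_le hq.le hk.le hk1 hlog hw)
    · simp [indicator_of_notMem hw]
  calc _ ≤ ∫⁻ u in Ioi 0, ∫⁻ ω in G, ENNReal.ofReal (Real.exp (-((1 - k) * q * y))) *
        ENNReal.ofReal (Real.exp (-(k * q / 2) * Y (p + u) ω) -
          Real.exp (-(k * q) * Y (p + u) ω)) ∂P := by
        gcongr with u ω
        exact hstep _
    _ = ENNReal.ofReal (Real.exp (-((1 - k) * q * y))) * ∫⁻ ω in G, (∫⁻ v in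
          Ioo (k * q / 2) (k * q), ENNReal.ofReal ((ψ v)⁻¹ * (1 - Real.exp (-(Y p ω) * v)))) ∂P := by
        simp_rw [lintegral_const_mul' _ _ ENNReal.ofReal_ne_top]
        rw [hY.lintegral_occupation_exp h hp (by positivity) (by linarith) hG]
    _ ≤ ENNReal.ofReal (Real.exp (-((1 - k) * q * y))) * ∫⁻ ω in G, (∫⁻ v in
          Ioo (k * q / 2) (k * q), ENNReal.ofReal ((ψ (k * q / 2))⁻¹ * B)) ∂P := by
        refine mul_le_mul_right ?_ _
        refine setLIntegral_mono' hGm fun ω hω => ?_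
        refine setLIntegral_mono' measurableSet_Ioo fun v hv => ?_
        have h0 : 0 < k * q / 2 := by positivity
        have hv0 : 0 < v := h0.trans hv.1
        refine ENNReal.ofReal_le_ofReal ?_
        have h1 : 0 ≤ 1 - Real.exp (-(Y p ω) * v) := by
          rw [sub_nonneg, Real.exp_le_one_iff]
          nlinarith [hY.nonneg p hp ω]
        have h2 := h.pos _ h0
        gcongr
        · exact h.mono h0 hv0 hv.1.le
        · exact hB ω hω v hv0 hv.2.le
    _ = _ := by
        rw [setLIntegral_const, setLIntegral_const, Real.volume_Ioo,
          show k * q - k * q / 2 = k * q / 2 by ring, ← mul_assoc,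
          ← ENNReal.ofReal_mul' (by positivity), ← ENNReal.ofReal_mul (Real.exp_pos _).le]
        congr 2
        rw [div_eq_mul_inv (k * q / 2) (ψ _)]
        ring

lemma measure_drop_extinct_le (hY : BranchingProcess φ φinv P Y) (h : GreyExponent ψ φ φinv)
    {p s t y e l d : ℝ} (hp : 0 ≤ p) (hs : 0 ≤ s) (hsd : s ≤ d) (hst : s < t) (hl : 0 < l)
    (hy : 0 ≤ y) {r : ℝ} (hr : 0 < r) (hrt : r ≤ t - s) (he1 : e ≤ 2)
    (h1 : d * ψ (l + φinv r) ≤ e / 2 * l) (h2 : Real.log 2 ≤ y * (e / 2 * l)) {G : Set Ω}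
    (hG : MeasurableSet[past Y p] G) (hGy : ∀ ω ∈ G, y ≤ Y p ω) :
    P (G ∩ {ω | Y (p + t) ω = 0} ∩ {ω | Y (p + s) ω < (1 - e) * y}) ≤
      2⁻¹ * P (G ∩ {ω | Y (p + t) ω = 0}) := by
  have hts : 0 < t - s := by linarith
  have ht : 0 < t := by linarith
  have hYs := hY.meas (p + s)
  have hGm := hY.past_le p _ hG
  have hVm : MeasurableSet {ω | Y (p + t) ω = 0} := hY.meas _ (measurableSet_singleton 0)
  have hSm : MeasurableSet {ω | Y (p + s) ω < (1 - e) * y} := hYs measurableSet_Iio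
  set c := l + φinv (t - s) with hc
  have hc0 : 0 < c := add_pos hl (h.inv_pos _ hts)
  have hGs : MeasurableSet[past Y (p + s)] G := past_mono Y (show p ≤ p + s by linarith) _ hG
  have hbound : P (G ∩ {ω | Y (p + t) ω = 0} ∩ {ω | Y (p + s) ω < (1 - e) * y}) ≤
      ENNReal.ofReal (Real.exp (l * ((1 - e) * y))) *
        ∫⁻ ω, G.indicator 1 ω * ENNReal.ofReal (Real.exp (-c * Y (p + s) ω)) ∂P := by
    have hYs' : Measurable[past Y (p + s)] (Y (p + s)) :=
      measurable_past Y (by linarith) le_rfl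
    have hfm : Measurable[past Y (p + s)] fun ω =>
        G.indicator 1 ω * ENNReal.ofReal (Real.exp (-l * Y (p + s) ω)) :=
      (measurable_indicator_one_of hGs).mul (hYs'.const_mul (-l)).exp.ennreal_ofReal
    have hE := hY.lintegral_mul_extinct h hts (show 0 ≤ p + s by linarith) hfm
    rw [show p + s + (t - s) = p + t by ring] at hE
    have hR : ∀ ω, G.indicator 1 ω * ENNReal.ofReal (Real.exp (-l * Y (p + s) ω)) *
        ENNReal.ofReal (Real.exp (-(Y (p + s) ω) * φinv (t - s))) =
        G.indicator 1 ω * ENNReal.ofReal (Real.exp (-c * Y (p + s) ω)) := fun ω => by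
      rw [mul_assoc, ← ENNReal.ofReal_mul (Real.exp_pos _).le, ← Real.exp_add]
      congr 3; rw [hc]; ring
    simp_rw [hR] at hE
    rw [← hE, ← lintegral_const_mul' _ _ ENNReal.ofReal_ne_top,
      ← lintegral_indicator_one ((hGm.inter hVm).inter hSm)]
    refine lintegral_mono fun ω => ?_
    by_cases hω : ω ∈ G ∩ {ω | Y (p + t) ω = 0} ∩ {ω | Y (p + s) ω < (1 - e) * y}
    · rw [indicator_of_mem hω, indicator_of_mem hω.1.1, indicator_of_mem hω.1.2]
      simp only [Pi.one_apply, one_mul, mul_one]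
      rw [← ENNReal.ofReal_mul (Real.exp_pos _).le, ← Real.exp_add, ENNReal.one_le_ofReal,
        Real.one_le_exp_iff]
      have : Y (p + s) ω < (1 - e) * y := hω.2
      nlinarith
    · simp [indicator_of_notMem hω]
  refine hbound.trans ?_
  have hf := hY.lintegral_mul_exp h hs hp hc0 (measurable_indicator_one_of hG)
  rw [hf, hY.measure_inter_extinct h ht hp hG, setLIntegral_eq_lintegral_indicator_mul hGm,
    ← lintegral_const_mul' _ _ ENNReal.ofReal_ne_top, ← lintegral_const_mul' _ _ (by simp)]
  refine lintegral_mono fun ω => ?_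
  by_cases hω : ω ∈ G
  swap
  · simp [hω]
  rw [indicator_of_mem hω]
  simp only [Pi.one_apply, one_mul]
  rw [show (2⁻¹ : ℝ≥0∞) = ENNReal.ofReal (Real.exp (-Real.log 2)) by
      rw [Real.exp_neg, Real.exp_log two_pos, ENNReal.ofReal_inv_of_pos two_pos]; simp,
    ← ENNReal.ofReal_mul (Real.exp_pos _).le, ← ENNReal.ofReal_mul (Real.exp_pos _).le,
    ← Real.exp_add, ← Real.exp_add]
  refine ENNReal.ofReal_le_ofReal (Real.exp_le_exp.2 ?_)
  have h3 := h.sub_le_cumulant hs hc0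
  have h4 : φinv t ≤ φinv (t - s) := h.inv_anti.antitoneOn hts ht (by linarith)
  have h5 : s * ψ c ≤ e / 2 * l := by
    refine le_trans ?_ h1
    have hcr : c ≤ l + φinv r := by
      have := h.inv_anti.antitoneOn hr hts hrt
      simp only [hc]; linarith
    have := h.mono hc0 (hc0.trans_le hcr) hcr
    have := h.pos c hc0
    exact mul_le_mul hsd (by assumption) this.le (hs.trans hsd)
  have h6 : φinv t + (1 - e / 2) * l ≤ φinv (s + φ c) := by
    have : c = l + φinv (t - s) := rfl
    linarith
  have hYy := hGy ω hω
  have h7 := mul_le_mul_of_nonneg_left h6 (hy.trans hYy)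
  have h8 : 0 ≤ (Y p ω - y) * ((1 - e / 2) * l) :=
    mul_nonneg (by linarith) (mul_nonneg (by linarith) hl.le)
  nlinarith

end BranchingProcess

lemma lintegral_overlap_le {d : ℝ} (hd : 0 < d) (H : ℝ → ℝ≥0∞) :
    ∑' j : ℕ, ∫⁻ u in Ioo (j * d) (j * d + 2 * d), H u ≤ 2 * ∫⁻ u in Ioi 0, H u := by
  set I : ℕ → ℝ≥0∞ := fun j => ∫⁻ u in Ico (j * d) ((j + 1) * d), H u with hI
  have hsum : ∑' j, I j ≤ ∫⁻ u in Ioi 0, H u := by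
    have hdisj : Pairwise (Function.onFun Disjoint
        fun j : ℕ => Ico ((j : ℝ) * d) (((j : ℝ) + 1) * d)) := by
      refine (pairwise_disjoint_on _).2 fun i j hij => ?_
      refine disjoint_left.2 fun u hu1 hu2 => ?_
      have h1 : (i : ℝ) + 1 ≤ j := by exact_mod_cast hij
      have h2 := hu1.2
      have h3 := hu2.1
      nlinarith
    rw [← lintegral_iUnion (fun j => measurableSet_Ico) hdisj,
      setLIntegral_congr (Ioi_ae_eq_Ici (a := (0 : ℝ)))]
    refine lintegral_mono_set (iUnion_subset fun j u hu => ?_)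
    exact le_trans (by positivity) hu.1
  calc ∑' j : ℕ, ∫⁻ u in Ioo (j * d) (j * d + 2 * d), H u
      ≤ ∑' j : ℕ, (I j + I (j + 1)) := by
        refine ENNReal.tsum_le_tsum fun j => ?_
        refine (lintegral_mono_set ?_).trans (lintegral_union_le _ _ _)
        intro u hu
        rcases lt_or_ge u ((j + 1) * d) with h | h
        · exact Or.inl ⟨hu.1.le, h⟩
        · refine Or.inr ⟨by push_cast; exact h, ?_⟩
          push_cast
          nlinarith [hu.2]
    _ ≤ ∑' j, I j + ∑' j, I j := by
        rw [ENNReal.tsum_add]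
        refine add_le_add le_rfl ?_
        exact ENNReal.tsum_comp_le_tsum_of_injective (add_left_injective 1) I
    _ ≤ 2 * ∫⁻ u in Ioi 0, H u := by
        rw [two_mul]
        gcongr

namespace BranchingProcess

variable {Ω : Type*} [mΩ : MeasurableSpace Ω] {ψ φ φinv : ℝ → ℝ} {P : Measure Ω}
  {Y : ℝ → Ω → ℝ} [IsProbabilityMeasure P]

lemma measure_block_le (hY : BranchingProcess φ φinv P Y) (h : GreyExponent ψ φ φinv)
    {a d t y e l : ℝ} (ha : 0 ≤ a) (hd : 0 < d) (hdt : d < t) (hy : 0 ≤ y) (he1 : e ≤ 2)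
    (hl : 0 < l) (h1 : d * ψ (l + φinv (t - d)) ≤ e / 2 * l)
    (h2 : Real.log 2 ≤ y * (e / 2 * l)) :
    P ((⋃ p ∈ range ((↑) : ℚ → ℝ) ∩ Ico a (a + d), {ω | Y p ω ∈ Ioi y}) ∩
        {ω | Y (a + d + t) ω = 0}) ≤
      ENNReal.ofReal (2 / d) * ∫⁻ u in Ioo a (a + 2 * d), ∫⁻ ω, (Ici ((1 - e) * y)).indicator
        (fun w => ENNReal.ofReal (Real.exp (-w * φinv (t + d)))) (Y u ω) ∂P := by
  set V : Set Ω := {ω | Y (a + d + t) ω = 0} with hV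
  have hVm : MeasurableSet V := hY.meas _ (measurableSet_singleton 0)
  set y' := (1 - e) * y with hy'
  have hYm : Measurable fun q : Ω × ℝ => (Ici y').indicator (1 : ℝ → ℝ≥0∞) (Y (max q.2 0) q.1) :=
    (measurable_one.indicator measurableSet_Ici).comp
      (hY.measurable_uncurry.comp measurable_swap)
  set J : Ω → ℝ≥0∞ := fun ω => ∫⁻ u in Ioo a (a + 2 * d),
    (Ici y').indicator 1 (Y (max u 0) ω) with hJ
  have hJm : Measurable J := hYm.lintegral_prod_right'
  have hVJ : Measurable fun ω => V.indicator 1 ω * J ω :=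
    (measurable_indicator_one_of hVm).mul hJm
  set m : Measure Ω := ENNReal.ofReal (2 / d) •
    P.withDensity (fun ω => V.indicator 1 ω * J ω) with hm
  have hmG : ∀ G : Set Ω, MeasurableSet G → m G = ENNReal.ofReal (2 / d) *
      ∫⁻ u in Ioo a (a + 2 * d), P (G ∩ V ∩ {ω | y' ≤ Y u ω}) := by
    intro G hG
    rw [hm, Measure.smul_apply, smul_eq_mul, withDensity_apply _ hG]
    congr 1
    have e1 : ∀ ω, V.indicator 1 ω * J ω = ∫⁻ u in Ioo a (a + 2 * d),
        V.indicator 1 ω * (Ici y').indicator 1 (Y (max u 0) ω) := fun ω => by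
      refine (lintegral_const_mul' _ _ ?_).symm
      by_cases hω : ω ∈ V <;> simp [hω]
    simp_rw [e1]
    rw [lintegral_lintegral_swap]
    · refine setLIntegral_congr_fun measurableSet_Ioo fun u hu => ?_
      have hu0 : 0 ≤ u := ha.trans hu.1.le
      have hS : MeasurableSet {ω | y' ≤ Y u ω} := hY.meas u measurableSet_Ici
      rw [setLIntegral_eq_lintegral_indicator_mul hG,
        ← lintegral_indicator_one ((hG.inter hVm).inter hS)]
      refine lintegral_congr fun ω => ?_
      rw [inter_indicator_one, inter_indicator_one, Pi.mul_apply, Pi.mul_apply, max_eq_left hu0,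
        mul_assoc]
      rfl
    · exact (((measurable_indicator_one_of hVm).comp measurable_fst).mul hYm).aemeasurable
  rw [← Measure.restrict_apply' hVm]
  refine (measure_biUnion_le_of_past (past_mono Y) hY.past_le
    ((countable_range _).mono inter_subset_left)
    (fun p hp => measurableSet_past Y (ha.trans hp.2.1) le_rfl measurableSet_Ioi)
    (m := m) ?_).trans ((measure_mono (subset_univ _)).trans ?_)
  · intro p hp G hG hGE
    have hp0 : 0 ≤ p := ha.trans hp.2.1
    have hGm := hY.past_le p _ hG
    rw [Measure.restrict_apply' hVm, hmG G hGm]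
    have hhalf : ∀ u ∈ Ioo p (p + d), 2⁻¹ * P (G ∩ V) ≤ P (G ∩ V ∩ {ω | y' ≤ Y u ω}) := by
      intro u hu
      have hdrop := hY.measure_drop_extinct_le h (s := u - p) (t := a + d + t - p) (d := d)
        (r := t - d) hp0 (by linarith [hu.1]) (by linarith [hu.2]) (by linarith [hu.2, hp.2.2]) hl hy
        (by linarith) (by linarith [hu.2, hp.2.2]) he1 h1 h2 hG
        (fun ω hω => le_of_lt (hGE hω))
      rw [show p + (a + d + t - p) = a + d + t by ring, show p + (u - p) = u by ring] at hdrop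
      have hS : MeasurableSet {ω | y' ≤ Y u ω} := hY.meas u measurableSet_Ici
      have hsplit := measure_inter_add_sdiff (μ := P) (G ∩ V) hS
      have hcompl : (G ∩ V) \ {ω | y' ≤ Y u ω} = G ∩ V ∩ {ω | Y u ω < (1 - e) * y} := by
        ext ω; simp [hy']
      rw [hcompl] at hsplit
      have hne : 2⁻¹ * P (G ∩ V) ≠ ⊤ := ENNReal.mul_ne_top (by simp) (measure_ne_top _ _)
      refine (ENNReal.add_le_add_iff_right hne).1 ?_
      rw [← add_mul, ENNReal.inv_two_add_inv_two, one_mul]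
      calc P (G ∩ V) = _ := hsplit.symm
        _ ≤ _ := by gcongr
    calc P (G ∩ V) = ENNReal.ofReal (2 / d) * (2⁻¹ * P (G ∩ V) * ENNReal.ofReal d) := by
          rw [mul_comm _ (ENNReal.ofReal d), ← mul_assoc, ← mul_assoc,
            ← ENNReal.ofReal_mul (by positivity), div_mul_cancel₀ _ hd.ne', ENNReal.ofReal_ofNat,
            ENNReal.mul_inv_cancel (by simp) (by simp), one_mul]
      _ = ENNReal.ofReal (2 / d) * ∫⁻ u in Ioo p (p + d), 2⁻¹ * P (G ∩ V) := by
          rw [setLIntegral_const, Real.volume_Ioo, add_sub_cancel_left]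
      _ ≤ ENNReal.ofReal (2 / d) * ∫⁻ u in Ioo p (p + d), P (G ∩ V ∩ {ω | y' ≤ Y u ω}) := by
          refine mul_le_mul_right ?_ _
          exact setLIntegral_mono' measurableSet_Ioo hhalf
      _ ≤ _ := by
          refine mul_le_mul_right ?_ _
          refine lintegral_mono_set (Ioo_subset_Ioo hp.2.1 ?_)
          linarith [hp.2.2]
  · rw [hmG univ MeasurableSet.univ]
    refine mul_le_mul_right (setLIntegral_mono' measurableSet_Ioo fun u hu => ?_) _
    have hu0 : 0 ≤ u := ha.trans hu.1.le
    have hS : MeasurableSet[past Y u] {ω | y' ≤ Y u ω} :=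
      measurableSet_past Y hu0 le_rfl measurableSet_Ici
    have hr : 0 < a + d + t - u := by linarith [hu.2]
    have hE := hY.measure_inter_extinct h hr hu0 hS
    rw [show u + (a + d + t - u) = a + d + t by ring] at hE
    rw [univ_inter, inter_comm, hE, ← lintegral_indicator (hY.past_le u _ hS)]
    refine lintegral_mono fun ω => ?_
    by_cases hω : y' ≤ Y u ω
    · rw [indicator_of_mem (show ω ∈ {ω | y' ≤ Y u ω} from hω),
        indicator_of_mem (show Y u ω ∈ Ici y' from hω)]
      refine ENNReal.ofReal_le_ofReal (Real.exp_le_exp.2 ?_)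
      have := h.inv_anti.antitoneOn hr (show 0 < t + d by linarith)
        (show a + d + t - u ≤ t + d by linarith [hu.1])
      nlinarith [hY.nonneg u hu0 ω]
    · rw [indicator_of_notMem (show ω ∉ {ω | y' ≤ Y u ω} from hω)]
      exact zero_le

lemma measure_exceed_extinct_le (hY : BranchingProcess φ φinv P Y) (h : GreyExponent ψ φ φinv)
    {d t y e l : ℝ} (hd : 0 < d) (hdt : d < t) (hy : 0 ≤ y) (he : 0 < e) (he1 : e ≤ 1)
    (hl : 0 < l) (h1 : d * ψ (l + φinv (t - d)) ≤ e / 2 * l)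
    (h2 : Real.log 2 ≤ y * (e / 2 * l))
    (h3 : Real.log 2 ≤ e * φinv (t + d) * ((1 - e) * y) / 2) :
    P {ω | ∃ p : ℚ, 0 ≤ (p : ℝ) ∧ y < Y p ω ∧ Y (p + t) ω = 0} ≤
      ENNReal.ofReal (4 / d * (Real.exp (-((1 - e) * φinv (t + d) * ((1 - e) * y))) *
        ((e * φinv (t + d) / 2) / ψ (e * φinv (t + d) / 2)))) := by
  have hcover : P {ω | ∃ p : ℚ, 0 ≤ (p : ℝ) ∧ y < Y p ω ∧ Y (p + t) ω = 0} ≤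
      P (⋃ j : ℕ, ((⋃ p ∈ range ((↑) : ℚ → ℝ) ∩ Ico (j * d) (j * d + d), {ω | Y p ω ∈ Ioi y}) ∩
        {ω | Y (j * d + d + t) ω = 0})) := by
    refine measure_mono_ae ?_
    filter_upwards [hY.ae_absorbed h] with ω hω hmem
    obtain ⟨p, hp0, hpy, hpt⟩ := hmem
    have hj1 : (⌊(p : ℝ) / d⌋₊ : ℝ) * d ≤ p := by
      rw [← le_div_iff₀ hd]
      exact Nat.floor_le (by positivity)
    have hj2 : (p : ℝ) < (⌊(p : ℝ) / d⌋₊ : ℝ) * d + d := by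
      have := Nat.lt_floor_add_one ((p : ℝ) / d)
      rw [div_lt_iff₀ hd] at this
      linarith
    refine mem_iUnion.2 ⟨⌊(p : ℝ) / d⌋₊, mem_biUnion (x := (p : ℝ)) ⟨mem_range_self p, hj1, hj2⟩ hpy,
      hω _ _ ?_ ?_ hpt⟩ <;> linarith
  refine hcover.trans ((measure_iUnion_le _).trans ?_)
  set H : ℝ → ℝ≥0∞ := fun u => ∫⁻ ω, (Ici ((1 - e) * y)).indicator
        (fun w => ENNReal.ofReal (Real.exp (-w * φinv (t + d)))) (Y u ω) ∂P with hH
  have hlev := hY.lintegral_level_le h (p := 0) (y := (1 - e) * y) (B := 1) le_rfl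
    (h.inv_pos (t + d) (by linarith)) he he1 h3 (G := univ) MeasurableSet.univ
    (fun ω _ v _ _ => by have := Real.exp_pos (-(Y 0 ω) * v); linarith)
  simp only [zero_add, Measure.restrict_univ, measure_univ, mul_one, one_mul] at hlev
  calc _ ≤ ∑' j : ℕ, ENNReal.ofReal (2 / d) * ∫⁻ u in Ioo (j * d) (j * d + 2 * d), H u :=
        ENNReal.tsum_le_tsum fun j =>
          hY.measure_block_le h (by positivity) hd hdt hy (by linarith) hl h1 h2
    _ ≤ ENNReal.ofReal (2 / d) * (2 * ∫⁻ u in Ioi 0, H u) := by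
        rw [ENNReal.tsum_mul_left]
        exact mul_le_mul_right (lintegral_overlap_le hd H) _
    _ ≤ ENNReal.ofReal (2 / d) * (2 * ENNReal.ofReal _) := by
        gcongr
    _ = _ := by
        rw [show (2 : ℝ≥0∞) = ENNReal.ofReal 2 by simp, ← ENNReal.ofReal_mul (by norm_num),
          ← ENNReal.ofReal_mul (by positivity)]
        congr 1; ring

end BranchingProcess

lemma RegularExponent.exists_doubling_iterate {ψ φ φinv : ℝ → ℝ} (h : RegularExponent ψ φ φinv) :
    ∃ C : ℝ, 1 ≤ C ∧ ∀ n : ℕ, ∀ u : ℝ, 1 ≤ u → ψ (2 ^ n * u) ≤ C ^ n * ψ u := by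
  obtain ⟨C, hC, hd⟩ := h.doubling
  refine ⟨C, hC, fun n u hu => ?_⟩
  induction n with
  | zero => simp
  | succ n ih =>
    calc ψ (2 ^ (n + 1) * u) = ψ (2 * (2 ^ n * u)) := by ring_nf
      _ ≤ C * ψ (2 ^ n * u) := hd _ (one_le_mul_of_one_le_of_one_le (one_le_pow₀ (by norm_num)) hu)
      _ ≤ C * (C ^ n * ψ u) := by gcongr
      _ = _ := by ring

namespace BranchingProcess

variable {Ω : Type*} [mΩ : MeasurableSpace Ω] {ψ φ φinv : ℝ → ℝ} {P : Measure Ω}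
  {Y : ℝ → Ω → ℝ} [IsProbabilityMeasure P]

set_option maxHeartbeats 800000 in
lemma exists_exceed_extinct_le (hY : BranchingProcess φ φinv P Y) (h : RegularExponent ψ φ φinv)
    {θ : ℝ} (hθ : 1 < θ) :
    ∃ C θ' q₀ : ℝ, 0 < C ∧ 1 < θ' ∧ 1 ≤ q₀ ∧ ∀ q : ℝ, q₀ ≤ q →
      P {ω | ∃ p : ℚ, 0 ≤ (p : ℝ) ∧ θ * Real.log (Real.log q) / q < Y p ω ∧ Y (p + φ q) ω = 0} ≤
        ENNReal.ofReal (C * Real.exp (-(θ' * Real.log (Real.log q)))) := by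
  obtain ⟨D, hD, hDn⟩ := h.exists_doubling_iterate
  obtain ⟨U, hU, hup⟩ := h.exists_phi_mul_psi_le
  obtain ⟨c, hc, hlow⟩ := h.exists_le_phi_mul_psi
  obtain ⟨K, hK, hcmp⟩ := h.exists_inv_comparison
  set e : ℝ := (θ - 1) / (6 * θ) with he
  have he0 : 0 < e := div_pos (by linarith) (by linarith)
  have he1 : e ≤ 1 / 6 := by rw [he, div_le_div_iff₀ (by linarith) (by norm_num)]; linarith
  have heθ : (1 - 3 * e) * θ = (θ + 1) / 2 := by rw [he]; field_simp; ring
  obtain ⟨η, hη, hη1, hη2, hη3⟩ : ∃ η : ℝ, 0 < η ∧ η ≤ 1 / 2 ∧ η * K ≤ e ∧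
      η * (D ^ 2 * U) ≤ e / 2 := by
    refine ⟨min (1 / 2) (min (e / K) (e / 2 / (D ^ 2 * U))), by positivity, min_le_left _ _, ?_, ?_⟩
    · rw [← le_div_iff₀ hK]; exact (min_le_right _ _).trans (min_le_left _ _)
    · rw [← le_div_iff₀ (by positivity)]; exact (min_le_right _ _).trans (min_le_right _ _)
  obtain ⟨n, hn⟩ := pow_unbounded_of_one_lt (4 / e) (one_lt_two (α := ℝ))
  refine ⟨4 * D ^ n / (η * c), (θ + 1) / 2, max (2 ^ n) (Real.exp (Real.exp (2 / e))),
    by positivity, by linarith, le_max_of_le_left (one_le_pow₀ (by norm_num)), fun q hq => ?_⟩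
  have hqn : 2 ^ n ≤ q := (le_max_left _ _).trans hq
  have hq1 : 1 ≤ q := le_trans (one_le_pow₀ (by norm_num)) hqn
  have hq0 : 0 < q := by linarith
  set L := Real.log (Real.log q) with hL
  have hLe : 2 / e ≤ L := by
    rw [hL, Real.le_log_iff_exp_le, Real.le_log_iff_exp_le hq0]
    · exact (le_max_right _ _).trans hq
    · exact (Real.exp_pos _).trans_le
        ((Real.le_log_iff_exp_le hq0).2 ((le_max_right _ _).trans hq))
  have hLe' : 2 ≤ e * L := by rw [div_le_iff₀ he0] at hLe; linarith
  have hL0 : 0 < L := lt_of_lt_of_le (by positivity) hLe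
  set t := φ q with ht
  have ht0 : 0 < t := h.phi_pos q hq0
  have hqt : φinv t = q := h.invl q hq0
  set d := η * t with hd
  have hd0 : 0 < d := by positivity
  have hdt : d < t := by rw [hd]; nlinarith
  set q' := φinv (t + d) with hq'
  have hq'0 : 0 < q' := h.inv_pos _ (by linarith)
  have hq'1 : (1 - e) * q ≤ q' := by
    have := hcmp t (t + d) η ht0 (by linarith) hη.le (by rw [hqt]; exact hq1)
      (by rw [hd]; linarith)
    rw [hqt] at this
    refine le_trans ?_ this
    gcongr
  have hq'2 : q' ≤ q := by
    rw [← hqt]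
    exact h.inv_anti.antitoneOn ht0 (show 0 < t + d by linarith) (show t ≤ t + d by linarith)
  have hl : φinv (t - d) ≤ 2 * q := by
    have h1 : q ≤ φinv (t - d) := by
      rw [← hqt]
      exact h.inv_anti.antitoneOn (show 0 < t - d by linarith) ht0 (show t - d ≤ t by linarith)
    have := hcmp (t - d) t (2 * η) (by linarith) ht0 (by linarith) (by linarith)
      (by rw [hd]; nlinarith [mul_nonneg (mul_nonneg hη.le ht0.le) (show 0 ≤ 1 - 2 * η by linarith)])
    rw [hqt] at this
    have h2 : (1 / 2) * φinv (t - d) ≤ (1 - 2 * η * K) * φinv (t - d) := by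
      refine mul_le_mul_of_nonneg_right ?_ (by linarith)
      nlinarith
    linarith
  have hψ4 : ψ (q + φinv (t - d)) ≤ D ^ 2 * ψ q := by
    refine le_trans ?_ (hDn 2 q hq1)
    refine h.mono (show 0 < q + φinv (t - d) from add_pos hq0 (h.inv_pos _ (by linarith)))
      (show 0 < 2 ^ 2 * q by positivity) ?_
    linarith
  have hy : θ * L / q * q = θ * L := div_mul_cancel₀ _ hq0.ne'
  have hlog2 : Real.log 2 ≤ 1 := by have := Real.log_two_lt_d9; linarith
  have hθL : L ≤ θ * L := le_mul_of_one_le_left hL0.le hθ.le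
  have hc3 : 1 - 3 * e ≤ (1 - e) ^ 3 := by nlinarith [sq_nonneg e, mul_nonneg he0.le (sq_nonneg e)]
  have hq'y : (1 - e) * (θ * L) ≤ q' * (θ * L / q) := by
    rw [mul_div_assoc', le_div_iff₀ hq0]
    have := mul_le_mul_of_nonneg_right hq'1 (show 0 ≤ θ * L by positivity)
    linarith
  have hexp : (θ + 1) / 2 * L ≤ (1 - e) * q' * ((1 - e) * (θ * L / q)) := by
    calc (θ + 1) / 2 * L = (1 - 3 * e) * (θ * L) := by rw [← heθ]; ring
      _ ≤ (1 - e) ^ 3 * (θ * L) := by gcongr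
      _ = (1 - e) ^ 2 * ((1 - e) * (θ * L)) := by ring
      _ ≤ (1 - e) ^ 2 * (q' * (θ * L / q)) := by gcongr
      _ = _ := by ring
  refine (hY.measure_exceed_extinct_le h.toGreyExponent (d := d) (t := t) (y := θ * L / q) (e := e)
    (l := q) hd0 hdt (by positivity) he0 (by linarith) hq0 ?_ ?_ ?_).trans ?_
  · calc d * ψ (q + φinv (t - d)) ≤ d * (D ^ 2 * ψ q) := by gcongr
      _ = η * D ^ 2 * (t * ψ q) := by rw [hd]; ring
      _ ≤ η * D ^ 2 * (U * q) := mul_le_mul_of_nonneg_left (hup q hq1) (by positivity)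
      _ = η * (D ^ 2 * U) * q := by ring
      _ ≤ _ := by gcongr
  · calc Real.log 2 ≤ 1 := hlog2
      _ ≤ e * L / 2 := by linarith
      _ ≤ e * (θ * L) / 2 := by gcongr
      _ = θ * L / q * (e / 2 * q) := by
        rw [show θ * L / q * (e / 2 * q) = e / 2 * (θ * L / q * q) by ring, hy]; ring
  · have h1 : L ≤ (θ + 1) / 2 * L := le_mul_of_one_le_left hL0.le (by linarith)
    have h2 : (1 - e) * q' * ((1 - e) * (θ * L / q)) ≤ q' * ((1 - e) * (θ * L / q)) := by
      refine mul_le_mul_of_nonneg_right ?_ ?_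
      · nlinarith
      · have : 0 ≤ 1 - e := by linarith
        positivity
    calc Real.log 2 ≤ 1 := hlog2
      _ ≤ e * L / 2 := by linarith
      _ ≤ e * (q' * ((1 - e) * (θ * L / q))) / 2 := by
        have := mul_le_mul_of_nonneg_left (h1.trans (hexp.trans h2)) he0.le
        linarith
      _ = e * q' * ((1 - e) * (θ * L / q)) / 2 := by ring
  · refine ENNReal.ofReal_le_ofReal ?_
    set v := e * q' / 2 with hv
    have hv0 : 0 < v := by positivity
    have hvq : v ≤ q := by rw [hv]; nlinarith
    have hqv : q / 2 ^ n ≤ v := by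
      rw [div_le_iff₀ (by positivity)]
      have h1 : e / 4 * q ≤ v := by rw [hv]; nlinarith
      have h2 : 4 ≤ e * 2 ^ n := by rw [div_lt_iff₀ he0] at hn; linarith
      calc q ≤ e * 2 ^ n / 4 * q := le_mul_of_one_le_left hq0.le (by linarith)
        _ = e / 4 * q * 2 ^ n := by ring
        _ ≤ _ := by gcongr
    have hψq := h.pos q hq0
    have hψv : ψ q ≤ D ^ n * ψ v := by
      have h1 := hDn n (q / 2 ^ n) (by rwa [one_le_div (by positivity)])
      rw [mul_div_cancel₀ _ (by positivity)] at h1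
      refine h1.trans ?_
      gcongr
      exact h.mono (show 0 < q / 2 ^ n by positivity) hv0 hqv
    have hψv0 := h.pos v hv0
    have hvψ : v / ψ v ≤ D ^ n * t / c := by
      rw [div_le_div_iff₀ hψv0 hc]
      calc v * c ≤ c * q := by nlinarith
        _ ≤ t * ψ q := hlow q hq1
        _ ≤ t * (D ^ n * ψ v) := by gcongr
        _ = _ := by ring
    refine (mul_le_mul_of_nonneg_left (mul_le_mul (Real.exp_le_exp.2 (neg_le_neg hexp)) hvψ
      (div_pos hv0 hψv0).le (Real.exp_pos _).le) (by positivity)).trans_eq ?_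
    rw [hd]
    field_simp

end BranchingProcess

lemma summable_exp_neg_log_log_pow {r θ : ℝ} (hr : 1 < r) (hθ : 1 < θ) :
    Summable fun n : ℕ => Real.exp (-(θ * Real.log (Real.log (r ^ n)))) := by
  have h1 : Summable fun n : ℕ => (Real.log r) ^ (-θ) * (n : ℝ) ^ (-θ) :=
    (Real.summable_nat_rpow.2 (by linarith)).mul_left _
  refine (summable_nat_add_iff 1).1 (((summable_nat_add_iff 1).2 h1).congr fun n => ?_)
  have hlog := Real.log_pos hr
  have hn : (0 : ℝ) < ((n + 1 : ℕ) : ℝ) := by positivity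
  rw [Real.log_pow, ← Real.mul_rpow hlog.le hn.le, mul_comm (Real.log r),
    Real.rpow_def_of_pos (by positivity)]
  congr 1
  ring

namespace BranchingProcess

variable {Ω : Type*} [mΩ : MeasurableSpace Ω] {ψ φ φinv : ℝ → ℝ} {P : Measure Ω}
  {Y : ℝ → Ω → ℝ} [IsProbabilityMeasure P]

lemma ae_eventually_le (hY : BranchingProcess φ φinv P Y) (h : RegularExponent ψ φ φinv)
    {θ : ℝ} (hθ : 1 < θ) :
    ∀ᵐ ω ∂P, ∀ T : ℝ, 0 < T → (∀ s : ℝ, T ≤ s → Y s ω = 0) →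
      ∀ᶠ t in 𝓝[>] (0 : ℝ), Y (T - t) ω ≤ θ * (Real.log (Real.log (φinv t)) / φinv t) := by
  set r := Real.sqrt θ with hr
  have hr1 : 1 < r := by rw [hr, Real.lt_sqrt zero_le_one]; simpa using hθ
  have hrr : r * r = θ := Real.mul_self_sqrt (by linarith)
  obtain ⟨C, θ', q₀, hC, hθ', hq₀, hbound⟩ := hY.exists_exceed_extinct_le h hr1
  set E : ℕ → Set Ω := fun n => {ω | ∃ p : ℚ, 0 ≤ (p : ℝ) ∧
    r * Real.log (Real.log (r ^ n)) / r ^ n < Y p ω ∧ Y (p + φ (r ^ n)) ω = 0} with hE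
  obtain ⟨N, hN⟩ := pow_unbounded_of_one_lt q₀ hr1
  have hsum : ∑' n, P (E (n + N)) ≠ ⊤ := by
    refine ne_top_of_le_ne_top (Summable.tsum_ofReal_ne_top
      ((summable_nat_add_iff N).2 ((summable_exp_neg_log_log_pow hr1 hθ').mul_left C)))
      (ENNReal.tsum_le_tsum fun n => hbound _ ?_)
    exact hN.le.trans (pow_le_pow_right₀ hr1.le (by omega))
  filter_upwards [ae_eventually_notMem hsum] with ω hω T hT hext
  obtain ⟨N', hN'⟩ := eventually_atTop.1 hω
  have hlarge : ∀ᶠ t in 𝓝[>] (0 : ℝ), max (r ^ (N' + N + 1)) (Real.exp 1) ≤ φinv t :=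
    h.tendsto_inv_zero.eventually_ge_atTop _
  filter_upwards [hlarge, self_mem_nhdsWithin,
    mem_nhdsWithin_of_mem_nhds (Iio_mem_nhds hT)] with t ht ht0 htT
  have ht0 : 0 < t := ht0
  have htT : t < T := htT
  set q := φinv t with hq
  have hqN := (le_max_left _ _).trans ht
  have hq1 : 1 ≤ q := (one_le_pow₀ hr1.le).trans hqN
  have hq0 : 0 < q := by linarith
  obtain ⟨n, hn1, hn2⟩ := exists_nat_pow_near hq1 hr1
  have hnN : N' + N + 1 ≤ n := by
    have := (pow_lt_pow_iff_right₀ hr1).1 (hqN.trans_lt hn2)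
    omega
  have hqn1 : 1 < r ^ n := one_lt_pow₀ hr1 (by omega)
  have hqn0 : 0 < r ^ n := by linarith
  by_contra! hlt
  have hlogq : 1 ≤ Real.log q := (Real.le_log_iff_exp_le hq0).2 ((le_max_right _ _).trans ht)
  have hL : Real.log (Real.log (r ^ n)) ≤ Real.log (Real.log q) :=
    Real.log_le_log (Real.log_pos hqn1) (Real.log_le_log hqn0 hn1)
  have hL0 : 0 ≤ Real.log (Real.log q) := Real.log_nonneg hlogq
  have hy : r * Real.log (Real.log (r ^ n)) / r ^ n < Y (T - t) ω := by
    refine lt_of_le_of_lt ?_ hlt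
    rw [mul_div_assoc', div_le_div_iff₀ hqn0 hq0]
    calc r * Real.log (Real.log (r ^ n)) * q ≤ r * Real.log (Real.log q) * r ^ (n + 1) := by
          gcongr
      _ = r * r * Real.log (Real.log q) * r ^ n := by ring
      _ = _ := by rw [hrr]
  obtain ⟨p, hp1, -, hp⟩ := exists_rat_of_eventually_nhdsGT (show T - t < T by linarith)
    (hY.eventually_nhdsGT ω (t := T - t) (by linarith) isOpen_Ioi hy)
  have htn : t ≤ φ (r ^ n) := by
    rw [← h.invr t ht0]
    exact h.phi_anti.antitoneOn hqn0 hq0 hn1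
  refine hN' (n - N) (by omega) ?_
  rw [Nat.sub_add_cancel (by omega)]
  exact ⟨p, by linarith, hp, hext _ (by linarith)⟩

end BranchingProcess

/-- The time spent after `p` above the level `y`, at instants from which the process dies within
time `t`. -/
noncomputable def occupation {Ω : Type*} (Y : ℝ → Ω → ℝ) (y t p : ℝ) (ω : Ω) : ℝ≥0∞ :=
  volume {u | p < u ∧ y < Y u ω ∧ Y (u + t) ω = 0}

namespace BranchingProcess

variable {Ω : Type*} [mΩ : MeasurableSpace Ω] {ψ φ φinv : ℝ → ℝ} {P : Measure Ω}
  {Y : ℝ → Ω → ℝ}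

lemma measurableSet_occupation (hY : BranchingProcess φ φinv P Y) (y t p : ℝ) :
    MeasurableSet {z : Ω × ℝ | p < z.2 ∧ y < Y (max z.2 0) z.1 ∧ Y (max (z.2 + t) 0) z.1 = 0} := by
  have h1 : Measurable fun z : Ω × ℝ => Y (max z.2 0) z.1 :=
    hY.measurable_uncurry.comp measurable_swap
  have h2 : Measurable fun z : Ω × ℝ => Y (max (z.2 + t) 0) z.1 :=
    hY.measurable_uncurry.comp (f := fun z : Ω × ℝ => (z.2 + t, z.1)) (by fun_prop)
  exact (measurableSet_lt measurable_const measurable_snd).inter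
    ((measurableSet_lt measurable_const h1).inter (h2 (measurableSet_singleton 0)))

omit mΩ in
lemma occupation_eq {y t p : ℝ} (hp : 0 ≤ p) (ht : 0 ≤ t) (ω : Ω) :
    occupation Y y t p ω = volume (Prod.mk ω ⁻¹'
      {z : Ω × ℝ | p < z.2 ∧ y < Y (max z.2 0) z.1 ∧ Y (max (z.2 + t) 0) z.1 = 0}) := by
  rw [occupation]
  congr 1
  ext u
  simp only [mem_ofPred_eq, mem_preimage]
  refine and_congr_right fun hu => ?_
  rw [max_eq_left (by linarith), max_eq_left (by linarith)]

lemma measurable_occupation (hY : BranchingProcess φ φinv P Y) {y t p : ℝ} (hp : 0 ≤ p)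
    (ht : 0 ≤ t) : Measurable (occupation Y y t p) := by
  rw [show occupation Y y t p = _ from funext fun ω => occupation_eq hp ht ω]
  exact measurable_measure_prodMk_left (hY.measurableSet_occupation y t p)

variable [IsProbabilityMeasure P]

lemma setLIntegral_occupation (hY : BranchingProcess φ φinv P Y) (h : GreyExponent ψ φ φinv)
    {y t p : ℝ} (hp : 0 ≤ p) (ht : 0 < t) {G : Set Ω} (hG : MeasurableSet[past Y p] G) :
    ∫⁻ ω in G, occupation Y y t p ω ∂P =
      ∫⁻ u in Ioi 0, ∫⁻ ω in G, (Ioi y).indicator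
        (fun w => ENNReal.ofReal (Real.exp (-w * φinv t))) (Y (p + u) ω) ∂P := by
  have hA := hY.measurableSet_occupation y t p
  simp_rw [occupation_eq hp ht.le]
  rw [← Measure.prod_apply hA, Measure.prod_apply_symm hA,
    ← lintegral_add_left_eq_self _ p, ← lintegral_indicator measurableSet_Ioi]
  refine lintegral_congr fun u => ?_
  by_cases hu : u ∈ Ioi (0 : ℝ)
  · have hu0 : 0 < u := hu
    have hpu : 0 ≤ p + u := by linarith
    have hE : MeasurableSet[past Y (p + u)] {ω | y < Y (p + u) ω} :=
      measurableSet_past Y hpu le_rfl measurableSet_Ioi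
    have hE' := hY.past_le _ _ hE
    have hG' : MeasurableSet[past Y (p + u)] G := past_mono Y (by linarith) _ hG
    rw [indicator_of_mem hu]
    have h1 : ((fun ω => (ω, p + u)) ⁻¹' {z : Ω × ℝ | p < z.2 ∧ y < Y (max z.2 0) z.1 ∧
        Y (max (z.2 + t) 0) z.1 = 0}) = {ω | y < Y (p + u) ω} ∩ {ω | Y (p + u + t) ω = 0} := by
      ext ω
      simp [max_eq_left hpu, max_eq_left (show 0 ≤ p + u + t by linarith), hu0]
    rw [h1, Measure.restrict_apply' (hY.past_le _ _ hG), inter_right_comm,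
      hY.measure_inter_extinct h ht hpu (hE.inter hG'), ← setLIntegral_indicator hE']
    refine lintegral_congr fun ω => ?_
    by_cases hω : y < Y (p + u) ω
    · rw [indicator_of_mem (show Y (p + u) ω ∈ Ioi y from hω), indicator_of_mem (by exact hω)]
    · rw [indicator_of_notMem (show Y (p + u) ω ∉ Ioi y from hω),
        indicator_of_notMem (by exact hω)]
  · have hu0 : ¬ 0 < u := hu
    rw [indicator_of_notMem hu]
    simp [hu0]

/-- From a small initial value the expected occupation is small. -/
lemma setLIntegral_occupation_le (hY : BranchingProcess φ φinv P Y) (h : GreyExponent ψ φ φinv)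
    {y t p z q : ℝ} (hp : 0 ≤ p) (ht : 0 < t) (hq : φinv t = q) (hlog : Real.log 2 ≤ q * y / 2)
    {G : Set Ω} (hG : MeasurableSet[past Y p] G) (hGz : ∀ ω ∈ G, Y p ω ≤ z) :
    ∫⁻ ω in G, occupation Y y t p ω ∂P ≤
      ENNReal.ofReal (z * q * ((q / 2) / ψ (q / 2))) * P G := by
  have hq0 : 0 < q := hq ▸ h.inv_pos t ht
  have := hY.lintegral_level_le h (p := p) (q := q) (y := y) (k := 1) (B := z * q) hp hq0 one_pos
    le_rfl (by simpa using hlog) hG (fun ω hω v hv hvq => ?_)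
  · rw [hY.setLIntegral_occupation h hp ht hG, hq]
    simp only [sub_self, zero_mul, neg_zero, Real.exp_zero, one_mul] at this
    refine le_trans (lintegral_mono fun u => lintegral_mono fun ω => ?_) this
    exact indicator_le_indicator_of_subset Ioi_subset_Ici_self (fun _ => zero_le) _
  · have h0 := hY.nonneg p hp ω
    have h1 := Real.add_one_le_exp (-(Y p ω) * v)
    have h2 : Y p ω * v ≤ z * q := by
      have := hGz ω hω
      have : v ≤ q := by linarith
      exact mul_le_mul (hGz ω hω) this hv.le (by linarith)
    linarith

end BranchingProcess

lemma exp_div_le_setIntegral_scale {ψ W : ℝ → ℝ} (hψpos : ∀ u : ℝ, 0 < u → 0 < ψ u)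
    (hWnonneg : ∀ y : ℝ, 0 ≤ y → 0 ≤ W y) (hWmono : MonotoneOn W (Ici 0))
    (hWlaplace : ∀ lam : ℝ, 0 < lam →
      ∫ y in Set.Ioi (0 : ℝ), Real.exp (-lam * y) * W y = (ψ lam)⁻¹)
    {q y D : ℝ} (hq : 0 < q) (hy : 0 < y) (hD : ψ q ≤ D * ψ (q / 2))
    (hDy : D * Real.exp (-(q * y)) ≤ 1 / 2) :
    Real.exp (-(q * y)) / (2 * ψ q) ≤ ∫ w in Ioc y (4 * y), Real.exp (-q * w) * W w := by
  obtain ⟨hi1, he1⟩ := integral_exp_mul_scaleExt_sub hψpos hWlaplace (v := q) (z := y) hq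
  obtain ⟨hi2, he2⟩ := integral_exp_mul_scaleExt_sub hψpos hWlaplace (v := q / 2) (z := 0)
    (by positivity)
  have hi3 : IntegrableOn (fun w => Real.exp (-q * w) * W w) (Ioc y (4 * y)) :=
    (integrable_exp_mul_scale hψpos hWlaplace hq).mono_set fun w hw => hy.trans hw.1
  have hsnn : ∀ r, 0 ≤ scaleExt W r := fun r =>
    indicator_nonneg (fun r hr => hWnonneg r (le_of_lt hr)) r
  have hle : Real.exp (-y * q) * (ψ q)⁻¹ ≤ (∫ w in Ioc y (4 * y), Real.exp (-q * w) * W w) +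
      Real.exp (-(2 * (q * y))) * (Real.exp (-0 * (q / 2)) * (ψ (q / 2))⁻¹) := by
    rw [← he1, ← he2, ← integral_indicator measurableSet_Ioc, ← integral_const_mul,
      ← integral_add ((integrable_indicator_iff measurableSet_Ioc).2 hi3) (hi2.const_mul _)]
    refine integral_mono hi1
      (((integrable_indicator_iff measurableSet_Ioc).2 hi3).add (hi2.const_mul _)) fun w => ?_
    dsimp only
    rw [sub_zero]
    have hnn : 0 ≤ Real.exp (-(2 * (q * y))) * (Real.exp (-(q / 2) * w) * scaleExt W w) :=
      mul_nonneg (Real.exp_pos _).le (mul_nonneg (Real.exp_pos _).le (hsnn w))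
    have hind : 0 ≤ (Ioc y (4 * y)).indicator (fun w => Real.exp (-q * w) * W w) w :=
      indicator_nonneg (fun r hr => mul_nonneg (Real.exp_pos _).le
        (hWnonneg r (hy.trans hr.1).le)) w
    rcases le_or_gt w y with hwy | hwy
    · rw [scaleExt_of_nonpos (by linarith), mul_zero]
      exact add_nonneg hind hnn
    · have hw0 : 0 < w := by linarith
      have hshift : scaleExt W (w - y) ≤ W w := by
        rw [scaleExt_of_pos (by linarith)]
        exact hWmono (show 0 ≤ w - y by linarith) hw0.le (by linarith)
      rcases le_or_gt w (4 * y) with hw4 | hw4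
      · rw [indicator_of_mem (show w ∈ Ioc y (4 * y) from ⟨hwy, hw4⟩)]
        have := mul_le_mul_of_nonneg_left hshift (Real.exp_pos (-q * w)).le
        linarith
      · rw [scaleExt_of_pos hw0]
        refine le_trans ?_ (le_add_of_nonneg_left hind)
        rw [← mul_assoc, ← Real.exp_add]
        refine mul_le_mul (Real.exp_le_exp.2 ?_) hshift (hsnn _) (Real.exp_pos _).le
        nlinarith
  have hψq := hψpos q hq
  have hψq2 := hψpos (q / 2) (by positivity)
  have hexp : Real.exp (-(2 * (q * y))) = Real.exp (-(q * y)) * Real.exp (-(q * y)) := by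
    rw [← Real.exp_add]; ring_nf
  rw [neg_zero, zero_mul, Real.exp_zero, one_mul, hexp, show -y * q = -(q * y) by ring] at hle
  have hinv : (ψ (q / 2))⁻¹ ≤ D * (ψ q)⁻¹ := by
    rw [← div_eq_mul_inv, le_div_iff₀ hψq, inv_mul_le_iff₀ hψq2, mul_comm]
    exact hD
  have hE := Real.exp_pos (-(q * y))
  have h1 : Real.exp (-(q * y)) * Real.exp (-(q * y)) * (ψ (q / 2))⁻¹ ≤
      Real.exp (-(q * y)) * (1 / 2) * (ψ q)⁻¹ := by
    calc Real.exp (-(q * y)) * Real.exp (-(q * y)) * (ψ (q / 2))⁻¹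
        ≤ Real.exp (-(q * y)) * Real.exp (-(q * y)) * (D * (ψ q)⁻¹) := by gcongr
      _ = Real.exp (-(q * y)) * (D * Real.exp (-(q * y))) * (ψ q)⁻¹ := by ring
      _ ≤ _ := by gcongr
  have h2 : Real.exp (-(q * y)) / (2 * ψ q) = Real.exp (-(q * y)) * (1 / 2) * (ψ q)⁻¹ := by
    field_simp
  linarith

namespace BranchingProcess

variable {Ω : Type*} [mΩ : MeasurableSpace Ω] {ψ φ φinv W : ℝ → ℝ} {P : Measure Ω}
  {Y : ℝ → Ω → ℝ} [IsProbabilityMeasure P]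

/-- From a not too small initial value the expected occupation is bounded below. -/
lemma le_setLIntegral_occupation (hY : BranchingProcess φ φinv P Y) (h : GreyExponent ψ φ φinv)
    (hWnonneg : ∀ y : ℝ, 0 ≤ y → 0 ≤ W y) (hWmono : MonotoneOn W (Ici 0))
    (hWlaplace : ∀ lam : ℝ, 0 < lam →
      ∫ y in Set.Ioi (0 : ℝ), Real.exp (-lam * y) * W y = (ψ lam)⁻¹)
    {y t p z q D β r : ℝ} (hp : 0 ≤ p) (ht : 0 < t) (hq : φinv t = q) (hy : 0 < y)
    (hD : ψ q ≤ D * ψ (q / 2)) (hDy : D * Real.exp (-(q * y)) ≤ 1 / 2) (hr : r ≤ 1)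
    (hβ : 0 < β) (hβz : (1 - β) * (4 * y) ≤ z) (hβ1 : β ≤ 1)
    (hβr : ∀ w, y < w → w ≤ 4 * y → W (β * w) ≤ r * W w)
    {G : Set Ω} (hG : MeasurableSet[past Y p] G) (hGz : ∀ ω ∈ G, z ≤ Y p ω) :
    ENNReal.ofReal ((1 - r) / (4 * y) * (Real.exp (-(q * y)) / (2 * ψ q))) * P G ≤
      ∫⁻ ω in G, occupation Y y t p ω ∂P := by
  have hq0 : 0 < q := hq ▸ h.inv_pos t ht
  have hf : Measurable ((Ioi y).indicator fun w => ENNReal.ofReal (Real.exp (-w * q))) :=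
    Measurable.indicator (by fun_prop) measurableSet_Ioi
  have hocc := hY.lintegral_occupation h hWnonneg hWmono hWlaplace hp hG hf
  rw [indicator_indicator, inter_eq_right.2 (Ioi_subset_Ioi hy.le)] at hocc
  rw [hY.setLIntegral_occupation h hp ht hG, hq, hocc]
  have hGm := hY.past_le p _ hG
  have hi3 : IntegrableOn (fun w => Real.exp (-q * w) * W w) (Ioc y (4 * y)) :=
    (integrable_exp_mul_scale h.pos hWlaplace hq0).mono_set fun w hw => hy.trans hw.1
  have hr0 : 0 ≤ (1 - r) / (4 * y) := div_nonneg (by linarith) (by linarith)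
  calc ENNReal.ofReal ((1 - r) / (4 * y) * (Real.exp (-(q * y)) / (2 * ψ q))) * P G
      ≤ ENNReal.ofReal ((1 - r) / (4 * y) *
          ∫ w in Ioc y (4 * y), Real.exp (-q * w) * W w) * P G := by
        gcongr
        exact exp_div_le_setIntegral_scale h.pos hWnonneg hWmono hWlaplace hq0 hy hD hDy
    _ = ∫⁻ w in Ioc y (4 * y), ENNReal.ofReal (Real.exp (-q * w)) *
          (ENNReal.ofReal ((1 - r) * W w / (4 * y)) * P G) := by
        rw [← integral_const_mul, ofReal_integral_eq_lintegral_ofReal (hi3.const_mul _),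
          ← lintegral_mul_const' _ _ (measure_ne_top _ _)]
        · refine lintegral_congr fun w => ?_
          rw [← mul_assoc (ENNReal.ofReal (Real.exp (-q * w))),
            ← ENNReal.ofReal_mul (Real.exp_pos _).le]
          congr 2
          ring
        · filter_upwards [ae_restrict_mem measurableSet_Ioc] with w hw
          exact mul_nonneg hr0 (mul_nonneg (Real.exp_pos _).le (hWnonneg w (hy.trans hw.1).le))
    _ ≤ ∫⁻ w in Ioc y (4 * y), (Ioi y).indicator (fun w => ENNReal.ofReal (Real.exp (-w * q))) w *
          ∫⁻ ω in G, ENNReal.ofReal ((scaleExt W w - scaleExt W (w - Y p ω)) / w) ∂P := by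
        refine setLIntegral_mono' measurableSet_Ioc fun w hw => ?_
        have hw0 : 0 < w := hy.trans hw.1
        rw [indicator_of_mem (show w ∈ Ioi y from hw.1), show -w * q = -q * w by ring]
        refine mul_le_mul_right ?_ _
        rw [← setLIntegral_const]
        refine setLIntegral_mono' hGm fun ω hω => ENNReal.ofReal_le_ofReal ?_
        have h1 : scaleExt W (w - Y p ω) ≤ r * W w := by
          refine le_trans (scaleExt_monotone hWnonneg hWmono
            (show w - Y p ω ≤ β * w from ?_)) ?_
          · have h2 := hGz ω hω
            have h3 : (1 - β) * w ≤ (1 - β) * (4 * y) :=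
              mul_le_mul_of_nonneg_left hw.2 (by linarith)
            linarith
          · rw [scaleExt_of_pos (by positivity)]
            exact hβr w hw.1 hw.2
        have hWw := hWnonneg w hw0.le
        have h2 : 0 ≤ (1 - r) * W w := mul_nonneg (by linarith) hWw
        rw [scaleExt_of_pos hw0]
        calc (1 - r) * W w / (4 * y) ≤ (1 - r) * W w / w :=
              div_le_div_of_nonneg_left h2 hw0 hw.2
          _ ≤ _ := by gcongr; linarith
    _ ≤ _ := lintegral_mono_set fun w hw => hy.trans hw.1

end BranchingProcess

/-- The grid of mesh `δ` meets `[0, z]` for the first time at the index `i`. -/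
def gridHit {Ω : Type*} (Y : ℝ → Ω → ℝ) (δ z : ℝ) (i : ℕ) : Set Ω :=
  {ω | Y (i * δ) ω ≤ z ∧ ∀ j < i, z < Y (j * δ) ω}

/-- The process exceeds `y` between the grid indices `i` and `j`, at most `t` before the latter. -/
def gridExceed {Ω : Type*} (Y : ℝ → Ω → ℝ) (δ y t : ℝ) (i j : ℕ) : Set Ω :=
  {ω | ∃ s : ℚ, (i : ℝ) * δ ≤ s ∧ (s : ℝ) < j * δ ∧ (j : ℝ) * δ ≤ s + t ∧ y < Y s ω}

section

variable {Ω : Type*} {Y : ℝ → Ω → ℝ}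

lemma measurableSet_gridHit {δ : ℝ} (hδ : 0 ≤ δ) (z : ℝ) (i : ℕ) :
    MeasurableSet[past Y (i * δ)] (gridHit Y δ z i) := by
  have h1 : gridHit Y δ z i = {ω | Y (i * δ) ω ∈ Iic z} ∩
      ⋂ j : ℕ, ⋂ _ : j < i, {ω | Y (j * δ) ω ∈ Ioi z} := by
    ext ω; simp [gridHit]
  rw [h1]
  refine MeasurableSet.inter (BranchingProcess.measurableSet_past Y (by positivity) le_rfl measurableSet_Iic)
    (MeasurableSet.iInter fun j => MeasurableSet.iInter fun hj =>
      BranchingProcess.measurableSet_past Y (by positivity) ?_ measurableSet_Ioi)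
  gcongr

lemma measurableSet_gridExceed {δ : ℝ} (hδ : 0 ≤ δ) (y t : ℝ) (i j : ℕ) :
    MeasurableSet[past Y (j * δ)] (gridExceed Y δ y t i j) := by
  have h1 : gridExceed Y δ y t i j = ⋃ s : ℚ, ⋃ _ : (i : ℝ) * δ ≤ s ∧ (s : ℝ) < j * δ ∧
      (j : ℝ) * δ ≤ s + t, {ω | Y s ω ∈ Ioi y} := by
    ext ω
    simp only [gridExceed, mem_ofPred_eq, mem_iUnion, mem_Ioi, exists_prop, and_assoc]
  rw [h1]
  refine MeasurableSet.iUnion fun s => MeasurableSet.iUnion fun hs => ?_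
  exact BranchingProcess.measurableSet_past Y (le_trans (by positivity) hs.1) hs.2.1.le measurableSet_Ioi

lemma gridHit_le {δ z z' : ℝ} {i j : ℕ} {ω : Ω} (hz : z' ≤ z) (hi : ω ∈ gridHit Y δ z i)
    (hj : ω ∈ gridHit Y δ z' j) : i ≤ j := by
  by_contra! hlt
  exact absurd (hi.2 j hlt) (not_lt.2 (hj.1.trans hz))

lemma gridHit_unique {δ z : ℝ} {i j : ℕ} {ω : Ω} (hi : ω ∈ gridHit Y δ z i)
    (hj : ω ∈ gridHit Y δ z j) : i = j :=
  le_antisymm (gridHit_le le_rfl hi hj) (gridHit_le le_rfl hj hi)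

lemma pairwise_disjoint_gridHit (Y : ℝ → Ω → ℝ) (δ z : ℝ) :
    Pairwise (Function.onFun Disjoint (gridHit Y δ z)) := fun _ _ hij =>
  disjoint_left.2 fun _ h1 h2 => hij (gridHit_unique h1 h2)

lemma exists_gridHit {δ z s : ℝ} {ω : Ω} (hδ : 0 < δ) (hz : 0 ≤ z) (hs : 0 ≤ s)
    (habs : ∀ s r : ℝ, 0 ≤ s → s ≤ r → Y s ω = 0 → Y r ω = 0) (hs0 : Y s ω = 0) :
    ∃ i, ω ∈ gridHit Y δ z i ∧ (i : ℝ) * δ < s + δ := by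
  have hex : ∃ i : ℕ, Y (i * δ) ω ≤ z := by
    refine ⟨⌈s / δ⌉₊, ?_⟩
    rw [habs s _ hs ((div_le_iff₀ hδ).1 (Nat.le_ceil _)) hs0]
    exact hz
  refine ⟨Nat.find hex, ⟨Nat.find_spec hex, fun j hj => not_le.1 (Nat.find_min hex hj)⟩, ?_⟩
  have h1 : Nat.find hex ≤ ⌈s / δ⌉₊ := Nat.find_min' hex (by
    rw [habs s _ hs ((div_le_iff₀ hδ).1 (Nat.le_ceil _)) hs0]
    exact hz)
  have h2 : (⌈s / δ⌉₊ : ℝ) < s / δ + 1 := Nat.ceil_lt_add_one (by positivity)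
  calc ((Nat.find hex : ℕ) : ℝ) * δ ≤ (⌈s / δ⌉₊ : ℝ) * δ := by gcongr
    _ < (s / δ + 1) * δ := by gcongr
    _ = s + δ := by field_simp

end

namespace BranchingProcess

variable {Ω : Type*} [mΩ : MeasurableSpace Ω] {ψ φ φinv : ℝ → ℝ} {P : Measure Ω}
  {Y : ℝ → Ω → ℝ}

lemma occupation_le_of_gridHit (hY : BranchingProcess φ φinv P Y) {ω : Ω}
    (habs : ∀ s r : ℝ, 0 ≤ s → s ≤ r → Y s ω = 0 → Y r ω = 0)
    {δ y t t' z' : ℝ} {i j : ℕ} (hδ : 0 < δ) (hy : 0 ≤ y) (ht : 0 < t)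
    (ht' : t + δ ≤ t') (hz' : 0 ≤ z') (hj : ω ∈ gridHit Y δ z' j) :
    occupation Y y t (i * δ) ω ≤
      ENNReal.ofReal t * (gridExceed Y δ y t' i j).indicator 1 ω +
        occupation Y y t (j * δ) ω := by
  set B : Set ℝ := {u | (i : ℝ) * δ < u ∧ u < j * δ ∧ y < Y u ω ∧ Y (u + t) ω = 0} with hB
  have hi0 : (0 : ℝ) ≤ i * δ := by positivity
  have hcover : occupation Y y t (i * δ) ω ≤ volume B + occupation Y y t (j * δ) ω := by
    calc occupation Y y t (i * δ) ω
        ≤ volume (B ∪ ({(j : ℝ) * δ} ∪ {u | (j : ℝ) * δ < u ∧ y < Y u ω ∧ Y (u + t) ω = 0})) := by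
          refine measure_mono fun u hu => ?_
          rcases lt_trichotomy u (j * δ) with h | h | h
          · exact Or.inl ⟨hu.1, h, hu.2⟩
          · exact Or.inr (Or.inl h)
          · exact Or.inr (Or.inr ⟨h, hu.2⟩)
      _ ≤ volume B + (volume {(j : ℝ) * δ} + occupation Y y t (j * δ) ω) :=
          (measure_union_le _ _).trans (add_le_add le_rfl (measure_union_le _ _))
      _ = _ := by simp
  refine hcover.trans (add_le_add ?_ le_rfl)
  rcases B.eq_empty_or_nonempty with he | ⟨u, hu⟩
  · simp [he]
  have hmem : ω ∈ gridExceed Y δ y t' i j := by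
    obtain ⟨s, hs1, hs2, hs⟩ := exists_rat_of_eventually_nhdsGT hu.2.1
      (hY.eventually_nhdsGT ω (t := u) (hi0.trans hu.1.le) isOpen_Ioi hu.2.2.1)
    obtain ⟨k, hk, hk'⟩ := exists_gridHit hδ hz' (show 0 ≤ u + t by linarith [hu.1]) habs
      hu.2.2.2
    rw [gridHit_unique hk hj] at hk'
    exact ⟨s, hu.1.le.trans hs1.le, hs2, by linarith, hs⟩
  rw [indicator_of_mem hmem, Pi.one_apply, mul_one]
  refine (Real.volume_le_diam B).trans (Metric.ediam_le fun a ha b hb => ?_)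
  have hlt : ∀ a ∈ B, ∀ b ∈ B, a ≤ b + t := fun a ha b hb => by
    by_contra! hgt
    have := habs _ a (by linarith [hb.1]) hgt.le hb.2.2.2
    linarith [ha.2.2.1]
  rw [edist_dist, Real.dist_eq]
  refine ENNReal.ofReal_le_ofReal (abs_le.2 ⟨?_, ?_⟩)
  · linarith [hlt b hb a ha]
  · linarith [hlt a ha b hb]

lemma setLIntegral_occupation_le_of_gridHit (hY : BranchingProcess φ φinv P Y)
    (habs : ∀ᵐ ω ∂P, ∀ s r : ℝ, 0 ≤ s → s ≤ r → Y s ω = 0 → Y r ω = 0)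
    (hext : ∀ᵐ ω ∂P, ∃ s : ℝ, 0 ≤ s ∧ Y s ω = 0)
    {δ y t t' z z' d : ℝ} {i : ℕ} (hδ : 0 < δ) (hy : 0 ≤ y) (ht : 0 < t)
    (ht' : t + δ ≤ t') (hz' : 0 ≤ z') (hzz : z' ≤ z)
    (hup : ∀ p : ℝ, 0 ≤ p → ∀ G : Set Ω, MeasurableSet[past Y p] G → (∀ ω ∈ G, Y p ω ≤ z') →
      ∫⁻ ω in G, occupation Y y t p ω ∂P ≤ ENNReal.ofReal (t * d) * P G)
    {G : Set Ω} (hG : MeasurableSet[past Y (i * δ)] G) (hGi : G ⊆ gridHit Y δ z i) :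
    ∫⁻ ω in G, occupation Y y t (i * δ) ω ∂P ≤
      ENNReal.ofReal t * P (G ∩ ⋃ j, gridHit Y δ z' j ∩ gridExceed Y δ y t' i j) +
        ENNReal.ofReal (t * d) * P G := by
  have hGm := hY.past_le _ _ hG
  have hHm : ∀ j, MeasurableSet (gridHit Y δ z' j) := fun j =>
    hY.past_le _ _ (measurableSet_gridHit hδ.le z' j)
  set S := ⋃ j, gridHit Y δ z' j ∩ gridExceed Y δ y t' i j with hS
  have hSm : MeasurableSet S := MeasurableSet.iUnion fun j =>
    (hHm j).inter (hY.past_le _ _ (measurableSet_gridExceed hδ.le y t' i j))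
  have hpt : ∀ᵐ ω ∂P.restrict G, occupation Y y t (i * δ) ω ≤
      ENNReal.ofReal t * S.indicator 1 ω +
        ∑' j : ℕ, (gridHit Y δ z' j).indicator (occupation Y y t (j * δ)) ω := by
    filter_upwards [ae_restrict_of_ae habs, ae_restrict_of_ae hext] with ω ha hex
    obtain ⟨s, hs, hs0⟩ := hex
    obtain ⟨j, hj, -⟩ := exists_gridHit hδ hz' hs ha hs0
    refine (hY.occupation_le_of_gridHit (i := i) ha hδ hy ht ht' hz' hj).trans (add_le_add ?_ ?_)
    · refine mul_le_mul_right ?_ _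
      by_cases hE : ω ∈ gridExceed Y δ y t' i j
      · have hS' : ω ∈ S := mem_iUnion.2 ⟨j, hj, hE⟩
        rw [indicator_of_mem hE, indicator_of_mem hS']
      · rw [indicator_of_notMem hE]; exact zero_le
    · refine le_trans ?_ (ENNReal.le_tsum j)
      rw [indicator_of_mem hj]
  refine (lintegral_mono_ae hpt).trans ?_
  rw [lintegral_add_left ((measurable_indicator_one_of hSm).const_mul _),
    lintegral_const_mul _ (measurable_indicator_one_of hSm), lintegral_indicator_one hSm,
    Measure.restrict_apply hSm, inter_comm S G, lintegral_tsum fun j =>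
      ((hY.measurable_occupation (by positivity) ht.le).indicator (hHm j)).aemeasurable]
  refine add_le_add le_rfl ?_
  calc _ ≤ ∑' j, ENNReal.ofReal (t * d) * P (gridHit Y δ z' j ∩ G) := by
        refine ENNReal.tsum_le_tsum fun j => ?_
        rw [setLIntegral_indicator (hHm j)]
        rcases lt_or_ge j i with hji | hij
        · have : gridHit Y δ z' j ∩ G = ∅ := by
            refine eq_empty_of_forall_notMem fun ω hω => ?_
            exact absurd (gridHit_le hzz (hGi hω.2) hω.1) (not_le.2 hji)
          simp [this]
        · refine hup _ (by positivity) _ ?_ fun ω hω => hω.1.1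
          refine (measurableSet_gridHit hδ.le z' j).inter (past_mono Y ?_ _ hG)
          gcongr
    _ ≤ _ := by
        rw [ENNReal.tsum_mul_left]
        refine mul_le_mul_right ?_ _
        rw [← measure_iUnion (fun a b hab => ((pairwise_disjoint_gridHit Y δ z') hab).mono
          inter_subset_left inter_subset_left) fun j => (hHm j).inter hGm]
        exact measure_mono (iUnion_subset fun j => inter_subset_right)

lemma measure_sdiff_add_le (hY : BranchingProcess φ φinv P Y)
    (habs : ∀ᵐ ω ∂P, ∀ s r : ℝ, 0 ≤ s → s ≤ r → Y s ω = 0 → Y r ω = 0)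
    (hext : ∀ᵐ ω ∂P, ∃ s : ℝ, 0 ≤ s ∧ Y s ω = 0)
    {δ y t t' z z' d π : ℝ} {i : ℕ} (hδ : 0 < δ) (hy : 0 ≤ y) (ht : 0 < t)
    (ht' : t + δ ≤ t') (hz' : 0 ≤ z') (hzz : z' ≤ z) (hπ1 : π ≤ 1)
    (hup : ∀ p : ℝ, 0 ≤ p → ∀ G : Set Ω, MeasurableSet[past Y p] G → (∀ ω ∈ G, Y p ω ≤ z') →
      ∫⁻ ω in G, occupation Y y t p ω ∂P ≤ ENNReal.ofReal (t * d) * P G)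
    (hlow : ∀ p : ℝ, 0 ≤ p → ∀ G : Set Ω, MeasurableSet[past Y p] G → (∀ ω ∈ G, z / 2 ≤ Y p ω) →
      ENNReal.ofReal (t * π) * P G ≤ ∫⁻ ω in G, occupation Y y t p ω ∂P)
    {G : Set Ω} (hG : MeasurableSet[past Y (i * δ)] G) (hGi : G ⊆ gridHit Y δ z i) :
    P (G \ ⋃ j, gridHit Y δ z' j ∩ gridExceed Y δ y t' i j) + ENNReal.ofReal π * P G ≤
      P G + ENNReal.ofReal d * P G + P (gridHit Y δ z i ∩ {ω | Y (i * δ) ω < z / 2}) := by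
  set S := ⋃ j, gridHit Y δ z' j ∩ gridExceed Y δ y t' i j with hS
  have hSm : MeasurableSet S := MeasurableSet.iUnion fun j =>
    (hY.past_le _ _ (measurableSet_gridHit hδ.le z' j)).inter
      (hY.past_le _ _ (measurableSet_gridExceed hδ.le y t' i j))
  have hi0 : (0 : ℝ) ≤ i * δ := by positivity
  set B : Set Ω := {ω | Y (i * δ) ω < z / 2} with hB
  have hBp : MeasurableSet[past Y (i * δ)] B :=
    measurableSet_past Y hi0 le_rfl measurableSet_Iio
  have hBm := hY.past_le _ _ hBp
  have hG1 : MeasurableSet[past Y (i * δ)] (G \ B) := hG.diff hBp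
  have hmain : ENNReal.ofReal π * P (G \ B) ≤ P ((G \ B) ∩ S) + ENNReal.ofReal d * P (G \ B) := by
    have h1 := (hlow _ hi0 _ hG1 fun ω hω => not_lt.1 hω.2).trans
      (hY.setLIntegral_occupation_le_of_gridHit habs hext hδ hy ht ht' hz' hzz hup hG1
        (sdiff_subset.trans hGi))
    rw [ENNReal.ofReal_mul ht.le, ENNReal.ofReal_mul ht.le, mul_assoc, mul_assoc, ← mul_add] at h1
    exact (ENNReal.mul_le_mul_iff_right (by simpa using ht) ENNReal.ofReal_ne_top).1 h1
  have hπ : ENNReal.ofReal π ≤ 1 := ENNReal.ofReal_le_one.2 hπ1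
  have hGS : P (G \ S) ≤ P ((G \ B) \ S) + P (G ∩ B) := by
    refine (measure_mono fun ω hω => ?_).trans (measure_union_le _ _)
    by_cases h : ω ∈ B
    · exact Or.inr ⟨hω.1, h⟩
    · exact Or.inl ⟨⟨hω.1, h⟩, hω.2⟩
  have hGB : P G = P (G ∩ B) + P (G \ B) := (measure_inter_add_sdiff G hBm).symm
  have hbad : P (G ∩ B) ≤ P (gridHit Y δ z i ∩ B) := measure_mono (inter_subset_inter_left _ hGi)
  calc P (G \ S) + ENNReal.ofReal π * P G
      ≤ P ((G \ B) \ S) + P (G ∩ B) + (P (G ∩ B) + (P ((G \ B) ∩ S) +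
          ENNReal.ofReal d * P (G \ B))) := by
        rw [hGB, mul_add]
        refine add_le_add hGS (add_le_add ?_ hmain)
        exact mul_le_of_le_one_left zero_le hπ
    _ = (P ((G \ B) ∩ S) + P ((G \ B) \ S)) + P (G ∩ B) + ENNReal.ofReal d * P (G \ B) +
          P (G ∩ B) := by ring
    _ = P G + ENNReal.ofReal d * P (G \ B) + P (G ∩ B) := by
        rw [measure_inter_add_sdiff _ hSm, add_comm (P (G \ B)), ← hGB]
    _ ≤ _ := by
        gcongr
        exact sdiff_subset

end BranchingProcess

/-- The grid enters `[0, z k]` at the index `i`, and the process does not exceed `y j` shortly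
before the grid enters `[0, z (j + 1)]`, for every `j < k`. -/
def quietHit {Ω : Type*} (Y : ℝ → Ω → ℝ) (δ : ℝ) (z y t : ℕ → ℝ) : ℕ → ℕ → Set Ω
  | 0, i => gridHit Y δ (z 0) i
  | k + 1, i => gridHit Y δ (z (k + 1)) i ∩
      ⋃ j ∈ Iic i, quietHit Y δ z y t k j \ gridExceed Y δ (y k) (t k) j i

section

variable {Ω : Type*} {Y : ℝ → Ω → ℝ} {δ : ℝ} {z y t : ℕ → ℝ}

lemma quietHit_subset (k i : ℕ) : quietHit Y δ z y t k i ⊆ gridHit Y δ (z k) i := by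
  cases k with
  | zero => exact subset_rfl
  | succ k => exact inter_subset_left

lemma measurableSet_quietHit (hδ : 0 ≤ δ) (k i : ℕ) :
    MeasurableSet[past Y (i * δ)] (quietHit Y δ z y t k i) := by
  induction k generalizing i with
  | zero => exact measurableSet_gridHit hδ _ _
  | succ k ih =>
    refine (measurableSet_gridHit hδ _ _).inter
      (MeasurableSet.biUnion (to_countable _) fun j hj => ?_)
    refine MeasurableSet.diff (past_mono Y ?_ _ (ih j)) (measurableSet_gridExceed hδ _ _ _ _)
    have : (j : ℝ) ≤ i := Nat.cast_le.2 hj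
    gcongr

lemma pairwise_disjoint_quietHit (k : ℕ) :
    Pairwise (Function.onFun Disjoint (quietHit Y δ z y t k)) := fun i j hij =>
  (pairwise_disjoint_gridHit Y δ (z k) hij).mono (quietHit_subset k i) (quietHit_subset k j)

lemma iUnion_quietHit_succ_subset (k : ℕ) :
    ⋃ i, quietHit Y δ z y t (k + 1) i ⊆ ⋃ i, quietHit Y δ z y t k i \
      ⋃ j, gridHit Y δ (z (k + 1)) j ∩ gridExceed Y δ (y k) (t k) i j := by
  refine iUnion_subset fun i ω hω => ?_
  obtain ⟨j, -, hj, hE⟩ := mem_iUnion₂.1 hω.2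
  refine mem_iUnion.2 ⟨j, hj, fun hS => ?_⟩
  obtain ⟨l, hl, hlE⟩ := mem_iUnion.1 hS
  rw [gridHit_unique hl hω.1] at hlE
  exact hE hlE

end

namespace BranchingProcess

variable {Ω : Type*} [mΩ : MeasurableSpace Ω] {ψ φ φinv : ℝ → ℝ} {P : Measure Ω}
  {Y : ℝ → Ω → ℝ} [IsProbabilityMeasure P]

lemma measure_quietHit_succ_add_le (hY : BranchingProcess φ φinv P Y)
    (habs : ∀ᵐ ω ∂P, ∀ s r : ℝ, 0 ≤ s → s ≤ r → Y s ω = 0 → Y r ω = 0)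
    (hext : ∀ᵐ ω ∂P, ∃ s : ℝ, 0 ≤ s ∧ Y s ω = 0)
    {δ : ℝ} {y t t' z d π : ℕ → ℝ} {b : ℕ → ℝ≥0∞} (hδ : 0 < δ) {k : ℕ}
    (hy : 0 ≤ y k) (ht : 0 < t k) (ht' : t k + δ ≤ t' k) (hz0 : 0 ≤ z (k + 1))
    (hz : z (k + 1) ≤ z k) (hπ : π k ≤ 1)
    (hup : ∀ p : ℝ, 0 ≤ p → ∀ G : Set Ω, MeasurableSet[past Y p] G →
      (∀ ω ∈ G, Y p ω ≤ z (k + 1)) →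
      ∫⁻ ω in G, occupation Y (y k) (t k) p ω ∂P ≤ ENNReal.ofReal (t k * d k) * P G)
    (hlow : ∀ p : ℝ, 0 ≤ p → ∀ G : Set Ω, MeasurableSet[past Y p] G →
      (∀ ω ∈ G, z k / 2 ≤ Y p ω) →
      ENNReal.ofReal (t k * π k) * P G ≤ ∫⁻ ω in G, occupation Y (y k) (t k) p ω ∂P)
    (hb : ∑' i : ℕ, P (gridHit Y δ (z k) i ∩ {ω | Y (i * δ) ω < z k / 2}) ≤ b k) :
    P (⋃ i, quietHit Y δ z y t' (k + 1) i) +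
        ENNReal.ofReal (π k) * P (⋃ i, quietHit Y δ z y t' k i) ≤
      P (⋃ i, quietHit Y δ z y t' k i) + (ENNReal.ofReal (d k) + b k) := by
  have hsum : P (⋃ i, quietHit Y δ z y t' k i) = ∑' i, P (quietHit Y δ z y t' k i) :=
    measure_iUnion (pairwise_disjoint_quietHit k) fun i =>
      hY.past_le _ _ (measurableSet_quietHit hδ.le k i)
  calc _ ≤ ∑' i, P (quietHit Y δ z y t' k i \
          ⋃ j, gridHit Y δ (z (k + 1)) j ∩ gridExceed Y δ (y k) (t' k) i j) +
        ENNReal.ofReal (π k) * ∑' i, P (quietHit Y δ z y t' k i) := by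
        rw [hsum]
        exact add_le_add ((measure_mono (iUnion_quietHit_succ_subset k)).trans
          (measure_iUnion_le _)) le_rfl
    _ ≤ ∑' i, (P (quietHit Y δ z y t' k i) + ENNReal.ofReal (d k) * P (quietHit Y δ z y t' k i) +
          P (gridHit Y δ (z k) i ∩ {ω | Y (i * δ) ω < z k / 2})) := by
        rw [← ENNReal.tsum_mul_left, ← ENNReal.tsum_add]
        exact ENNReal.tsum_le_tsum fun i => hY.measure_sdiff_add_le habs hext hδ hy ht ht' hz0 hz
          hπ hup hlow (measurableSet_quietHit hδ.le k i) (quietHit_subset k i)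
    _ ≤ _ := by
        rw [ENNReal.tsum_add, ENNReal.tsum_add, ENNReal.tsum_mul_left, ← hsum, add_assoc]
        refine add_le_add le_rfl (add_le_add ?_ hb)
        exact mul_le_of_le_one_right zero_le prob_le_one

lemma measure_quietHit_mul_sum_le (hY : BranchingProcess φ φinv P Y)
    (habs : ∀ᵐ ω ∂P, ∀ s r : ℝ, 0 ≤ s → s ≤ r → Y s ω = 0 → Y r ω = 0)
    (hext : ∀ᵐ ω ∂P, ∃ s : ℝ, 0 ≤ s ∧ Y s ω = 0)
    {δ : ℝ} {y t t' z d π : ℕ → ℝ} {b : ℕ → ℝ≥0∞} (hδ : 0 < δ) {N : ℕ}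
    (hy : ∀ k, 0 ≤ y k) (ht : ∀ k, 0 < t k) (ht' : ∀ k < N, t k + δ ≤ t' k) (hz0 : ∀ k, 0 ≤ z k)
    (hz : Antitone z) (hπ : ∀ k, π k ≤ 1)
    (hup : ∀ k, ∀ p : ℝ, 0 ≤ p → ∀ G : Set Ω, MeasurableSet[past Y p] G →
      (∀ ω ∈ G, Y p ω ≤ z (k + 1)) →
      ∫⁻ ω in G, occupation Y (y k) (t k) p ω ∂P ≤ ENNReal.ofReal (t k * d k) * P G)
    (hlow : ∀ k, ∀ p : ℝ, 0 ≤ p → ∀ G : Set Ω, MeasurableSet[past Y p] G →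
      (∀ ω ∈ G, z k / 2 ≤ Y p ω) →
      ENNReal.ofReal (t k * π k) * P G ≤ ∫⁻ ω in G, occupation Y (y k) (t k) p ω ∂P)
    (hb : ∀ k < N, ∑' i : ℕ, P (gridHit Y δ (z k) i ∩ {ω | Y (i * δ) ω < z k / 2}) ≤ b k) :
    P (⋃ i, quietHit Y δ z y t' N i) * ∑ k ∈ Finset.range N, ENNReal.ofReal (π k) ≤
      1 + ∑ k ∈ Finset.range N, (ENNReal.ofReal (d k) + b k) := by
  set A : ℕ → ℝ≥0∞ := fun k => P (⋃ i, quietHit Y δ z y t' k i) with hA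
  have hanti : Antitone A := antitone_nat_of_succ_le fun k =>
    measure_mono ((iUnion_quietHit_succ_subset k).trans (iUnion_mono fun i => sdiff_subset))
  have hstep : ∀ n ≤ N, A n + ∑ k ∈ Finset.range n, ENNReal.ofReal (π k) * A k ≤
      1 + ∑ k ∈ Finset.range n, (ENNReal.ofReal (d k) + b k) := by
    intro n
    induction n with
    | zero => intro _; simpa using prob_le_one
    | succ n ih =>
      intro hn
      rw [Finset.sum_range_succ, Finset.sum_range_succ]
      have h1 := hY.measure_quietHit_succ_add_le habs hext hδ (hy n) (ht n) (ht' n hn)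
        (hz0 (n + 1)) (hz n.le_succ) (hπ n) (hup n) (hlow n) (hb n hn)
      have h2 := ih (Nat.le_of_succ_le hn)
      calc A (n + 1) + (∑ k ∈ Finset.range n, ENNReal.ofReal (π k) * A k +
              ENNReal.ofReal (π n) * A n)
          = (A (n + 1) + ENNReal.ofReal (π n) * A n) +
              ∑ k ∈ Finset.range n, ENNReal.ofReal (π k) * A k := by ring
        _ ≤ (A n + (ENNReal.ofReal (d n) + b n)) +
              ∑ k ∈ Finset.range n, ENNReal.ofReal (π k) * A k := add_le_add h1 le_rfl
        _ = (A n + ∑ k ∈ Finset.range n, ENNReal.ofReal (π k) * A k) +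
              (ENNReal.ofReal (d n) + b n) := by ring
        _ ≤ _ := (add_le_add h2 le_rfl).trans (add_assoc _ _ _).le
  refine le_trans ?_ (le_add_self.trans (hstep N le_rfl))
  rw [mul_comm, Finset.sum_mul]
  exact Finset.sum_le_sum fun k hk =>
    mul_le_mul_right (hanti (Finset.mem_range.1 hk).le) _

lemma measure_gridHit_survive_le (hY : BranchingProcess φ φinv P Y) (h : GreyExponent ψ φ φinv)
    {δ z s : ℝ} (hδ : 0 < δ) (hs : 0 < s) :
    P (⋃ i : ℕ, gridHit Y δ z i ∩ {ω | Y (i * δ + s) ω ≠ 0}) ≤ ENNReal.ofReal (z * φinv s) := by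
  calc _ ≤ ∑' i : ℕ, P (gridHit Y δ z i ∩ {ω | Y (i * δ + s) ω ≠ 0}) := measure_iUnion_le _
    _ ≤ ∑' i : ℕ, ENNReal.ofReal (z * φinv s) * P (gridHit Y δ z i) :=
        ENNReal.tsum_le_tsum fun i => hY.measure_survive_le h hs (by positivity)
          (measurableSet_gridHit hδ.le z i) fun ω hω => hω.1
    _ ≤ ENNReal.ofReal (z * φinv s) := by
        rw [ENNReal.tsum_mul_left, ← measure_iUnion (pairwise_disjoint_gridHit Y δ z) fun i =>
          hY.past_le _ _ (measurableSet_gridHit hδ.le z i)]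
        exact mul_le_of_le_one_right zero_le prob_le_one

lemma measure_iInter_compl_le (hY : BranchingProcess φ φinv P Y) (h : GreyExponent ψ φ φinv)
    (habs : ∀ᵐ ω ∂P, ∀ s r : ℝ, 0 ≤ s → s ≤ r → Y s ω = 0 → Y r ω = 0)
    (hext : ∀ᵐ ω ∂P, ∃ s : ℝ, 0 ≤ s ∧ Y s ω = 0)
    {δ : ℝ} {y t s z : ℕ → ℝ} (hδ : 0 < δ) {N : ℕ} (hz0 : ∀ k, 0 ≤ z k)
    (hz : Antitone z) (hs : ∀ k, 0 < s k) :
    P {ω | ∀ k < N, ¬ ∃ r u : ℝ, 0 ≤ r ∧ r ≤ u ∧ Y r ω ≤ z k ∧ y k < Y u ω ∧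
        Y (u + (t k + s k)) ω = 0} ≤
      P (⋃ i, quietHit Y δ z y t N i) +
        ∑ k ∈ Finset.range N, ENNReal.ofReal (z (k + 1) * φinv (s k)) := by
  set V : ℕ → Set Ω := fun k =>
    ⋃ i : ℕ, gridHit Y δ (z (k + 1)) i ∩ {ω | Y (i * δ + s k) ω ≠ 0} with hV
  have hsub : {ω | ∀ k < N, ¬ ∃ r u : ℝ, 0 ≤ r ∧ r ≤ u ∧ Y r ω ≤ z k ∧ y k < Y u ω ∧
      Y (u + (t k + s k)) ω = 0} ≤ᵐ[P]
      ((⋃ i, quietHit Y δ z y t N i) ∪ ⋃ k ∈ Finset.range N, V k : Set Ω) := by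
    filter_upwards [habs, hext] with ω ha hex hω
    obtain ⟨s0, hs0, hY0⟩ := hex
    by_cases hVω : ω ∈ ⋃ k ∈ Finset.range N, V k
    · exact Or.inr hVω
    refine Or.inl (mem_iUnion.2 ?_)
    have hstep : ∀ n ≤ N, ∃ i, ω ∈ quietHit Y δ z y t n i := by
      intro n
      induction n with
      | zero =>
        intro _
        obtain ⟨i, hi, -⟩ := exists_gridHit hδ (hz0 0) hs0 ha hY0
        exact ⟨i, hi⟩
      | succ n ih =>
        intro hn
        obtain ⟨i, hi⟩ := ih (Nat.le_of_succ_le hn)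
        obtain ⟨j, hj, -⟩ := exists_gridHit hδ (hz0 (n + 1)) hs0 ha hY0
        have hiz := quietHit_subset n i hi
        have hij := gridHit_le (hz n.le_succ) hiz hj
        refine ⟨j, hj, mem_iUnion₂.2 ⟨i, hij, hi, fun hE => hω n hn ?_⟩⟩
        obtain ⟨u, hu1, hu2, hu3, hu4⟩ := hE
        refine ⟨i * δ, u, by positivity, hu1, hiz.1, hu4, ?_⟩
        have hj0 : Y (j * δ + s n) ω = 0 := by
          by_contra hne
          exact hVω (mem_iUnion₂.2 ⟨n, Finset.mem_range.2 hn, mem_iUnion.2 ⟨j, hj, hne⟩⟩)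
        exact ha _ _ (add_nonneg (by positivity) (hs n).le) (by linarith) hj0
    exact hstep N le_rfl
  refine (measure_mono_ae hsub).trans ((measure_union_le _ _).trans (add_le_add le_rfl ?_))
  exact (measure_biUnion_finset_le _ _).trans
    (Finset.sum_le_sum fun k _ => hY.measure_gridHit_survive_le h hδ (hs k))

end BranchingProcess

namespace BranchingProcess

variable {Ω : Type*} [mΩ : MeasurableSpace Ω] {ψ φ φinv : ℝ → ℝ} {P : Measure Ω}
  {Y : ℝ → Ω → ℝ} [IsProbabilityMeasure P]

lemma measure_halve_le (hY : BranchingProcess φ φinv P Y) (h : GreyExponent ψ φ φinv)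
    {p δ z l : ℝ} (hp : 0 ≤ p) (hδ : 0 ≤ δ) (hl : 0 < l)
    (hδl : δ * ψ l ≤ l / 4) :
    P ({ω | z < Y p ω} ∩ {ω | Y (p + δ) ω < z / 2}) ≤ ENNReal.ofReal (Real.exp (-(l * z / 4))) := by
  rcases le_or_gt z 0 with hz | hz
  · refine prob_le_one.trans ?_
    rw [ENNReal.one_le_ofReal, Real.one_le_exp_iff]
    nlinarith
  have hGp : MeasurableSet[past Y p] {ω | z < Y p ω} :=
    BranchingProcess.measurableSet_past Y hp le_rfl measurableSet_Ioi
  set G := {ω | z < Y p ω}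
  have hGm := hY.past_le _ _ hGp
  have hBm : MeasurableSet {ω | Y (p + δ) ω < z / 2} := hY.meas (p + δ) measurableSet_Iio
  set B := {ω | Y (p + δ) ω < z / 2}
  have h1 := hY.lintegral_mul_exp h hδ hp hl (measurable_indicator_one_of hGp)
  have h2 : ENNReal.ofReal (Real.exp (-(l * z / 2))) * P (G ∩ B) ≤
      ∫⁻ ω, G.indicator 1 ω * ENNReal.ofReal (Real.exp (-l * Y (p + δ) ω)) ∂P := by
    rw [← lintegral_indicator_one (hGm.inter hBm),
      ← lintegral_const_mul _ (measurable_indicator_one_of (hGm.inter hBm))]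
    refine lintegral_mono fun ω => ?_
    by_cases hω : ω ∈ G ∩ B
    · rw [indicator_of_mem hω, indicator_of_mem hω.1]
      simp only [Pi.one_apply, mul_one, one_mul]
      refine ENNReal.ofReal_le_ofReal (Real.exp_le_exp.2 ?_)
      have : Y (p + δ) ω < z / 2 := hω.2
      nlinarith
    · rw [indicator_of_notMem hω]; simp
  have h3 : ∫⁻ ω, G.indicator 1 ω * ENNReal.ofReal (Real.exp (-(Y p ω) * φinv (δ + φ l))) ∂P ≤
      ENNReal.ofReal (Real.exp (-(3 * l * z / 4))) := by
    calc _ ≤ ∫⁻ _, ENNReal.ofReal (Real.exp (-(3 * l * z / 4))) ∂P := by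
          refine lintegral_mono fun ω => ?_
          by_cases hω : ω ∈ G
          · rw [indicator_of_mem hω]
            simp only [Pi.one_apply, one_mul]
            refine ENNReal.ofReal_le_ofReal (Real.exp_le_exp.2 ?_)
            have h4 : z < Y p ω := hω
            have h5 := h.sub_le_cumulant hδ hl
            have h6 : 3 * l / 4 ≤ φinv (δ + φ l) := by linarith
            nlinarith
          · rw [indicator_of_notMem hω]; simp
      _ = _ := by simp
  have h4 := h2.trans (h1.le.trans h3)
  have h5 : ENNReal.ofReal (Real.exp (-(3 * l * z / 4))) =
      ENNReal.ofReal (Real.exp (-(l * z / 2))) * ENNReal.ofReal (Real.exp (-(l * z / 4))) := by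
    rw [← ENNReal.ofReal_mul (Real.exp_pos _).le, ← Real.exp_add]
    ring_nf
  rw [h5] at h4
  exact (ENNReal.mul_le_mul_iff_right (by simpa using Real.exp_pos _) ENNReal.ofReal_ne_top).1 h4

lemma tsum_gridHit_lt_le (hY : BranchingProcess φ φinv P Y) (h : GreyExponent ψ φ φinv)
    {x z l : ℝ} (hY0 : ∀ᵐ ω ∂P, Y 0 ω = x) (hz : 0 < z) (hzx : z < x) (hl : 0 < l) {m M : ℕ}
    (hm : 0 < m) (hml : (1 / (m : ℝ)) * ψ l ≤ l / 4) :
    ∑' i : ℕ, P (gridHit Y (1 / m) z i ∩ {ω | Y (i * (1 / m)) ω < z / 2}) ≤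
      ENNReal.ofReal ((M * m + 1) * Real.exp (-(l * z / 4))) + P {ω | Y M ω ≠ 0} := by
  set e := ENNReal.ofReal (Real.exp (-(l * z / 4))) with he
  have hm' : (0 : ℝ) < m := Nat.cast_pos.2 hm
  have hδ : 0 < 1 / (m : ℝ) := by positivity
  have hVm : MeasurableSet {ω | Y M ω ≠ 0} := hY.meas M (measurableSet_singleton 0).compl
  have hterm : ∀ i : ℕ, P (gridHit Y (1 / m) z i ∩ {ω | Y (i * (1 / m)) ω < z / 2}) ≤
      (if i ∈ Finset.range (M * m + 1) then e else 0) +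
        P (gridHit Y (1 / m) z i ∩ {ω | Y M ω ≠ 0}) := by
    intro i
    split_ifs with hi
    · refine le_add_right ?_
      cases i with
      | zero =>
        have : P {ω | ¬ Y 0 ω = x} = 0 := ae_iff.1 hY0
        refine le_trans (measure_mono fun ω hω => ?_) (this.le.trans zero_le)
        intro h0
        have h1 := hω.1.1
        rw [Nat.cast_zero, zero_mul, h0] at h1
        exact absurd hzx (not_lt.2 h1)
      | succ j =>
        refine (measure_mono fun ω hω => ?_).trans
          (hY.measure_halve_le h (p := j * (1 / m)) (by positivity) hδ.le hl hml)
        refine ⟨hω.1.2 j j.lt_succ_self, ?_⟩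
        have h1 : Y (((j + 1 : ℕ) : ℝ) * (1 / m)) ω < z / 2 := hω.2
        rwa [Nat.cast_add, Nat.cast_one, add_mul, one_mul] at h1
    · rw [zero_add]
      refine measure_mono fun ω hω => ⟨hω.1, ?_⟩
      have h1 := hω.1.2 (M * m) (by simpa using hi)
      rw [Nat.cast_mul, mul_assoc, mul_one_div_cancel hm'.ne', mul_one] at h1
      exact (hz.trans h1).ne'
  refine (ENNReal.tsum_le_tsum hterm).trans ?_
  rw [ENNReal.tsum_add]
  refine add_le_add ?_ ?_
  · rw [tsum_eq_sum (s := Finset.range (M * m + 1)) fun i hi => if_neg hi, Finset.sum_ite_mem,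
      Finset.inter_self, Finset.sum_const, Finset.card_range, nsmul_eq_mul, he,
      ENNReal.ofReal_mul (by positivity)]
    refine mul_le_mul_left (le_of_eq ?_) _
    rw [← ENNReal.ofReal_natCast]
    push_cast
    rfl
  · rw [← measure_iUnion (fun a b hab => ((pairwise_disjoint_gridHit Y _ z) hab).mono
      inter_subset_left inter_subset_left) fun i =>
        (hY.past_le _ _ (measurableSet_gridHit hδ.le z i)).inter hVm]
    exact measure_mono (iUnion_subset fun i => inter_subset_right)

lemma tendsto_tsum_gridHit_lt (hY : BranchingProcess φ φinv P Y) (h : RegularExponent ψ φ φinv)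
    {x z : ℝ} (hY0 : ∀ᵐ ω ∂P, Y 0 ω = x) (hz : 0 < z) (hzx : z < x) :
    Tendsto (fun m : ℕ => ∑' i : ℕ, P (gridHit Y (1 / m) z i ∩
      {ω | Y (i * (1 / m)) ω < z / 2})) atTop (𝓝 0) := by
  obtain ⟨C, hC, hquad⟩ := h.quadratic
  refine ENNReal.tendsto_nhds_zero.2 fun ε hε => ?_
  have hε2 : 0 < ε / 2 := ENNReal.half_pos hε.ne'
  obtain ⟨n, hn⟩ := (ENNReal.tendsto_nhds_zero.1
    (hY.tendsto_measure_survive h.toGreyExponent hY0) _ hε2).exists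
  have hlim : Tendsto (fun m : ℕ => ENNReal.ofReal ((((n + 1 : ℕ) : ℝ) * m + 1) *
      Real.exp (-((m : ℝ) / (4 * C) * z / 4)))) atTop (𝓝 0) := by
    have hc : 0 < z / (16 * C) := by positivity
    have h1 : Tendsto (fun r : ℝ => r * Real.exp (-r)) atTop (𝓝 0) := by
      simpa using Real.tendsto_pow_mul_exp_neg_atTop_nhds_zero 1
    have hr : Tendsto (fun m : ℕ => z / (16 * C) * (m : ℝ)) atTop atTop :=
      tendsto_natCast_atTop_atTop.const_mul_atTop hc
    have h2 := ((h1.comp hr).const_mul (((n + 1 : ℕ) : ℝ) * (16 * C / z))).add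
      ((Real.tendsto_exp_neg_atTop_nhds_zero).comp hr)
    rw [mul_zero, add_zero] at h2
    have h3 := ENNReal.tendsto_ofReal h2
    rw [ENNReal.ofReal_zero] at h3
    refine h3.congr fun m => ?_
    congr 1
    simp only [Function.comp]
    have e1 : (m : ℝ) / (4 * C) * z / 4 = z / (16 * C) * m := by field_simp; norm_num
    rw [e1]
    field_simp
  filter_upwards [ENNReal.tendsto_nhds_zero.1 hlim _ hε2, eventually_gt_atTop 0,
    tendsto_natCast_atTop_atTop.eventually_ge_atTop (4 * C)] with m h1 hm hmC
  have hm' : (0 : ℝ) < m := Nat.cast_pos.2 hm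
  have hl1 : 1 ≤ (m : ℝ) / (4 * C) := by rwa [le_div_iff₀ (by positivity), one_mul]
  refine (hY.tsum_gridHit_lt_le h.toGreyExponent hY0 hz hzx (l := (m : ℝ) / (4 * C))
    (M := n + 1) (by positivity) hm ?_).trans ?_
  · calc 1 / (m : ℝ) * ψ (m / (4 * C)) ≤ 1 / (m : ℝ) * (C * (m / (4 * C)) ^ 2) := by
          gcongr; exact hquad _ hl1
      _ = m / (4 * C) / 4 := by field_simp
  · rw [← ENNReal.add_halves ε]
    refine add_le_add h1 ?_
    simpa using hn

end BranchingProcess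

namespace BranchingProcess

variable {Ω : Type*} [mΩ : MeasurableSpace Ω] {ψ φ φinv : ℝ → ℝ} {P : Measure Ω}
  {Y : ℝ → Ω → ℝ} [IsProbabilityMeasure P]

lemma measure_forall_not_exceed_le (hY : BranchingProcess φ φinv P Y)
    (h : RegularExponent ψ φ φinv) {x : ℝ} (hY0 : ∀ᵐ ω ∂P, Y 0 ω = x)
    {y t s z d π : ℕ → ℝ} (hy : ∀ k, 0 ≤ y k) (ht : ∀ k, 0 < t k) (hs : ∀ k, 0 < s k)
    (hz0 : ∀ k, 0 < z k) (hz : Antitone z) (hzx : z 0 < x)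
    (hπ0 : ∀ k, 0 ≤ π k) (hπ1 : ∀ k, π k ≤ 1) (hπs : ¬ Summable π) (hd0 : ∀ k, 0 ≤ d k)
    (hds : Summable d)
    (hup : ∀ k, ∀ p : ℝ, 0 ≤ p → ∀ G : Set Ω, MeasurableSet[past Y p] G →
      (∀ ω ∈ G, Y p ω ≤ z (k + 1)) →
      ∫⁻ ω in G, occupation Y (y k) (t k) p ω ∂P ≤ ENNReal.ofReal (t k * d k) * P G)
    (hlow : ∀ k, ∀ p : ℝ, 0 ≤ p → ∀ G : Set Ω, MeasurableSet[past Y p] G →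
      (∀ ω ∈ G, z k / 2 ≤ Y p ω) →
      ENNReal.ofReal (t k * π k) * P G ≤ ∫⁻ ω in G, occupation Y (y k) (t k) p ω ∂P) :
    P {ω | ∀ k, ¬ ∃ r u : ℝ, 0 ≤ r ∧ r ≤ u ∧ Y r ω ≤ z k ∧ y k < Y u ω ∧
        Y (u + (t k + s k + s k)) ω = 0} ≤
      ∑' k, ENNReal.ofReal (z (k + 1) * φinv (s k)) := by
  have habs := hY.ae_absorbed h.toGreyExponent
  have hext := hY.ae_exists_extinct h.toGreyExponent hY0
  set D : ℝ := ∑' k, d k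
  have hD0 : 0 ≤ D := tsum_nonneg hd0
  have hbound : ∀ N : ℕ, 0 < ∑ k ∈ Finset.range N, π k →
      P {ω | ∀ k, ¬ ∃ r u : ℝ, 0 ≤ r ∧ r ≤ u ∧ Y r ω ≤ z k ∧ y k < Y u ω ∧
        Y (u + (t k + s k + s k)) ω = 0} ≤
      ENNReal.ofReal ((2 + D) / ∑ k ∈ Finset.range N, π k) +
        ∑' k, ENNReal.ofReal (z (k + 1) * φinv (s k)) := by
    intro N hN
    have hbad : Tendsto (fun m : ℕ => ∑ k ∈ Finset.range N, ∑' i : ℕ,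
        P (gridHit Y (1 / m) (z k) i ∩ {ω | Y (i * (1 / m)) ω < z k / 2})) atTop (𝓝 0) := by
      have := tendsto_finsetSum (Finset.range N) fun k _ =>
        hY.tendsto_tsum_gridHit_lt h hY0 (hz0 k) ((hz k.zero_le).trans_lt hzx)
      simpa only [Finset.sum_const_zero] using this
    have hmesh : ∀ᶠ m : ℕ in atTop, ∀ k ∈ Finset.range N, 1 / (m : ℝ) ≤ s k :=
      (Finset.eventually_all _).2 fun k _ =>
        (tendsto_one_div_atTop_nhds_zero_nat (𝕜 := ℝ)).eventually_le_const (hs k)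
    obtain ⟨m, hm1, hm2, hm0⟩ := ((ENNReal.tendsto_nhds_zero.1 hbad 1 one_pos).and
      (hmesh.and (eventually_gt_atTop 0))).exists
    have hδ : 0 < 1 / (m : ℝ) := by
      have : (0 : ℝ) < m := Nat.cast_pos.2 hm0
      positivity
    have hA := hY.measure_quietHit_mul_sum_le habs hext (δ := 1 / m) (t := t)
      (t' := fun k => t k + s k) (d := d) (π := π) (y := y) (z := z)
      (b := fun k => ∑' i : ℕ,
        P (gridHit Y (1 / m) (z k) i ∩ {ω | Y (i * (1 / m)) ω < z k / 2}))
      (N := N) hδ hy ht (fun k hk => by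
        have := hm2 k (Finset.mem_range.2 hk)
        linarith) (fun k => (hz0 k).le) hz hπ1 hup hlow fun k _ => le_rfl
    rw [Finset.sum_add_distrib, ← ENNReal.ofReal_sum_of_nonneg fun k _ => hπ0 k,
      ← ENNReal.ofReal_sum_of_nonneg fun k _ => hd0 k] at hA
    have hA2 : P (⋃ i, quietHit Y (1 / m) z y (fun k => t k + s k) N i) *
        ENNReal.ofReal (∑ k ∈ Finset.range N, π k) ≤ ENNReal.ofReal (2 + D) := by
      refine hA.trans ?_
      calc _ ≤ 1 + (ENNReal.ofReal D + 1) := by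
            refine add_le_add le_rfl (add_le_add (ENNReal.ofReal_le_ofReal ?_) hm1)
            exact hds.sum_le_tsum _ fun k _ => hd0 k
        _ = ENNReal.ofReal (2 + D) := by
            rw [ENNReal.ofReal_add (by norm_num) hD0, ENNReal.ofReal_ofNat, add_comm _ (1 : ℝ≥0∞),
              ← add_assoc, one_add_one_eq_two]
    have hA3 : P (⋃ i, quietHit Y (1 / m) z y (fun k => t k + s k) N i) ≤
        ENNReal.ofReal ((2 + D) / ∑ k ∈ Finset.range N, π k) := by
      rw [ENNReal.ofReal_div_of_pos hN]
      exact (ENNReal.le_div_iff_mul_le (Or.inl (by simpa using hN))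
        (Or.inl ENNReal.ofReal_ne_top)).2 hA2
    have hE := hY.measure_iInter_compl_le h.toGreyExponent habs hext (δ := 1 / m)
      (t := fun k => t k + s k) (s := s) (y := y) (z := z) (N := N) hδ (fun k => (hz0 k).le) hz hs
    refine le_trans (measure_mono ?_) (hE.trans (add_le_add hA3 (ENNReal.sum_le_tsum _)))
    exact fun ω hω k _ => hω k
  have htend : Tendsto (fun N : ℕ => ENNReal.ofReal ((2 + D) / ∑ k ∈ Finset.range N, π k) +
      ∑' k, ENNReal.ofReal (z (k + 1) * φinv (s k))) atTop
      (𝓝 (0 + ∑' k, ENNReal.ofReal (z (k + 1) * φinv (s k)))) := by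
    refine Tendsto.add ?_ tendsto_const_nhds
    rw [← ENNReal.ofReal_zero]
    exact ENNReal.tendsto_ofReal
      (((not_summable_iff_tendsto_nat_atTop_of_nonneg hπ0).1 hπs).const_div_atTop _)
  rw [zero_add] at htend
  refine ge_of_tendsto htend ?_
  filter_upwards [((not_summable_iff_tendsto_nat_atTop_of_nonneg hπ0).1 hπs).eventually_gt_atTop 0]
    with N hN using hbound N hN

/-- A Borel–Cantelli criterion for the process to make infinitely many large excursions above
small values shortly before extinction. -/
lemma ae_frequently_exceed (hY : BranchingProcess φ φinv P Y)
    (h : RegularExponent ψ φ φinv) {x : ℝ} (hx : 0 < x) (hY0 : ∀ᵐ ω ∂P, Y 0 ω = x)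
    {y t s z d π : ℕ → ℝ} {K : ℕ} (hy : ∀ k, K ≤ k → 0 ≤ y k) (ht : ∀ k, K ≤ k → 0 < t k)
    (hs : ∀ k, K ≤ k → 0 < s k) (hz0 : ∀ k, K ≤ k → 0 < z k)
    (hz : ∀ k, K ≤ k → z (k + 1) ≤ z k) (hzlim : Tendsto z atTop (𝓝 0))
    (hπ0 : ∀ k, K ≤ k → 0 ≤ π k) (hπ1 : ∀ k, K ≤ k → π k ≤ 1) (hπs : ¬ Summable π)
    (hd0 : ∀ k, K ≤ k → 0 ≤ d k) (hds : Summable d)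
    (hcs : Summable fun k => z (k + 1) * φinv (s k))
    (hup : ∀ k, K ≤ k → ∀ p : ℝ, 0 ≤ p → ∀ G : Set Ω, MeasurableSet[past Y p] G →
      (∀ ω ∈ G, Y p ω ≤ z (k + 1)) →
      ∫⁻ ω in G, occupation Y (y k) (t k) p ω ∂P ≤ ENNReal.ofReal (t k * d k) * P G)
    (hlow : ∀ k, K ≤ k → ∀ p : ℝ, 0 ≤ p → ∀ G : Set Ω, MeasurableSet[past Y p] G →
      (∀ ω ∈ G, z k / 2 ≤ Y p ω) →
      ENNReal.ofReal (t k * π k) * P G ≤ ∫⁻ ω in G, occupation Y (y k) (t k) p ω ∂P) :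
    ∀ᵐ ω ∂P, ∃ᶠ k in atTop, ∃ r u : ℝ, 0 ≤ r ∧ r ≤ u ∧ Y r ω ≤ z k ∧ y k < Y u ω ∧
        Y (u + (t k + s k + s k)) ω = 0 := by
  obtain ⟨K', hK'⟩ := eventually_atTop.1 (hzlim.eventually_lt_const hx)
  have hbound : ∀ n, max K K' ≤ n → P {ω | ∀ k, n ≤ k → ¬ ∃ r u : ℝ, 0 ≤ r ∧ r ≤ u ∧
      Y r ω ≤ z k ∧ y k < Y u ω ∧ Y (u + (t k + s k + s k)) ω = 0} ≤
      ∑' k, ENNReal.ofReal (z (k + n + 1) * φinv (s (k + n))) := by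
    intro n hn
    have hKn : ∀ k, K ≤ k + n := fun k => ((le_max_left _ _).trans hn).trans (Nat.le_add_left _ _)
    have h1 := hY.measure_forall_not_exceed_le h hY0 (y := fun k => y (k + n))
      (t := fun k => t (k + n)) (s := fun k => s (k + n)) (z := fun k => z (k + n))
      (d := fun k => d (k + n)) (π := fun k => π (k + n)) (fun k => hy _ (hKn k))
      (fun k => ht _ (hKn k)) (fun k => hs _ (hKn k)) (fun k => hz0 _ (hKn k))
      (antitone_nat_of_succ_le fun k => by
        have := hz _ (hKn k)
        rwa [add_right_comm] at this) (hK' _ (by rw [zero_add]; exact (le_max_right _ _).trans hn))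
      (fun k => hπ0 _ (hKn k)) (fun k => hπ1 _ (hKn k))
      (fun hsum => hπs ((summable_nat_add_iff n).1 hsum)) (fun k => hd0 _ (hKn k))
      ((summable_nat_add_iff n).2 hds)
      (fun k p hp G hG hGz => hup _ (hKn k) p hp G hG (by simpa [add_right_comm] using hGz))
      (fun k => hlow _ (hKn k))
    refine le_trans (measure_mono ?_) (h1.trans (le_of_eq ?_))
    · exact fun ω hω k => hω _ (Nat.le_add_left _ _)
    · simp only [add_right_comm]
  have htail : Tendsto (fun n => ∑' k, ENNReal.ofReal (z (k + n + 1) * φinv (s (k + n)))) atTop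
      (𝓝 0) := by
    exact ENNReal.tendsto_sum_nat_add
      (fun k => ENNReal.ofReal (z (k + 1) * φinv (s k))) hcs.tsum_ofReal_ne_top
  have hnull : ∀ n, P {ω | ∀ k, n ≤ k → ¬ ∃ r u : ℝ, 0 ≤ r ∧ r ≤ u ∧
      Y r ω ≤ z k ∧ y k < Y u ω ∧ Y (u + (t k + s k + s k)) ω = 0} = 0 := by
    intro n
    refine le_antisymm (ge_of_tendsto htail ?_) zero_le
    filter_upwards [eventually_ge_atTop n, eventually_ge_atTop (max K K')] with n' h1 h2
    refine le_trans (measure_mono ?_) (hbound n' h2)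
    exact fun ω hω k hk => hω k (h1.trans hk)
  have := ae_all_iff.2 fun n => compl_mem_ae_iff.2 (hnull n)
  filter_upwards [this] with ω hω
  refine frequently_atTop.2 fun n => ?_
  have h1 := hω n
  by_contra! h2
  exact h1 fun k hk ⟨r, u, h3, h4, h5, h6, h7⟩ => h2 k hk r u h3 h4 h5 h6 h7

end BranchingProcess

lemma summable_log_mul_exp_rpow_sub {ρ : ℝ} (hρ : 1 < ρ) :
    Summable fun k : ℕ => ρ * Real.log ((k : ℝ) + 1) *
      Real.exp ((k : ℝ) ^ ρ - ((k : ℝ) + 1) ^ ρ) := by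
  have hρ0 : 0 < ρ := by linarith
  have hlog : ∀ᶠ x : ℝ in atTop, 3 * Real.log x ≤ ρ * x ^ (ρ - 1) := by
    filter_upwards [(isLittleO_log_rpow_atTop (show 0 < ρ - 1 by linarith)).bound
      (show 0 < ρ / 3 by positivity), eventually_ge_atTop 1] with x hx hx1
    rw [Real.norm_of_nonneg (Real.log_nonneg hx1), Real.norm_of_nonneg (by positivity)] at hx
    linarith
  refine Summable.of_norm_bounded_eventually_nat (g := fun k : ℕ => ρ * (1 / (k : ℝ) ^ 2))
    ((Real.summable_one_div_nat_pow.2 one_lt_two).mul_left ρ) ?_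
  filter_upwards [tendsto_natCast_atTop_atTop.eventually hlog, eventually_ge_atTop 1] with k hk hk1
  have hk1' : (1 : ℝ) ≤ k := by exact_mod_cast hk1
  have hk0 : (0 : ℝ) < k := by linarith
  have hl0 : 0 ≤ Real.log ((k : ℝ) + 1) := Real.log_nonneg (by linarith)
  have hl1 : Real.log ((k : ℝ) + 1) ≤ k := by
    have := Real.log_le_sub_one_of_pos (show 0 < (k : ℝ) + 1 by linarith)
    linarith
  have hb : (k : ℝ) ^ ρ + ρ * (k : ℝ) ^ (ρ - 1) ≤ ((k : ℝ) + 1) ^ ρ := by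
    have h1 := one_add_mul_self_le_rpow_one_add (s := 1 / (k : ℝ))
      (by have : 0 < 1 / (k : ℝ) := by positivity
          linarith) hρ.le
    calc (k : ℝ) ^ ρ + ρ * (k : ℝ) ^ (ρ - 1) = (k : ℝ) ^ ρ * (1 + ρ * (1 / k)) := by
          rw [Real.rpow_sub_one hk0.ne']; ring
      _ ≤ (k : ℝ) ^ ρ * (1 + 1 / (k : ℝ)) ^ ρ := by gcongr
      _ = ((k : ℝ) + 1) ^ ρ := by
          rw [← Real.mul_rpow hk0.le (by positivity)]
          congr 1
          field_simp
  have he : Real.exp ((k : ℝ) ^ ρ - ((k : ℝ) + 1) ^ ρ) ≤ 1 / (k : ℝ) ^ 3 := by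
    calc Real.exp ((k : ℝ) ^ ρ - ((k : ℝ) + 1) ^ ρ) ≤ Real.exp (-Real.log ((k : ℝ) ^ 3)) := by
          refine Real.exp_le_exp.2 ?_
          rw [Real.log_pow]
          push_cast
          linarith
      _ = 1 / (k : ℝ) ^ 3 := by rw [Real.exp_neg, Real.exp_log (by positivity), one_div]
  rw [Real.norm_of_nonneg (by positivity)]
  calc ρ * Real.log ((k : ℝ) + 1) * Real.exp ((k : ℝ) ^ ρ - ((k : ℝ) + 1) ^ ρ)
      ≤ ρ * k * (1 / (k : ℝ) ^ 3) := by gcongr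
    _ = ρ * (1 / (k : ℝ) ^ 2) := by field_simp

/-- A sequence growing fast enough for almost independence, and slowly enough for a divergent
series. -/
lemma exists_level_sequence {γ : ℝ} (hγ0 : 0 < γ) (hγ1 : γ < 1) :
    ∃ q : ℕ → ℝ, Tendsto q atTop atTop ∧
      (∀ A : ℝ, ∀ᶠ k : ℕ in atTop, A * (γ * Real.log (Real.log (q k))) ≤
        k * Real.exp (-(γ * Real.log (Real.log (q k))))) ∧
      Summable fun k => Real.log (Real.log (q (k + 1))) / q (k + 1) * q k := by
  set ρ : ℝ := (1 + 1 / γ) / 2 with hρ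
  have h1γ : 1 < 1 / γ := by rwa [lt_div_iff₀ hγ0, one_mul]
  have hρ1 : 1 < ρ := by rw [hρ]; linarith
  have hγρ : γ * ρ < 1 := by
    have : γ * ρ = (γ + 1) / 2 := by rw [hρ]; field_simp
    linarith
  have hρ0 : 0 < ρ := by linarith
  have hγρ0 : 0 < γ * ρ := by positivity
  have hL : ∀ k : ℕ, 0 < k → Real.log (Real.log (Real.exp ((k : ℝ) ^ ρ))) = ρ * Real.log k :=
    fun k hk => by rw [Real.log_exp, Real.log_rpow (Nat.cast_pos.2 hk)]
  refine ⟨fun k => Real.exp ((k : ℝ) ^ ρ),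
    Real.tendsto_exp_atTop.comp ((tendsto_rpow_atTop hρ0).comp tendsto_natCast_atTop_atTop),
    fun A => ?_, ?_⟩
  · have hlog : ∀ᶠ x : ℝ in atTop, A * (γ * ρ * Real.log x) ≤ x ^ (1 - γ * ρ) := by
      filter_upwards [(isLittleO_log_rpow_atTop (show 0 < 1 - γ * ρ by linarith)).bound
        (show 0 < 1 / ((|A| + 1) * (γ * ρ)) by positivity), eventually_ge_atTop 1] with x hx hx1
      have hl := Real.log_nonneg hx1
      rw [Real.norm_of_nonneg hl, Real.norm_of_nonneg (by positivity), div_mul_eq_mul_div,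
        le_div_iff₀ (by positivity), one_mul] at hx
      refine le_trans ?_ hx
      have := le_abs_self A
      calc A * (γ * ρ * Real.log x) ≤ (|A| + 1) * (γ * ρ * Real.log x) := by gcongr; linarith
        _ = Real.log x * ((|A| + 1) * (γ * ρ)) := by ring
    filter_upwards [tendsto_natCast_atTop_atTop.eventually hlog, eventually_gt_atTop 0] with k hk hk0
    have hk0' : (0 : ℝ) < k := Nat.cast_pos.2 hk0
    rw [hL k hk0, ← mul_assoc γ]
    refine hk.trans (le_of_eq ?_)
    rw [sub_eq_add_neg, Real.rpow_add hk0', Real.rpow_one, Real.rpow_def_of_pos hk0']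
    ring_nf
  · refine (summable_log_mul_exp_rpow_sub hρ1).congr fun k => ?_
    simp only
    rw [hL (k + 1) k.succ_pos, Real.exp_sub]
    push_cast
    ring

lemma tendsto_log_log_atTop : Tendsto (fun q : ℝ => Real.log (Real.log q)) atTop atTop :=
  Real.tendsto_log_atTop.comp Real.tendsto_log_atTop

lemma tendsto_log_log_div_atTop :
    Tendsto (fun q : ℝ => Real.log (Real.log q) / q) atTop (𝓝 0) := by
  refine squeeze_zero' ?_ ?_ Real.isLittleO_log_id_atTop.tendsto_div_nhds_zero
  · filter_upwards [tendsto_log_log_atTop.eventually_ge_atTop 0, eventually_ge_atTop 0]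
      with q h1 h2 using div_nonneg h1 h2
  · filter_upwards [Real.tendsto_log_atTop.eventually_ge_atTop 0, eventually_ge_atTop 0] with q h1 h2
    have := Real.log_le_self h1
    simp only [id]
    gcongr

namespace BranchingProcess

variable {Ω : Type*} [mΩ : MeasurableSpace Ω] {ψ φ φinv : ℝ → ℝ} {P : Measure Ω}
  {Y : ℝ → Ω → ℝ} [IsProbabilityMeasure P] {W : ℝ → ℝ}

lemma exists_ae_frequently_exceed (hY : BranchingProcess φ φinv P Y)
    (h : RegularExponent ψ φ φinv) {x : ℝ} (hx : 0 < x) (hY0 : ∀ᵐ ω ∂P, Y 0 ω = x)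
    (hWnonneg : ∀ y : ℝ, 0 ≤ y → 0 ≤ W y) (hWmono : MonotoneOn W (Ici 0))
    (hWlaplace : ∀ lam : ℝ, 0 < lam →
      ∫ y in Set.Ioi (0 : ℝ), Real.exp (-lam * y) * W y = (ψ lam)⁻¹)
    (hW : ∀ β : ℝ, 0 < β → β < 1 → ∃ r < 1, ∀ᶠ w in 𝓝[>] (0 : ℝ), W (β * w) ≤ r * W w)
    {γ ε η : ℝ} (hγ0 : 0 < γ) (hγ1 : γ < 1) (hε0 : 0 < ε) (hε1 : ε < 1) (hη : 0 < η) :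
    ∃ q : ℕ → ℝ, Tendsto q atTop atTop ∧ ∀ᵐ ω ∂P, ∃ᶠ k in atTop, ∃ r u : ℝ, 0 ≤ r ∧ r ≤ u ∧
      Y r ω ≤ ε * (γ * (Real.log (Real.log (q k)) / q k)) ∧
      γ * (Real.log (Real.log (q k)) / q k) < Y u ω ∧ Y (u + (1 + 2 * η) * φ (q k)) ω = 0 := by
  obtain ⟨q, hq, hqA, hqs⟩ := exists_level_sequence hγ0 hγ1
  refine ⟨q, hq, ?_⟩
  obtain ⟨U, hU, hphi⟩ := h.exists_phi_mul_psi_le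
  obtain ⟨c, hc, hphi'⟩ := h.exists_le_phi_mul_psi
  obtain ⟨M, hM, hphiM⟩ := h.exists_phi_mul_le hη
  obtain ⟨D, hD, hdoub⟩ := h.doubling
  obtain ⟨r, hr1, hWr⟩ := hW (1 - ε / 8) (by linarith) (by linarith)
  obtain ⟨w0, hw0, hWr⟩ := (mem_nhdsGT_iff_exists_Ioc_subset (a := (0 : ℝ))).1 hWr
  have hw0 : 0 < w0 := hw0
  set L : ℕ → ℝ := fun k => Real.log (Real.log (q k)) with hLdef
  have hL : Tendsto L atTop atTop := tendsto_log_log_atTop.comp hq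
  set y : ℕ → ℝ := fun k => γ * (L k / q k) with hydef
  have hylim : Tendsto y atTop (𝓝 0) := by
    simpa using (tendsto_log_log_div_atTop.comp hq).const_mul γ
  have hexp : Tendsto (fun k => D * Real.exp (-(γ * L k))) atTop (𝓝 0) := by
    simpa using (Real.tendsto_exp_neg_atTop_nhds_zero.comp (hL.const_mul_atTop hγ0)).const_mul D
  obtain ⟨K, hK⟩ := eventually_atTop.1 (((hq.eventually_ge_atTop 2).and
    (hL.eventually_ge_atTop 1)).and (((hL.eventually_ge_atTop (2 * Real.log 2 / γ)).and
    (hylim.eventually_le_const (show 0 < w0 / 4 by positivity))).and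
    (((hexp.eventually_le_const one_half_pos).and (hqA (8 * U / (1 - r)))).and
    ((hqs.tendsto_atTop_zero.eventually_le_const one_pos).and (eventually_ge_atTop 1)))))
  have hq2 : ∀ k, K ≤ k → 2 ≤ q k := fun k hk => (hK k hk).1.1
  have hq0 : ∀ k, K ≤ k → 0 < q k := fun k hk => by linarith [hq2 k hk]
  have hL1 : ∀ k, K ≤ k → 1 ≤ L k := fun k hk => (hK k hk).1.2
  have hy0 : ∀ k, K ≤ k → 0 < y k := fun k hk => by
    have := hL1 k hk
    have := hq0 k hk
    positivity
  have hqy : ∀ k, K ≤ k → q k * y k = γ * L k := fun k hk => by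
    have := hq0 k hk
    simp only [hydef]
    field_simp
  have ht0 : ∀ k, K ≤ k → 0 < φ (q k) := fun k hk => h.phi_pos _ (hq0 k hk)
  have hzq : ∀ k, ε * y (k + 1) * q k = ε * γ * (L (k + 1) / q (k + 1) * q k) := fun k => by
    simp only [hydef]
    ring
  have hmain := hY.ae_frequently_exceed h hx hY0 (y := y) (t := fun k => φ (q k))
    (s := fun k => η * φ (q k)) (z := fun k => ε * y k)
    (d := fun k => ε * y (k + 1) * q k * (D / (2 * c))) (π := fun k => 1 / (k : ℝ)) (K := K)
    (fun k hk => (hy0 k hk).le) ht0 (fun k hk => mul_pos hη (ht0 k hk))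
    (fun k hk => mul_pos hε0 (hy0 k hk)) (fun k hk => ?_) (by simpa using hylim.const_mul ε)
    (fun k _ => by positivity) (fun k hk => ?_) Real.not_summable_one_div_natCast
    (fun k hk => ?_) ?_ ?_ (fun k hk p hp G hG hGz => ?_) (fun k hk p hp G hG hGz => ?_)
  · filter_upwards [hmain] with ω hω
    refine hω.mono fun k hk => ?_
    obtain ⟨r', u, h1, h2, h3, h4, h5⟩ := hk
    refine ⟨r', u, h1, h2, h3, h4, ?_⟩
    rw [← h5]
    congr 1
    ring
  · have h1 : L (k + 1) / q (k + 1) * q k ≤ L k := ((hK k hk).2.2.2.1).trans (hL1 k hk)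
    rw [← le_div_iff₀ (hq0 k hk)] at h1
    simp only [hydef]
    gcongr
  · have : (1 : ℝ) ≤ k := by exact_mod_cast (hK k hk).2.2.2.2
    rw [div_le_one (by linarith)]
    exact this
  · have := hy0 (k + 1) (by lia)
    have := hq0 k hk
    positivity
  · simp only [hzq]
    exact (hqs.mul_left _).mul_right _
  · refine Summable.of_norm_bounded_eventually_nat
      (g := fun k => ε * γ * (L (k + 1) / q (k + 1) * q k) * M) ((hqs.mul_left _).mul_right _) ?_
    filter_upwards [eventually_ge_atTop K] with k hk
    have h1 := hy0 (k + 1) (by lia)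
    have h2 := mul_pos hη (ht0 k hk)
    have h3 := h.inv_pos _ h2
    have h4 : φinv (η * φ (q k)) ≤ M * q k :=
      (h.inv_le_iff h2 (mul_pos (by linarith) (hq0 k hk))).2 (hphiM _ (by linarith [hq2 k hk]))
    rw [Real.norm_of_nonneg (by positivity), ← hzq]
    calc ε * y (k + 1) * φinv (η * φ (q k)) ≤ ε * y (k + 1) * (M * q k) := by gcongr
      _ = ε * y (k + 1) * q k * M := by ring
  · refine (hY.setLIntegral_occupation_le h.toGreyExponent hp (ht0 k hk)
      (h.invl _ (hq0 k hk)) ?_ hG hGz).trans ?_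
    · rw [hqy k hk]
      have := (hK k hk).2.1.1
      rw [div_le_iff₀ hγ0] at this
      linarith
    · refine mul_le_mul_left (ENNReal.ofReal_le_ofReal ?_) _
      have h1 := hy0 (k + 1) (by lia)
      have h2 := hq0 k hk
      have h3 := hdoub (q k / 2) (by linarith [hq2 k hk])
      have h4 := hphi' (q k) (by linarith [hq2 k hk])
      have h5 := h.pos (q k / 2) (by linarith)
      rw [mul_div_cancel₀ _ (two_ne_zero' ℝ)] at h3
      have h6 : q k / 2 / ψ (q k / 2) ≤ φ (q k) * (D / (2 * c)) := by
        rw [div_le_iff₀ h5]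
        have h7 : c * q k ≤ φ (q k) * (D * ψ (q k / 2)) :=
          h4.trans (mul_le_mul_of_nonneg_left h3 (ht0 k hk).le)
        calc q k / 2 = c * q k / (2 * c) := by field_simp
          _ ≤ φ (q k) * (D * ψ (q k / 2)) / (2 * c) := by gcongr
          _ = _ := by ring
      calc ε * y (k + 1) * q k * (q k / 2 / ψ (q k / 2))
          ≤ ε * y (k + 1) * q k * (φ (q k) * (D / (2 * c))) := by gcongr
        _ = _ := by ring
  · have h1 := hy0 k hk
    have h2 := hq0 k hk
    have h3 := hdoub (q k / 2) (by linarith [hq2 k hk])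
    rw [mul_div_cancel₀ _ (two_ne_zero' ℝ)] at h3
    have hlow := hY.le_setLIntegral_occupation h.toGreyExponent hWnonneg hWmono hWlaplace
      (y := y k) (t := φ (q k)) (p := p) (z := ε * y k / 2) (q := q k) (D := D)
      (β := 1 - ε / 8) (r := r) hp (ht0 k hk) (h.invl _ h2) h1 h3
      (by rw [hqy k hk]; exact (hK k hk).2.2.1.1) hr1.le (by linarith) (by linarith) (by linarith)
      (fun w hw1 hw2 => hWr ⟨h1.trans hw1, by linarith [(hK k hk).2.1.2]⟩) hG hGz
    refine le_trans (mul_le_mul_left (ENNReal.ofReal_le_ofReal ?_) _) hlow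
    have h4 := (hK k hk).2.2.1.2
    have h5 := hphi (q k) (by linarith [hq2 k hk])
    have h6 := h.pos _ h2
    have hk1 : (1 : ℝ) ≤ k := by exact_mod_cast (hK k hk).2.2.2.2
    have hr0 : 0 < 1 - r := by linarith
    have h7 : 8 * U * (γ * L k) ≤ (1 - r) * (k * Real.exp (-(γ * L k))) := by
      rw [div_mul_eq_mul_div, div_le_iff₀ hr0] at h4
      linarith
    rw [← hqy k hk] at h7
    rw [div_mul_div_comm, mul_one_div, div_le_div_iff₀ (by linarith) (by positivity)]
    calc φ (q k) * (4 * y k * (2 * ψ (q k))) = 8 * y k * (φ (q k) * ψ (q k)) := by ring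
      _ ≤ 8 * y k * (U * q k) := by gcongr
      _ = 8 * U * (q k * y k) := by ring
      _ ≤ _ := h7.trans (le_of_eq (by ring))

end BranchingProcess

lemma log_log_div_le {p q : ℝ} (hp : Real.exp (Real.exp 1) ≤ p) (hpq : p ≤ q) :
    Real.log (Real.log q) / q ≤ Real.log (Real.log p) / p := by
  have he : 0 < Real.exp 1 := Real.exp_pos 1
  have he1 : 1 ≤ Real.exp 1 := Real.one_le_exp zero_le_one
  have hp0 : 0 < p := (Real.exp_pos _).trans_le hp
  have hlp : Real.exp 1 ≤ Real.log p := (Real.le_log_iff_exp_le hp0).2 hp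
  have hlpq : Real.log p ≤ Real.log q := Real.log_le_log hp0 hpq
  have hp1 : Real.exp 1 ≤ p := (Real.exp_le_exp.2 he1).trans hp
  have h1 := Real.log_div_self_antitoneOn hlp (hlp.trans hlpq) hlpq
  have h2 := Real.log_div_self_antitoneOn hp1 (hp1.trans hpq) hpq
  simp only at h1 h2
  have hlp0 : 0 < Real.log p := he.trans_le hlp
  have hlq0 : 0 < Real.log q := hlp0.trans_le hlpq
  have h3 : 0 ≤ Real.log (Real.log p) / Real.log p :=
    div_nonneg (Real.log_nonneg (he1.trans hlp)) hlp0.le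
  have h4 : 0 ≤ Real.log q / q := div_nonneg hlq0.le (by linarith)
  calc Real.log (Real.log q) / q = Real.log (Real.log q) / Real.log q * (Real.log q / q) := by
        field_simp
    _ ≤ Real.log (Real.log p) / Real.log p * (Real.log p / p) := by gcongr
    _ = Real.log (Real.log p) / p := by field_simp

namespace BranchingProcess

variable {Ω : Type*} [mΩ : MeasurableSpace Ω] {ψ φ φinv : ℝ → ℝ} {P : Measure Ω}
  {Y : ℝ → Ω → ℝ} {W : ℝ → ℝ}

lemma eventually_le_sub_sInf (hY : BranchingProcess φ φinv P Y) {ω : Ω} {r u b c : ℝ}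
    (hr : 0 ≤ r) (hru : r ≤ u) (hb : Y r ω ≤ b) (hc : c < Y u ω) :
    ∀ᶠ v in 𝓝[>] u, c - b ≤ Y v ω - sInf ((fun s => Y s ω) '' Icc 0 v) := by
  filter_upwards [hY.eventually_nhdsGT ω (hr.trans hru) isOpen_Ioi hc, self_mem_nhdsWithin]
    with v hv huv
  have h1 : sInf ((fun s => Y s ω) '' Icc 0 v) ≤ Y r ω := by
    refine csInf_le ⟨0, ?_⟩ ⟨r, ⟨hr, hru.trans (le_of_lt huv)⟩, rfl⟩
    rintro _ ⟨s, hs, rfl⟩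
    exact hY.nonneg s hs.1 ω
  have hv : c < Y v ω := hv
  linarith

variable [IsProbabilityMeasure P]

lemma ae_frequently_le_sub_sInf (hY : BranchingProcess φ φinv P Y)
    (h : RegularExponent ψ φ φinv) {x : ℝ} (hx : 0 < x) (hY0 : ∀ᵐ ω ∂P, Y 0 ω = x)
    (hWnonneg : ∀ y : ℝ, 0 ≤ y → 0 ≤ W y) (hWmono : MonotoneOn W (Ici 0))
    (hWlaplace : ∀ lam : ℝ, 0 < lam →
      ∫ y in Set.Ioi (0 : ℝ), Real.exp (-lam * y) * W y = (ψ lam)⁻¹)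
    (hW : ∀ β : ℝ, 0 < β → β < 1 → ∃ r < 1, ∀ᶠ w in 𝓝[>] (0 : ℝ), W (β * w) ≤ r * W w)
    {θ : ℝ} (hθ0 : 0 < θ) (hθ1 : θ < 1) :
    ∀ᵐ ω ∂P, ∀ T : ℝ, (∀ s : ℝ, 0 ≤ s → (Y s ω = 0 ↔ T ≤ s)) →
      ∃ᶠ t in 𝓝[>] (0 : ℝ), t < T ∧ ∀ᶠ v in 𝓝[<] (T - t),
        θ * (Real.log (Real.log (φinv t)) / φinv t) ≤
          Y v ω - sInf ((fun s => Y s ω) '' Icc 0 v) := by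
  obtain ⟨C, hC, hcmp⟩ := h.exists_inv_comparison
  set a : ℝ := (1 - θ) / 3 with ha
  have ha0 : 0 < a := by rw [ha]; linarith
  have ha1 : a < 1 / 2 := by rw [ha]; linarith
  have hθa : θ ≤ (1 - a) * (1 - a) * (1 - a) := by nlinarith [sq_nonneg a]
  obtain ⟨q, hq, hfreq⟩ := hY.exists_ae_frequently_exceed h hx hY0 hWnonneg hWmono hWlaplace hW
    (γ := 1 - a) (ε := a) (η := a / (2 * C)) (by linarith) (by linarith) ha0 (by linarith)
    (by positivity)
  have hηC : 1 + 2 * (a / (2 * C)) = 1 + a / C := by field_simp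
  rw [hηC] at hfreq
  have haC : 0 < a / C := by positivity
  filter_upwards [hfreq] with ω hω T hT
  refine frequently_iff.2 fun {U} hU => ?_
  obtain ⟨t0, ht0, hU⟩ := mem_nhdsGT_iff_exists_Ioc_subset.1 hU
  have ht0 : 0 < t0 := ht0
  have hsmall : Tendsto (fun k => (1 + a / C) * φ (q k)) atTop (𝓝 0) := by
    simpa using (h.tendsto_phi_atTop.comp hq).const_mul (1 + a / C)
  obtain ⟨k, ⟨r, u, hr, hru, hYr, hYu, hY0'⟩, hk1, hkq⟩ := (hω.and_eventually
    ((hsmall.eventually_le_const ht0).and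
      (hq.eventually_ge_atTop (2 * Real.exp (Real.exp 1))))).exists
  have he : 1 ≤ Real.exp (Real.exp 1) := Real.one_le_exp (Real.exp_pos 1).le
  have hq0 : 0 < q k := by linarith
  have hφ0 := h.phi_pos _ hq0
  set g : ℝ := Real.log (Real.log (q k)) / q k with hg
  have hu0 := hr.trans hru
  have hl1 : 1 ≤ Real.log (q k) := by
    rw [Real.le_log_iff_exp_le hq0]
    have : Real.exp 1 ≤ Real.exp (Real.exp 1) :=
      Real.exp_le_exp.2 (Real.one_le_exp zero_le_one)
    linarith
  have hg0 : 0 ≤ g := div_nonneg (Real.log_nonneg hl1) hq0.le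
  have hYu0 : Y u ω ≠ 0 := by
    have : 0 ≤ (1 - a) * g := mul_nonneg (by linarith) hg0
    exact (this.trans_lt hYu).ne'
  have huT : u < T := not_le.1 fun hle => hYu0 ((hT u hu0).2 hle)
  have hTu : T ≤ u + (1 + a / C) * φ (q k) := (hT _ (by positivity)).1 hY0'
  obtain ⟨v0, hv0, hsub⟩ := mem_nhdsGT_iff_exists_Ioc_subset.1
    (hY.eventually_le_sub_sInf hr hru hYr hYu)
  have hv0 : u < v0 := hv0
  obtain ⟨s, hus, hs⟩ := exists_between (lt_min hv0 huT)
  have hsv := hs.trans_le (min_le_left _ _)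
  have hsT := hs.trans_le (min_le_right _ _)
  have ht : 0 < T - s := by linarith
  have htk : T - s ≤ (1 + a / C) * φ (q k) := by linarith
  refine ⟨T - s, hU ⟨ht, by linarith⟩, by linarith, ?_⟩
  rw [sub_sub_cancel]
  filter_upwards [Ioo_mem_nhdsLT hus] with v hv
  refine le_trans ?_ (hsub ⟨hv.1, hv.2.le.trans hsv.le⟩)
  have hinv := hcmp (φ (q k)) (T - s) (a / C) hφ0 ht haC.le
    (by rw [h.invl _ hq0]; linarith) htk
  rw [h.invl _ hq0, div_mul_cancel₀ _ hC.ne'] at hinv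
  have hqa : Real.exp (Real.exp 1) ≤ (1 - a) * q k := by nlinarith
  have ha1' : 0 < 1 - a := by linarith
  have hqa0 : 0 < (1 - a) * q k := by positivity
  have hle : (1 - a) * q k ≤ q k := by nlinarith
  have hll : Real.log (Real.log ((1 - a) * q k)) ≤ Real.log (Real.log (q k)) := by
    refine Real.log_le_log ?_ (Real.log_le_log hqa0 hle)
    have := (Real.le_log_iff_exp_le hqa0).2 hqa
    exact (Real.exp_pos 1).trans_le this
  have h1 : Real.log (Real.log (φinv (T - s))) / φinv (T - s) ≤ g / (1 - a) := by
    refine (log_log_div_le hqa hinv).trans ?_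
    rw [hg, div_div, mul_comm (q k)]
    gcongr
  calc θ * (Real.log (Real.log (φinv (T - s))) / φinv (T - s)) ≤ θ * (g / (1 - a)) := by gcongr
    _ ≤ (1 - a) * (1 - a) * (1 - a) * (g / (1 - a)) := by gcongr
    _ = (1 - a) * g - a * ((1 - a) * g) := by field_simp

end BranchingProcess

lemma exists_ratio_bound_of_limsup_lt {W : ℝ → ℝ} (hWnonneg : ∀ y : ℝ, 0 ≤ y → 0 ≤ W y)
    (hWmono : MonotoneOn W (Ici 0)) {β : ℝ} (hβ0 : 0 < β) (hβ1 : β < 1)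
    (hlim : limsup (fun y => W (β * y) / W y) (𝓝[>] (0 : ℝ)) < 1) :
    ∃ r < 1, ∀ᶠ w in 𝓝[>] (0 : ℝ), W (β * w) ≤ r * W w := by
  have hle : ∀ y : ℝ, 0 < y → W (β * y) ≤ W y := fun y hy =>
    hWmono (mem_Ici.2 (by positivity)) (mem_Ici.2 hy.le) (by nlinarith)
  obtain ⟨r, hr, hr1⟩ := exists_between hlim
  have hbdd : IsBoundedUnder (· ≤ ·) (𝓝[>] (0 : ℝ)) fun y => W (β * y) / W y := by
    refine isBoundedUnder_of_eventually_le (a := 1) ?_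
    filter_upwards [self_mem_nhdsWithin] with y hy
    exact div_le_one_of_le₀ (hle y hy) (hWnonneg y (le_of_lt hy))
  refine ⟨r, hr1, ?_⟩
  filter_upwards [eventually_lt_of_limsup_lt hr hbdd, self_mem_nhdsWithin] with y hy hy0
  have hy0 : 0 < y := hy0
  rcases (hWnonneg y hy0.le).eq_or_lt with h0 | h0
  · have := hle y hy0
    rw [← h0] at this ⊢
    simpa using this
  · exact ((div_lt_iff₀ h0).1 hy).le

lemma sInf_zeros_le_iff {f : ℝ → ℝ}
    (hright : ∀ t : ℝ, 0 ≤ t → ContinuousWithinAt f (Ici t) t) (hpos : f 0 ≠ 0)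
    (habs : ∀ s r : ℝ, 0 ≤ s → s ≤ r → f s = 0 → f r = 0) (hex : ∃ t : ℝ, 0 ≤ t ∧ f t = 0) :
    0 < sInf {s : ℝ | 0 ≤ s ∧ f s = 0} ∧
      ∀ s : ℝ, 0 ≤ s → (f s = 0 ↔ sInf {s : ℝ | 0 ≤ s ∧ f s = 0} ≤ s) := by
  set S := {s : ℝ | 0 ≤ s ∧ f s = 0} with hS
  set T := sInf S with hT
  have hbdd : BddBelow S := ⟨0, fun s hs => hs.1⟩
  have hT0 : 0 ≤ T := Real.sInf_nonneg fun s hs => hs.1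
  have hfT : f T = 0 := by
    by_contra hne
    have hev := (hright T hT0).eventually_mem (isOpen_compl_singleton.mem_nhds hne)
    obtain ⟨c, hc, hcS⟩ := (mem_nhdsGE_iff_exists_Ico_subset' (lt_add_one T)).1 hev
    obtain ⟨s, hs, hsc⟩ := exists_lt_of_csInf_lt hex (show sInf S < c from hc)
    exact hcS ⟨csInf_le hbdd hs, hsc⟩ hs.2
  refine ⟨hT0.lt_of_ne fun h0 => hpos (h0 ▸ hfT), fun s hs => ⟨fun h => csInf_le hbdd ⟨hs, h⟩,
    fun h => habs T s hT0 h hfT⟩⟩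

lemma limsup_eq_one_of_forall_nat {α : Type*} {l : Filter α} {F : α → ℝ}
    (hup : ∀ n : ℕ, ∀ᶠ t in l, F t ≤ 1 + 1 / ((n : ℝ) + 1))
    (hlo : ∀ n : ℕ, ∃ᶠ t in l, 1 - 1 / ((n : ℝ) + 1 + 1) ≤ F t) : limsup F l = 1 := by
  have h1 : Tendsto (fun n : ℕ => 1 + 1 / ((n : ℝ) + 1)) atTop (𝓝 1) := by
    simpa using (tendsto_one_div_add_atTop_nhds_zero_nat (𝕜 := ℝ)).const_add 1
  have h2 : Tendsto (fun n : ℕ => 1 - 1 / ((n : ℝ) + 1 + 1)) atTop (𝓝 1) := by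
    have := ((tendsto_one_div_add_atTop_nhds_zero_nat (𝕜 := ℝ)).comp
      (tendsto_add_atTop_nat 1)).const_sub 1
    simpa using this
  have hcob : IsCoboundedUnder (· ≤ ·) l F := IsCoboundedUnder.of_frequently_ge (hlo 0)
  have hbdd : IsBoundedUnder (· ≤ ·) l F := isBoundedUnder_of_eventually_le (hup 0)
  exact le_antisymm (ge_of_tendsto' h1 fun n => limsup_le_of_le hcob (hup n))
    (le_of_tendsto' h2 fun n => le_limsup_of_frequently_le (hlo n) hbdd)

lemma GreyExponent.eventually_rate_pos {ψ φ φinv : ℝ → ℝ} (h : GreyExponent ψ φ φinv) :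
    ∀ᶠ t in 𝓝[>] (0 : ℝ), 1 < φinv t ∧ 0 < Real.log (φinv t) ∧
      0 < Real.log (Real.log (φinv t)) :=
  h.tendsto_inv_zero.eventually ((eventually_gt_atTop 1).and
    ((Real.tendsto_log_atTop.eventually_gt_atTop 0).and
      (tendsto_log_log_atTop.eventually_gt_atTop 0)))

/-- An eventual upper bound on a path before its extinction time passes to the left limits of the
path reflected at its infimum. -/
lemma GreyExponent.eventually_reflected_le {ψ φ φinv : ℝ → ℝ} (h : GreyExponent ψ φ φinv)
    {f R : ℝ → ℝ} {T θ : ℝ} (hT : 0 < T) (hf : ∀ t : ℝ, 0 ≤ t → 0 ≤ f t)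
    (hR : ∀ s : ℝ, 0 < s → Tendsto (fun u => f u - sInf (f '' Icc 0 u)) (𝓝[<] s) (𝓝 (R s)))
    (hle : ∀ᶠ t in 𝓝[>] (0 : ℝ), f (T - t) ≤ θ * (Real.log (Real.log (φinv t)) / φinv t)) :
    ∀ᶠ t in 𝓝[>] (0 : ℝ), R (T - t) ≤ θ * (Real.log (Real.log (φinv t)) / φinv t) := by
  obtain ⟨c, hc, hcle⟩ := (mem_nhdsGT_iff_exists_Ioo_subset' hT).1 hle
  filter_upwards [Ioo_mem_nhdsGT (lt_min hT hc), h.eventually_rate_pos] with t ht hrate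
  obtain ⟨ht0, ht1⟩ := ht
  have htT : 0 < T - t := by linarith [ht1.trans_le (min_le_left T c)]
  have htc : t < c := ht1.trans_le (min_le_right T c)
  set g : ℝ → ℝ := fun t => θ * (Real.log (Real.log (φinv t)) / φinv t) with hg
  have hgc : ContinuousAt g t :=
    continuousAt_const.mul ((((h.inv_continuousAt ht0).log (by linarith)).log
      hrate.2.1.ne').div (h.inv_continuousAt ht0) (by linarith))
  have hgl : Tendsto (fun u => g (T - u)) (𝓝[<] (T - t)) (𝓝 (g t)) := by
    have h1 : Tendsto (fun u => T - u) (𝓝 (T - t)) (𝓝 t) := by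
      simpa using (tendsto_id (α := ℝ) (x := 𝓝 (T - t))).const_sub T
    exact (hgc.tendsto.comp h1).mono_left nhdsWithin_le_nhds
  refine le_of_tendsto_of_tendsto (hR (T - t) htT) hgl ?_
  have hmax : max 0 (T - c) < T - t := max_lt htT (by linarith)
  filter_upwards [Ioo_mem_nhdsLT hmax] with u hu
  have hu0 : 0 < u := (le_max_left _ _).trans_lt hu.1
  have huc : T - c < u := (le_max_right _ _).trans_lt hu.1
  have hinf : 0 ≤ sInf (f '' Icc 0 u) := Real.sInf_nonneg (by
    rintro _ ⟨s, hs, rfl⟩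
    exact hf s hs.1)
  have hfu : f (T - (T - u)) ≤ g (T - u) := hcle ⟨by linarith [hu.2], by linarith⟩
  rw [sub_sub_cancel] at hfu
  linarith

end CSBP

open CSBP
theorem LIL_reflected_near_extinction
    (ψ : ℝ → ℝ) (a b : ℝ) (hb : 0 ≤ b) (ν : Measure ℝ)
    (hνsupp : ν (Set.Iic 0) = 0)
    (hνint : ∫⁻ x, ENNReal.ofReal (min 1 (x ^ 2)) ∂ν ≠ ⊤)
    (hψform : ∀ l : ℝ, 0 ≤ l →
      ψ l = a * l + b * l ^ 2 +
        ∫ x, (Real.exp (-l * x) - 1 + l * x * Set.indicator (Set.Iio 1) (fun _ => (1 : ℝ)) x) ∂ν)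
    (hψpos : ∀ u : ℝ, 0 < u → 0 < ψ u)
    (hGrey : ∀ t : ℝ, 0 < t → IntegrableOn (fun u => (ψ u)⁻¹) (Set.Ioi t))
    (hdiv : ¬ IntegrableOn (fun u => (ψ u)⁻¹) (Set.Ioc 0 1))
    (φ : ℝ → ℝ)
    (hφ : ∀ t : ℝ, 0 < t → φ t = ∫ u in Set.Ioi t, (ψ u)⁻¹)
    (hφanti : StrictAntiOn φ (Set.Ioi 0))
    (hφcont : ContinuousOn φ (Set.Ioi 0))
    (hφbij : Set.BijOn φ (Set.Ioi 0) (Set.Ioi 0))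
    (φinv : ℝ → ℝ)
    (hφinvpos : ∀ s : ℝ, 0 < s → 0 < φinv s)
    (hinvl : ∀ t : ℝ, 0 < t → φinv (φ t) = t)
    (hinvr : ∀ s : ℝ, 0 < s → φ (φinv s) = s)
    (hδ : 1 < sSup {c : ℝ | 0 ≤ c ∧ ∃ Q : ℝ, 0 < Q ∧
      ∀ u v : ℝ, 1 ≤ u → u ≤ v → Q * ψ u * u ^ (-c) ≤ ψ v * v ^ (-c)})
    (x : ℝ) (hx : 0 < x)
    {Ω : Type*} [MeasurableSpace Ω] (P : Measure Ω) [IsProbabilityMeasure P]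
    (Y : ℝ → Ω → ℝ) (hYmeas : ∀ t : ℝ, Measurable (Y t))
    (hYnonneg : ∀ t : ℝ, 0 ≤ t → ∀ ω, 0 ≤ Y t ω)
    (hYright : ∀ ω, ∀ t : ℝ, 0 ≤ t → ContinuousWithinAt (fun s => Y s ω) (Set.Ici t) t)
    (hY0 : ∀ᵐ ω ∂P, Y 0 ω = x)
    (hMarkov : ∀ s t : ℝ, 0 ≤ s → 0 ≤ t → ∀ lam : ℝ, 0 < lam →
      P[(fun ω => Real.exp (-lam * Y (t + s) ω)) |
          ⨆ u ∈ Set.Icc (0 : ℝ) t, MeasurableSpace.comap (Y u) inferInstance]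
        =ᵐ[P] fun ω => Real.exp (-(Y t ω) * φinv (s + φ lam)))
    (W : ℝ → ℝ) (hWnonneg : ∀ y : ℝ, 0 ≤ y → 0 ≤ W y)
    (hWmono : MonotoneOn W (Set.Ici 0))
    (hWlaplace : ∀ lam : ℝ, 0 < lam →
      ∫ y in Set.Ioi (0 : ℝ), Real.exp (-lam * y) * W y = (ψ lam)⁻¹)
    (hH : ∀ β : ℝ, 0 < β → β < 1 →
      Filter.limsup (fun y => W (β * y) / W y) (𝓝[>] (0 : ℝ)) < 1)
    (Rleft : ℝ → Ω → ℝ)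
    (hRleft : ∀ ω, ∀ s : ℝ, 0 < s →
      Tendsto (fun u => Y u ω - sInf ((fun v => Y v ω) '' Set.Icc 0 u))
        (𝓝[<] s) (nhds (Rleft s ω))) :
    ∀ᵐ ω ∂P,
      Filter.limsup (fun t : ℝ =>
          Rleft (sInf {s : ℝ | 0 ≤ s ∧ Y s ω = 0} - t) ω *
            φinv t / Real.log (Real.log (φinv t)))
        (𝓝[>] (0 : ℝ)) = 1 := by
  obtain ⟨c, Q, hc, hQ, hpow⟩ : ∃ c Q : ℝ, 1 < c ∧ 0 < Q ∧
      ∀ u v : ℝ, 1 ≤ u → u ≤ v → Q * ψ u * u ^ (-c) ≤ ψ v * v ^ (-c) := by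
    have hne : {c : ℝ | 0 ≤ c ∧ ∃ Q : ℝ, 0 < Q ∧
        ∀ u v : ℝ, 1 ≤ u → u ≤ v → Q * ψ u * u ^ (-c) ≤ ψ v * v ^ (-c)}.Nonempty := by
      rw [Set.nonempty_iff_ne_empty]
      intro he
      rw [he, Real.sSup_empty] at hδ
      linarith
    obtain ⟨c, ⟨-, Q, hQ, hpow⟩, hc⟩ := exists_lt_of_lt_csSup hne hδ
    exact ⟨c, Q, hc, hQ, hpow⟩
  obtain ⟨k, hk, hlin⟩ := exists_linear_lower_bound hψpos hc hQ hpow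
  have h : RegularExponent ψ φ φinv :=
    { pos := hψpos
      mono := monotoneOn_of_laplace hψpos hWnonneg hWlaplace
      cont := continuousOn_of_laplace hψpos hWnonneg hWlaplace
      integ := hGrey
      phi_eq := hφ
      phi_anti := hφanti
      phi_pos := fun t ht => hφbij.mapsTo ht
      inv_pos := hφinvpos
      invl := hinvl
      invr := hinvr
      quadratic := exists_quadratic_bound hb hνsupp hνint hψform
      doubling := exists_doubling_bound hb hνsupp hνint hψform hk hlin
      power := ⟨c, Q, hc, hQ, hpow⟩ }
  have hY : BranchingProcess φ φinv P Y := ⟨hYmeas, hYnonneg, hYright, hMarkov⟩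
  have hup := ae_all_iff.2 fun n : ℕ => hY.ae_eventually_le h
    (θ := 1 + 1 / ((n : ℝ) + 1)) (by linarith [Nat.one_div_pos_of_nat (α := ℝ) (n := n)])
  have hlo := ae_all_iff.2 fun n : ℕ => hY.ae_frequently_le_sub_sInf h hx hY0 hWnonneg hWmono
    hWlaplace (fun β hβ0 hβ1 =>
      exists_ratio_bound_of_limsup_lt hWnonneg hWmono hβ0 hβ1 (hH β hβ0 hβ1))
    (θ := 1 - 1 / ((n : ℝ) + 1 + 1))
    (by
      rw [sub_pos, div_lt_one (by positivity)]
      linarith [Nat.cast_nonneg (α := ℝ) n])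
    (sub_lt_self _ (by positivity))
  filter_upwards [hup, hlo, hY0, hY.ae_absorbed h.toGreyExponent,
    hY.ae_exists_extinct h.toGreyExponent hY0] with ω hup hlo hω0 habs hex
  obtain ⟨hT, hiff⟩ := sInf_zeros_le_iff (hYright ω) (by simp only [hω0]; exact hx.ne') habs hex
  set T := sInf {s : ℝ | 0 ≤ s ∧ Y s ω = 0} with hTdef
  have hrate := h.eventually_rate_pos
  refine limsup_eq_one_of_forall_nat (fun n => ?_) fun n => ?_
  · have hev := h.eventually_reflected_le hT (fun t ht => hYnonneg t ht ω) (hRleft ω)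
      (hup n T hT fun s hs => (hiff s (hT.le.trans hs)).2 hs)
    filter_upwards [hev, hrate] with t ht hr
    rw [div_le_iff₀ hr.2.2, ← le_div_iff₀ (by linarith), mul_div_assoc]
    exact ht
  · refine ((hlo n T hiff).and_eventually hrate).mono fun t ht => ?_
    obtain ⟨⟨htT, hv⟩, hr⟩ := ht
    have hge := ge_of_tendsto (hRleft ω (T - t) (by linarith)) hv
    rw [le_div_iff₀ hr.2.2, ← div_le_iff₀ (by linarith), mul_div_assoc]
    exact hge
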